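/- Let A : [1,∞) → ℝ^{d×d} be continuous such that x'=A(t)x admits a nonuniform strong polynomial dichotomy with nonuniformity exponent ε≥0, and let 𝒮 = (‖·‖_t)_{t≥1} be a family of norms with respect to which the equation admits a strong polynomial dichotomy and satisfying ‖x‖ ≤ ‖x‖_t ≤ C·t^{2ε}‖x‖ for all x,t. Suppose the spectrum Σ_{PD,A(·),𝒮} = ⋃_{i=1}^r [log a_i/log 2, log b_i/log 2] where a_1≤b_1<···<a_k≤b_k<1<a_{k+1}≤···<a_r≤b_r, a_{k+1}/b_k > max{b_r, a_1^{-1}}, b_i/a_i < b_k^{-1} for i=1,…,k, and b_j/a_j < a_{k+1} for j=k+1,…,r. Let f : [1,∞)×ℝ^d → ℝ^d be C¹ with f(t,0)=0, D_xf(t,0)=0, ‖D_xf(t,x)‖ ≤ η/t^{1+4ε}, and ‖D_xf(t,x)−D_xf(t,y)‖ ≤ L/t^{1+5ε}·‖x−y‖ for all t≥1, x,y∈ℝ^d, with constants η,L>0. Then there exists η₀>0 such that if η≤η₀, there exist C¹ maps H,G : [1,∞)×ℝ^d → ℝ^d such that: (i) if x(t) solves x'=A(t)x+f(t,x) then H(t,x(t))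 solves x'=A(t)x; (ii) if x(t) solves x'=A(t)x then G(t,x(t)) solves x'=A(t)x+f(t,x); (iii) H(t,G(t,x))=x and G(t,H(t,x))=x for all t≥1, x∈ℝ^d; (iv) there exist R,ζ>0 such that ‖D_xH(t,x)‖ ≤ R·t^{4ε} and ‖D_xG(t,x)‖ ≤ R·t^{4ε} for all t≥1 and x∈ℝ^d with ‖x‖ ≤ ζ/t^{3ε}. -/

import Mathlib

noncomputable section

namespace NonautLin

variable {E : Type*} [NormedAddCommGroup E] [NormedSpace ℝ E]

/-- `N : E → ℝ` is a norm on the real vector space `E`. -/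
def IsNormOn (N : E → ℝ) : Prop :=
  (∀ x, 0 ≤ N x) ∧ (∀ x, N x = 0 ↔ x = 0) ∧
  (∀ (c : ℝ) (x : E), N (c • x) = |c| * N x) ∧
  (∀ x y : E, N (x + y) ≤ N x + N y)

/-- Multiplication by the scalar `c` as a continuous linear equivalence
(junk value `id` for `c = 0`). -/
def smulCLE (c : ℝ) : E ≃L[ℝ] E :=
  if hc : c = 0 then ContinuousLinearEquiv.refl ℝ E
  else
    { toFun := fun x => c • x
      invFun := fun x => c⁻¹ • x
      map_add' := fun x y => smul_add c x y
      map_smul' := fun a x => smul_comm c a x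
      left_inv := fun x => by simp [smul_smul, inv_mul_cancel₀ hc]
      right_inv := fun x => by simp [smul_smul, mul_inv_cancel₀ hc]
      continuous_toFun := continuous_const_smul c
      continuous_invFun := continuous_const_smul c⁻¹ }

/-- The operator `c • A` as a continuous linear equivalence. -/
def scale (c : ℝ) (A : E ≃L[ℝ] E) : E ≃L[ℝ] E := A.trans (smulCLE c)

/-- `T` is the evolution family of the linear equation `x' = A(t)x` on `[1,∞)`. -/
def IsEvolutionFamily (A : ℝ → (E →L[ℝ] E)) (T : ℝ → ℝ → (E ≃L[ℝ] E)) : Prop :=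
  (∀ s : ℝ, 1 ≤ s → T s s = ContinuousLinearEquiv.refl ℝ E) ∧
  (∀ t r s : ℝ, 1 ≤ s → 1 ≤ r → 1 ≤ t → ∀ x : E, T t r (T r s x) = T t s x) ∧
  (∀ s : ℝ, 1 ≤ s → ∀ x : E, ∀ t : ℝ, 1 ≤ t →
    HasDerivWithinAt (fun τ => T τ s x) (A t (T t s x)) (Set.Ici 1) t)

/-- Nonuniform strong polynomial dichotomy for an evolution family, with nonuniformity
exponent `eps`. -/
def CNonuniformStrongPolyDichotomyWith (T : ℝ → ℝ → (E ≃L[ℝ] E)) (eps : ℝ) : Prop :=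
  ∃ K lam a : ℝ, 0 < K ∧ 0 < lam ∧ lam ≤ a ∧
    ∃ P : ℝ → (E →L[ℝ] E),
      (∀ t : ℝ, 1 ≤ t → (P t).comp (P t) = P t) ∧
      (∀ t s : ℝ, 1 ≤ s → s ≤ t →
        (P t).comp (T t s : E →L[ℝ] E) = ((T t s : E →L[ℝ] E)).comp (P s)) ∧
      (∀ t s : ℝ, 1 ≤ s → s ≤ t →
        ‖((T t s : E →L[ℝ] E)).comp (P s)‖ ≤ K * (t / s) ^ (-lam) * s ^ eps ∧
        ‖((T s t : E →L[ℝ] E)).comp (ContinuousLinearMap.id ℝ E - P t)‖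
          ≤ K * (t / s) ^ (-lam) * t ^ eps ∧
        ‖(T t s : E →L[ℝ] E)‖ ≤ K * (t / s) ^ a * s ^ eps ∧
        ‖(T s t : E →L[ℝ] E)‖ ≤ K * (t / s) ^ a * t ^ eps)

/-- Nonuniform strong polynomial dichotomy for an evolution family. -/
def CNonuniformStrongPolyDichotomy (T : ℝ → ℝ → (E ≃L[ℝ] E)) : Prop :=
  ∃ eps : ℝ, 0 ≤ eps ∧ CNonuniformStrongPolyDichotomyWith T eps

/-- Strong polynomial dichotomy for an evolution family w.r.t. a family of norms. -/
def CStrongPolyDichotomyWRT (T : ℝ → ℝ → (E ≃L[ℝ] E)) (N : ℝ → E → ℝ) : Prop :=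
  ∃ K lam a : ℝ, 0 < K ∧ 0 < lam ∧ lam ≤ a ∧
    ∃ P : ℝ → (E →L[ℝ] E),
      (∀ t : ℝ, 1 ≤ t → (P t).comp (P t) = P t) ∧
      (∀ t s : ℝ, 1 ≤ s → s ≤ t →
        (P t).comp (T t s : E →L[ℝ] E) = ((T t s : E →L[ℝ] E)).comp (P s)) ∧
      (∀ t s : ℝ, 1 ≤ s → s ≤ t → ∀ x : E,
        N t (T t s (P s x)) ≤ K * (t / s) ^ (-lam) * N s x ∧
        N s (T s t (x - P t x)) ≤ K * (t / s) ^ (-lam) * N t x ∧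
        N t (T t s x) ≤ K * (t / s) ^ a * N s x ∧
        N s (T s t x) ≤ K * (t / s) ^ a * N t x)

/-- The continuous-time polynomial dichotomy spectrum, defined via the evolution family
`(t/s)^{-τ} T(t,s)` of the shifted equation `x' = (A(t) - (τ/t) Id) x`. -/
def SigmaPDc (T : ℝ → ℝ → (E ≃L[ℝ] E)) (N : ℝ → E → ℝ) : Set ℝ :=
  {τ | ¬ CStrongPolyDichotomyWRT (fun t s => scale ((t / s) ^ (-τ)) (T t s)) N}

/-- `u` is a solution of the linear equation `x' = A(t)x` on `[1,∞)`. -/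
def IsLinSolution (A : ℝ → (E →L[ℝ] E)) (u : ℝ → E) : Prop :=
  ∀ t : ℝ, 1 ≤ t → HasDerivWithinAt u (A t (u t)) (Set.Ici 1) t

/-- `u` is a solution of the semilinear equation `x' = A(t)x + f(t,x)` on `[1,∞)`. -/
def IsSemilinSolution (A : ℝ → (E →L[ℝ] E)) (f : ℝ → E → E) (u : ℝ → E) : Prop :=
  ∀ t : ℝ, 1 ≤ t → HasDerivWithinAt u (A t (u t) + f t (u t)) (Set.Ici 1) t

/-- A pair of families of seminorms, one contracted by `β`, the other expanded by `α`. -/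
structure Split (l r p : ℕ → Seminorm ℝ E) (β α : ℝ) : Prop where
  eq_max : ∀ n x, p n x = max (l n x) (r n x)
  contr : ∀ n x, l (n + 1) x ≤ β * l n x
  expand : ∀ n x, α * r n x ≤ r (n + 1) x

namespace Split

variable {l r p : ℕ → Seminorm ℝ E} {β α : ℝ}

theorem l_le (h : Split l r p β α) (n : ℕ) (x : E) : l n x ≤ p n x := by
  rw [h.eq_max]; exact le_max_left _ _

theorem r_le (h : Split l r p β α) (n : ℕ) (x : E) : r n x ≤ p n x := by
  rw [h.eq_max]; exact le_max_right _ _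

theorem l_succ_le (h : Split l r p β α) (m : ℕ) (e : ℕ → E) :
    l (m + 1) (e (m + 1)) ≤ β * l m (e m) + p (m + 1) (e (m + 1) - e m) := by
  have h1 : e (m + 1) = e m + (e (m + 1) - e m) := by abel
  calc l (m + 1) (e (m + 1)) = l (m + 1) (e m + (e (m + 1) - e m)) := by rw [← h1]
    _ ≤ l (m + 1) (e m) + l (m + 1) (e (m + 1) - e m) := map_add_le_add _ _ _
    _ ≤ _ := add_le_add (h.contr _ _) (h.l_le _ _)

theorem r_le_succ (h : Split l r p β α) (m : ℕ) (e : ℕ → E) :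
    α * r m (e m) ≤ r (m + 1) (e (m + 1)) + p (m + 1) (e (m + 1) - e m) := by
  have h1 : e m = e (m + 1) - (e (m + 1) - e m) := by abel
  calc α * r m (e m) ≤ r (m + 1) (e m) := h.expand _ _
    _ = r (m + 1) (e (m + 1) - (e (m + 1) - e m)) := by rw [← h1]
    _ ≤ r (m + 1) (e (m + 1)) + r (m + 1) (e (m + 1) - e m) := map_sub_le_add _ _ _
    _ ≤ _ := add_le_add le_rfl (h.r_le _ _)

theorem window (h : Split l r p β α) {δ η w S M : ℝ} (hδ : 0 < δ) (hβ : 0 ≤ β)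
    (hw : β + δ ≤ w) (hw' : w + δ ≤ α) (hη : 0 ≤ η) (hηδ : η ≤ δ / 2) {n N : ℕ}
    (hnN : n ≤ N) {e : ℕ → E}
    (hstep : ∀ m, n ≤ m → m < N → p (m + 1) (e (m + 1) - e m) ≤ η * p m (e m) + S * w ^ m)
    (hS : 2 * S ≤ δ * M) (hl : l n (e n) ≤ w ^ n * M)
    (hr : r N (e N) ≤ w ^ N * M) : ∀ m, n ≤ m → m ≤ N → p m (e m) ≤ w ^ m * M := by
  have hw0 : 0 < w := by linarith
  obtain ⟨j, hj, hmax⟩ := Finset.exists_max_image (Finset.Icc n N)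
    (fun m => p m (e m) / w ^ m) ⟨n, by simp [hnN]⟩
  simp only [Finset.mem_Icc] at hj hmax
  set A := p j (e j) / w ^ j with hA
  have hA0 : 0 ≤ A := div_nonneg (apply_nonneg _ _) (by positivity)
  have hle : ∀ m, n ≤ m → m ≤ N → p m (e m) ≤ w ^ m * A := fun m h1 h2 => by
    have := hmax m ⟨h1, h2⟩
    rw [div_le_iff₀ (by positivity)] at this
    linarith
  have hpj : p j (e j) = w ^ j * A := by rw [hA]; field_simp
  suffices hAM : A ≤ M by
    intro m h1 h2
    exact (hle m h1 h2).trans (mul_le_mul_of_nonneg_left hAM (by positivity))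
  by_contra! hlt
  rcases le_total (r j (e j)) (l j (e j)) with hc | hc
  · have hpl : l j (e j) = w ^ j * A := by rw [← hpj, h.eq_max, max_eq_left hc]
    rcases hj.1.eq_or_lt with hjn | hjn
    · subst hjn
      have : w ^ n * A ≤ w ^ n * M := hpl ▸ hl
      exact absurd (le_of_mul_le_mul_left this (by positivity)) (not_le.2 hlt)
    · obtain ⟨i, rfl⟩ : ∃ i, j = i + 1 := ⟨j - 1, by omega⟩
      have h1 := h.l_succ_le i e
      have h2 := hstep i (by omega) (by omega)
      have h3 := hle i (by omega) (by omega)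
      have h4 := (h.l_le i (e i)).trans h3
      have h5 : w ^ i * (w * A) ≤ w ^ i * (β * A + η * A + S) := by
        have := mul_le_mul_of_nonneg_left h3 hη
        have := mul_le_mul_of_nonneg_left h4 hβ
        rw [hpl, pow_succ] at h1
        nlinarith
      have h6 := le_of_mul_le_mul_left h5 (by positivity)
      nlinarith
  · have hpr : r j (e j) = w ^ j * A := by rw [← hpj, h.eq_max, max_eq_right hc]
    rcases hj.2.eq_or_lt with hjn | hjn
    · subst hjn
      have : w ^ j * A ≤ w ^ j * M := hpr ▸ hr
      exact absurd (le_of_mul_le_mul_left this (by positivity)) (not_le.2 hlt)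
    · have h1 := h.r_le_succ j e
      have h2 := hstep j (by omega) (by omega)
      have h3 := (h.r_le (j + 1) (e (j + 1))).trans (hle (j + 1) (by omega) (by omega))
      have h5 : w ^ j * (α * A) ≤ w ^ j * (w * A + η * A + S) := by
        rw [hpr] at h1
        rw [hpj] at h2
        rw [pow_succ] at h3
        nlinarith
      have h6 := le_of_mul_le_mul_left h5 (by positivity)
      nlinarith

theorem window_l (h : Split l r p β α) {δ η w S M B : ℝ} (hβ : 0 ≤ β) (hδ : 0 < δ)
    (hw : β + δ ≤ w) (hη : 0 ≤ η) {n N : ℕ} {e : ℕ → E}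
    (hstep : ∀ m, n ≤ m → m < N → p (m + 1) (e (m + 1) - e m) ≤ η * p m (e m) + S * w ^ m)
    (hM : ∀ m, n ≤ m → m ≤ N → p m (e m) ≤ w ^ m * M) (hB : 0 ≤ B)
    (hB' : η * M + S ≤ δ * B) (hl : l n (e n) ≤ w ^ n * B) :
    ∀ m, n ≤ m → m ≤ N → l m (e m) ≤ w ^ m * B := by
  have hw0 : 0 < w := by linarith
  intro m hnm
  induction m, hnm using Nat.le_induction with
  | base => exact fun _ => hl
  | succ m hnm ih =>
    intro hmN
    have h0 := ih (by omega)
    have h1 := h.l_succ_le m e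
    have h2 := hstep m hnm (by omega)
    have h3 := mul_le_mul_of_nonneg_left (hM m hnm (by omega)) hη
    have h4 := mul_le_mul_of_nonneg_left h0 hβ
    have h5 : w ^ m * (β * B + η * M + S) ≤ w ^ m * (w * B) :=
      mul_le_mul_of_nonneg_left (by nlinarith) (by positivity)
    rw [pow_succ]
    nlinarith

theorem window_r (h : Split l r p β α) {δ η w S M B : ℝ} (hδ : 0 < δ) (hw0 : 0 < w)
    (hw' : w + δ ≤ α) (hη : 0 ≤ η) {n N : ℕ} {e : ℕ → E}
    (hstep : ∀ m, n ≤ m → m < N → p (m + 1) (e (m + 1) - e m) ≤ η * p m (e m) + S * w ^ m)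
    (hM : ∀ m, n ≤ m → m ≤ N → p m (e m) ≤ w ^ m * M) (hB : 0 ≤ B)
    (hB' : η * M + S ≤ δ * B) (hnN : n ≤ N) (hr : r N (e N) ≤ w ^ N * B) :
    r n (e n) ≤ w ^ n * B := by
  refine Nat.decreasingInduction' (n := N) (m := n)
    (P := fun m => r m (e m) ≤ w ^ m * B) ?_ hnN hr
  intro m hmN hnm ih
  have h1 := h.r_le_succ m e
  have h2 := hstep m hnm hmN
  have h3 := mul_le_mul_of_nonneg_left (hM m hnm hmN.le) hη
  have h5 : w ^ m * (w * B + η * M + S) ≤ w ^ m * (α * B) :=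
    mul_le_mul_of_nonneg_left (by nlinarith) (by positivity)
  rw [pow_succ] at ih
  have h6 : α * r m (e m) ≤ α * (w ^ m * B) := by nlinarith
  exact le_of_mul_le_mul_left h6 (by linarith)

/-- Backward bounds for an orbit whose slow component vanishes at time `0`. -/
theorem from_past (h : Split l r p β α) {δ η w S : ℝ} (hδ : 0 < δ) (hβ : 0 ≤ β)
    (hw : β + δ ≤ w) (hw' : w + δ ≤ α) (hη : 0 ≤ η) (hηδ : η ≤ δ / 2) {n : ℕ} {e : ℕ → E}
    (hS : 0 ≤ S) (h0 : l 0 (e 0) = 0)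
    (hstep : ∀ m, m < n → p (m + 1) (e (m + 1) - e m) ≤ η * p m (e m) + S * (w ^ m / w ^ n)) :
    (∀ m, m ≤ n → p m (e m) ≤ w ^ m / w ^ n * (p n (e n) + 2 / δ * S)) ∧
    l n (e n) ≤ η / δ * p n (e n) + 2 / δ * S := by
  have hw0 : 0 < w := by linarith
  have hwn : 0 < w ^ n := by positivity
  set M := (p n (e n) + 2 / δ * S) / w ^ n with hMdef
  have hst : ∀ m, 0 ≤ m → m < n →
      p (m + 1) (e (m + 1) - e m) ≤ η * p m (e m) + S / w ^ n * w ^ m := fun m _ hm => by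
    have := hstep m hm
    calc _ ≤ _ := this
      _ = _ := by ring
  have hp0 : 0 ≤ p n (e n) := apply_nonneg _ _
  have hM0 : 0 ≤ M := by positivity
  have hM := h.window hδ hβ hw hw' hη hηδ (Nat.zero_le n) hst (M := M)
    (by
      rw [hMdef, mul_div_assoc', mul_div_assoc', div_le_div_iff_of_pos_right hwn]
      have : δ * (2 / δ * S) = 2 * S := by field_simp
      nlinarith)
    (by rw [h0]; positivity)
    (by
      rw [hMdef, mul_div_cancel₀ _ hwn.ne']
      have := h.r_le n (e n)
      have : 0 ≤ 2 / δ * S := by positivity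
      linarith)
  refine ⟨fun m hm => (hM m (Nat.zero_le _) hm).trans (le_of_eq (by rw [hMdef]; ring)), ?_⟩
  have := h.window_l hβ hδ hw hη hst hM (B := (η * M + S / w ^ n) / δ) (by positivity)
    (by field_simp; rfl) (by rw [h0]; positivity) n (Nat.zero_le _) le_rfl
  refine this.trans ?_
  have h1 : w ^ n * ((η * M + S / w ^ n) / δ) =
      η / δ * p n (e n) + (η / δ * (2 / δ) * S + S / δ) := by
    rw [hMdef]; field_simp; ring
  rw [h1]
  have h2 : η / δ ≤ 1 / 2 := by rw [div_le_iff₀ hδ]; linarith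
  have h3 : η / δ * (2 / δ * S) ≤ 1 / 2 * (2 / δ * S) :=
    mul_le_mul_of_nonneg_right h2 (by positivity)
  have h4 : 1 / 2 * (2 / δ * S) + S / δ = 2 / δ * S := by ring
  nlinarith

/-- Forward bounds for an orbit growing slower than the weight `w`. -/
theorem from_future (h : Split l r p β α) {δ η w S C θ : ℝ} (hδ : 0 < δ) (hβ : 0 ≤ β)
    (hw : β + δ ≤ w) (hw' : w + δ ≤ α) (hη : 0 ≤ η) (hηδ : η ≤ δ / 2) (n : ℕ) {e : ℕ → E}
    (hS : 0 ≤ S) (hθ : 0 ≤ θ) (hθw : θ < w) (hgrow : ∀ m, p m (e m) ≤ C * θ ^ m)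
    (hstep : ∀ m, n ≤ m → p (m + 1) (e (m + 1) - e m) ≤ η * p m (e m) + S * (w ^ m / w ^ n)) :
    (∀ m, n ≤ m → p m (e m) ≤ w ^ m / w ^ n * (p n (e n) + 2 / δ * S)) ∧
    r n (e n) ≤ η / δ * p n (e n) + 2 / δ * S := by
  have hw0 : 0 < w := by linarith
  have hwn : 0 < w ^ n := by positivity
  have hp0 : 0 ≤ p n (e n) := apply_nonneg _ _
  have hst : ∀ m, n ≤ m → 
      p (m + 1) (e (m + 1) - e m) ≤ η * p m (e m) + S / w ^ n * w ^ m := fun m hm => by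
    calc _ ≤ _ := hstep m hm
      _ = _ := by ring
  have hsmall : ∀ κ : ℝ, 0 < κ → ∀ᶠ N in Filter.atTop, r N (e N) ≤ w ^ N * κ := by
    intro κ hκ
    have ht : Filter.Tendsto (fun N : ℕ => C * (θ / w) ^ N) Filter.atTop (nhds (C * 0)) :=
      (tendsto_pow_atTop_nhds_zero_of_lt_one (by positivity)
        ((div_lt_one hw0).2 hθw)).const_mul C
    rw [mul_zero] at ht
    filter_upwards [ht.eventually (gt_mem_nhds hκ)] with N hN
    calc r N (e N) ≤ C * θ ^ N := (h.r_le _ _).trans (hgrow N)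
      _ = w ^ N * (C * (θ / w) ^ N) := by rw [div_pow]; field_simp
      _ ≤ _ := mul_le_mul_of_nonneg_left hN.le (by positivity)
  have key : ∀ κ : ℝ, 0 < κ →
      (∀ m, n ≤ m → p m (e m) ≤ w ^ m * ((p n (e n) + 2 / δ * S) / w ^ n + κ)) := by
    intro κ hκ m hm
    obtain ⟨N, hN, hNm⟩ := ((hsmall κ hκ).and (Filter.eventually_ge_atTop m)).exists
    refine h.window hδ hβ hw hw' hη hηδ (hm.trans hNm) (fun j hj _ => hst j hj)
      ?_ ?_ ?_ m hm hNm
    · have : δ * ((p n (e n) + 2 / δ * S) / w ^ n + κ) =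
        δ * p n (e n) / w ^ n + 2 * (S / w ^ n) + δ * κ := by field_simp
      rw [this]
      have : 0 ≤ δ * p n (e n) / w ^ n := by positivity
      nlinarith
    · have h1 := h.l_le n (e n)
      have h2 : w ^ n * ((p n (e n) + 2 / δ * S) / w ^ n + κ) =
        p n (e n) + 2 / δ * S + w ^ n * κ := by field_simp
      have : 0 ≤ 2 / δ * S + w ^ n * κ := by positivity
      rw [h2]; linarith
    · refine hN.trans (mul_le_mul_of_nonneg_left ?_ (by positivity))
      have : 0 ≤ (p n (e n) + 2 / δ * S) / w ^ n := by positivity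
      linarith
  have hM : ∀ m, n ≤ m → p m (e m) ≤ w ^ m * ((p n (e n) + 2 / δ * S) / w ^ n) := by
    intro m hm
    refine le_of_forall_pos_le_add fun κ hκ => ?_
    refine (key (κ / w ^ m) (by positivity) m hm).trans (le_of_eq ?_)
    field_simp
  set M := (p n (e n) + 2 / δ * S) / w ^ n with hMdef
  have hM0 : 0 ≤ M := by positivity
  refine ⟨fun m hm => (hM m hm).trans (le_of_eq (by rw [hMdef]; ring)), ?_⟩
  have hB : r n (e n) ≤ w ^ n * ((η * M + S / w ^ n) / δ) := by
    refine le_of_forall_pos_le_add fun κ hκ => ?_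
    obtain ⟨N, hN, hNm⟩ := ((hsmall (κ / w ^ n) (by positivity)).and
      (Filter.eventually_ge_atTop n)).exists
    have := h.window_r hδ hw0 hw' hη (n := n) (N := N) (fun j hj _ => hst j hj)
      (fun j hj _ => hM j hj) (B := (η * M + S / w ^ n) / δ + κ / w ^ n) (by positivity)
      (by
        have : δ * ((η * M + S / w ^ n) / δ + κ / w ^ n) =
          η * M + S / w ^ n + δ * (κ / w ^ n) := by field_simp
        have : 0 ≤ δ * (κ / w ^ n) := by positivity
        linarith) hNm
      (hN.trans (mul_le_mul_of_nonneg_left (by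
        have : 0 ≤ (η * M + S / w ^ n) / δ := by positivity
        linarith) (by positivity)))
    refine this.trans (le_of_eq ?_)
    field_simp
  refine hB.trans ?_
  have h1 : w ^ n * ((η * M + S / w ^ n) / δ) =
      η / δ * p n (e n) + (η / δ * (2 / δ) * S + S / δ) := by
    rw [hMdef]; field_simp; ring
  rw [h1]
  have h2 : η / δ ≤ 1 / 2 := by rw [div_le_iff₀ hδ]; linarith
  have h3 : η / δ * (2 / δ * S) ≤ 1 / 2 * (2 / δ * S) :=
    mul_le_mul_of_nonneg_right h2 (by positivity)
  have h4 : 1 / 2 * (2 / δ * S) + S / δ = 2 / δ * S := by ring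
  nlinarith

/-- A vector split into a mostly fast part `y` and a mostly slow part `z`. -/
theorem two_parts (h : Split l r p β α) {n : ℕ} {x y z : E} {s : ℝ} (hs : 0 ≤ s) (hx : x = y + z)
    (hy : l n y ≤ 1 / 2 * p n y + s) (hz : r n z ≤ 1 / 2 * p n z + s) :
    p n y + p n z ≤ 4 * p n x + 12 * s := by
  have hpy := h.eq_max n y
  have hpz := h.eq_max n z
  have h1 : r n y ≤ p n x + r n z := by
    have : y = x - z := by rw [hx]; abel
    calc r n y = r n (x - z) := by rw [← this]
      _ ≤ r n x + r n z := map_sub_le_add _ _ _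
      _ ≤ _ := by linarith [h.r_le n x]
  have h2 : l n z ≤ p n x + l n y := by
    have : z = x - y := by rw [hx]; abel
    calc l n z = l n (x - y) := by rw [← this]
      _ ≤ l n x + l n y := map_sub_le_add _ _ _
      _ ≤ _ := by linarith [h.l_le n x]
  have := apply_nonneg (p n) y
  have := apply_nonneg (p n) z
  have := apply_nonneg (p n) x
  rcases le_total (l n y) (r n y) with hc | hc <;> rcases le_total (l n z) (r n z) with hd | hd <;>
    simp only [max_eq_left, max_eq_right, hc, hd] at hpy hpz <;> linarith

end Split

open Filter Topology in
theorem exists_contDiff_limit {F : Type*} [NormedAddCommGroup F] [NormedSpace ℝ F] [CompleteSpace F]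
    {f : ℕ → E → F} (hf : ∀ n, ContDiff ℝ 1 (f n))
    (h : ∀ ρ : ℝ, ∃ C κ : ℝ, 0 ≤ κ ∧ κ < 1 ∧ ∀ x, ‖x‖ ≤ ρ → ∀ n,
      ‖f (n + 1) x - f n x‖ ≤ C * κ ^ n ∧
      ‖fderiv ℝ (f (n + 1)) x - fderiv ℝ (f n) x‖ ≤ C * κ ^ n) :
    ∃ g : E → F, ContDiff ℝ 1 g ∧ (∀ x, Tendsto (fun n => f n x) atTop (𝓝 (g x))) ∧
      ∀ x, Tendsto (fun n => fderiv ℝ (f n) x) atTop (𝓝 (fderiv ℝ g x)) := by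
  have h1 : ∀ x, ∃ y, Tendsto (fun n => f n x) atTop (𝓝 y) := fun x => by
    obtain ⟨C, κ, _, h1, hx⟩ := h ‖x‖
    refine cauchySeq_tendsto_of_complete (cauchySeq_of_le_geometric κ C h1 fun n => ?_)
    rw [dist_comm, dist_eq_norm]
    exact (hx x le_rfl n).1
  have h2 : ∀ x, ∃ y, Tendsto (fun n => fderiv ℝ (f n) x) atTop (𝓝 y) := fun x => by
    obtain ⟨C, κ, _, h1, hx⟩ := h ‖x‖
    refine cauchySeq_tendsto_of_complete (cauchySeq_of_le_geometric κ C h1 fun n => ?_)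
    rw [dist_comm, dist_eq_norm]
    exact (hx x le_rfl n).2
  choose g hg using h1
  choose g' hg' using h2
  have hu : ∀ ρ, TendstoUniformlyOn (fun n => fderiv ℝ (f n)) g' atTop (Metric.ball 0 ρ) := by
    intro ρ
    obtain ⟨C, κ, h0, h1, hx⟩ := h ρ
    rw [Metric.tendstoUniformlyOn_iff]
    intro ε hε
    have ht : Tendsto (fun n : ℕ => C * κ ^ n / (1 - κ)) atTop (𝓝 (C * 0 / (1 - κ))) :=
      ((tendsto_pow_atTop_nhds_zero_of_lt_one h0 h1).const_mul C).div_const _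
    rw [mul_zero, zero_div] at ht
    filter_upwards [ht.eventually (gt_mem_nhds hε)] with n hn x hxρ
    refine lt_of_le_of_lt ?_ hn
    rw [dist_comm]
    refine dist_le_of_le_geometric_of_tendsto κ C h1 (fun n => ?_) (hg' x) n
    rw [dist_comm, dist_eq_norm]
    exact (hx x (by simpa using (mem_ball_zero_iff.1 hxρ).le) n).2
  have hd : ∀ x, HasFDerivAt g (g' x) x := fun x =>
    hasFDerivAt_of_tendstoUniformlyOn Metric.isOpen_ball (hu (‖x‖ + 1))
      (fun n y _ => ((hf n).differentiable one_ne_zero y).hasFDerivAt)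
      (fun y _ => hg y) (by simp)
  have hgd : fderiv ℝ g = g' := funext fun x => (hd x).fderiv
  refine ⟨g, contDiff_one_iff_fderiv.2 ⟨fun x => (hd x).differentiableAt, ?_⟩, hg, by
    rw [hgd]; exact hg'⟩
  rw [hgd, continuous_iff_continuousAt]
  intro x
  have hc : ContinuousOn g' (Metric.ball 0 (‖x‖ + 1)) :=
    (hu (‖x‖ + 1)).continuousOn (Frequently.of_forall fun n =>
      ((hf n).continuous_fderiv one_ne_zero).continuousOn)
  exact hc.continuousAt (Metric.isOpen_ball.mem_nhds (by simp))

section FiniteDim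

variable [FiniteDimensional ℝ E]

theorem seminorm_continuous (p : Seminorm ℝ E) : Continuous p := by
  rw [← continuousOn_univ]
  exact ConvexOn.continuousOn isOpen_univ p.convexOn

theorem seminorm_bound (p : Seminorm ℝ E) : ∃ C, 0 < C ∧ ∀ x : E, p x ≤ C * ‖x‖ :=
  Seminorm.bound_of_continuous_normedSpace p (seminorm_continuous p)

theorem exists_norming_functional (p : Seminorm ℝ E) (v : E) :
    ∃ g : E →L[ℝ] ℝ, g v = p v ∧ ∀ x, |g x| ≤ p x := by
  by_cases hv : v = 0
  · exact ⟨0, by simp [hv], fun x => by simp⟩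
  let φ : E →ₗ.[ℝ] ℝ := LinearPMap.mkSpanSingleton v (p v) hv
  obtain ⟨g, hg, hgp⟩ := Module.Dual.exists_extension_of_le_seminorm_real φ.domain φ.toFun
    (p := p) (by
      rintro ⟨x, hx⟩
      obtain ⟨c, rfl⟩ := Submodule.mem_span_singleton.1 hx
      have : φ.toFun ⟨c • v, hx⟩ = c • p v := LinearPMap.mkSpanSingleton'_apply _ _ _ c hx
      rw [this, map_smul_eq_mul, smul_eq_mul]
      exact mul_le_mul_of_nonneg_right (le_abs_self c) (apply_nonneg _ _))
  refine ⟨g.toContinuousLinearMap, ?_, hgp⟩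
  have h1 := hg ⟨v, Submodule.mem_span_singleton_self v⟩
  have h2 : φ.toFun ⟨v, Submodule.mem_span_singleton_self v⟩ = p v :=
    LinearPMap.mkSpanSingleton'_apply_self _ _ _ _
  exact h1.trans h2

/-- Mean value inequality for a seminorm. -/
theorem seminorm_sub_le_of_deriv (p : Seminorm ℝ E) {γ γ' : ℝ → E} {a b B : ℝ} (hab : a ≤ b)
    (h : ∀ t ∈ Set.Icc a b, HasDerivWithinAt γ (γ' t) (Set.Icc a b) t)
    (hB : ∀ t ∈ Set.Icc a b, p (γ' t) ≤ B) : p (γ b - γ a) ≤ B * (b - a) := by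
  obtain ⟨g, hg, hgp⟩ := exists_norming_functional p (γ b - γ a)
  rw [← hg, map_sub]
  have hd : ∀ t ∈ Set.Icc a b, HasDerivWithinAt (fun s => g (γ s)) (g (γ' t)) (Set.Icc a b) t :=
    fun t ht => g.hasFDerivAt.comp_hasDerivWithinAt t (h t ht)
  have hI : ∀ t ∈ interior (Set.Icc a b), HasDerivAt (fun s => g (γ s)) (g (γ' t)) t :=
    fun t ht => (hd t (interior_subset ht)).hasDerivAt (mem_interior_iff_mem_nhds.1 ht)
  exact (convex_Icc a b).image_sub_le_mul_sub_of_deriv_le (f := fun s => g (γ s))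
    (fun t ht => (hd t ht).continuousWithinAt)
    (fun t ht => (hI t ht).differentiableAt.differentiableWithinAt)
    (fun t ht => by
      rw [(hI t ht).deriv]
      exact (le_abs_self _).trans ((hgp _).trans (hB t (interior_subset ht))))
    a (Set.left_mem_Icc.2 hab) b (Set.right_mem_Icc.2 hab) hab

/-- Lipschitz estimate on a convex seminorm ball from a derivative bound. -/
theorem seminorm_map_sub_le (p : Seminorm ℝ E) {K : E → E} (hK : Differentiable ℝ K) {c ζ : ℝ}
    (hD : ∀ x, p x ≤ ζ → ∀ h, p (fderiv ℝ K x h - h) ≤ c * p h) {x y : E}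
    (hx : p x ≤ ζ) (hy : p y ≤ ζ) : p ((K x - K y) - (x - y)) ≤ c * p (x - y) := by
  have hz : ∀ t ∈ Set.Icc (0 : ℝ) 1, p (y + t • (x - y)) ≤ ζ := fun t ht => by
    have h1 : y + t • (x - y) = (1 - t) • y + t • x := by module
    rw [h1]
    refine (map_add_le_add p _ _).trans ?_
    rw [map_smul_eq_mul, map_smul_eq_mul, Real.norm_of_nonneg ht.1,
      Real.norm_of_nonneg (by linarith [ht.2])]
    nlinarith [ht.1, ht.2]
  have := seminorm_sub_le_of_deriv p (zero_le_one (α := ℝ))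
    (γ := fun t => K (y + t • (x - y)) - t • (x - y))
    (γ' := fun t => fderiv ℝ K (y + t • (x - y)) (x - y) - (x - y)) (B := c * p (x - y))
    (fun t _ => by
      have h1 : HasDerivAt (fun t : ℝ => t • (x - y)) (x - y) t := by
        simpa using (hasDerivAt_id t).smul_const (x - y)
      have h2 : HasDerivAt (fun t : ℝ => y + t • (x - y)) (x - y) t := h1.const_add y
      exact (((hK _).hasFDerivAt.comp_hasDerivAt t h2).sub h1).hasDerivWithinAt)
    (fun t ht => hD _ (hz t ht) _)
  simpa [sub_sub, add_comm] using this

/-- A seminorm which is definite dominates the norm. -/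
theorem seminorm_lower_bound (p : Seminorm ℝ E) (hp : ∀ x, p x = 0 → x = 0) :
    ∃ C, 0 < C ∧ ∀ x : E, ‖x‖ ≤ C * p x := by
  by_cases hs : (Metric.sphere (0 : E) 1).Nonempty
  · obtain ⟨x₀, hx₀, hmin⟩ := (isCompact_sphere (0 : E) 1).exists_isMinOn hs
      (seminorm_continuous p).continuousOn
    have hx₀' : ‖x₀‖ = 1 := by simpa using hx₀
    have hpos : 0 < p x₀ := lt_of_le_of_ne (apply_nonneg _ _) fun h0 => by
      have := hp x₀ h0.symm
      rw [this, norm_zero] at hx₀'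
      exact zero_ne_one hx₀'
    refine ⟨(p x₀)⁻¹, by positivity, fun x => ?_⟩
    by_cases hx : x = 0
    · simp [hx]
    have hn : 0 < ‖x‖ := norm_pos_iff.2 hx
    have h1 : p x₀ ≤ p (‖x‖⁻¹ • x) := hmin (by simp [norm_smul, hn.ne'])
    rw [map_smul_eq_mul, norm_inv, norm_norm] at h1
    rw [inv_mul_eq_div, le_div_iff₀ hpos]
    calc ‖x‖ * p x₀ ≤ ‖x‖ * (‖x‖⁻¹ * p x) := by gcongr
      _ = p x := by field_simp
  · refine ⟨1, one_pos, fun x => ?_⟩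
    by_cases hx : x = 0
    · simp [hx]
    · exact absurd ⟨‖x‖⁻¹ • x, by simp [norm_smul, (norm_pos_iff.2 hx).ne']⟩ hs

/-- A map close to the identity on a ball covers a smaller ball. -/
theorem exists_preimage_of_near_id (p : Seminorm ℝ E) (hp : ∀ x, p x = 0 → x = 0) {K : E → E}
    (hK : Continuous K) (hK0 : K 0 = 0) {ζ : ℝ} (hζ : 0 ≤ ζ)
    (hD : ∀ x y, p x ≤ ζ → p y ≤ ζ → p ((K x - K y) - (x - y)) ≤ 1 / 2 * p (x - y))
    {z : E} (hz : p z ≤ ζ / 2) : ∃ x, p x ≤ ζ ∧ K x = z := by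
  have hpc := seminorm_continuous p
  obtain ⟨C, hC, hpC⟩ := seminorm_lower_bound p hp
  have hcomp : IsCompact {x | p x ≤ ζ} := by
    refine Metric.isCompact_of_isClosed_isBounded (isClosed_le hpc continuous_const) ?_
    refine (Metric.isBounded_closedBall (x := (0 : E)) (r := C * ζ)).subset fun x hx => ?_
    rw [mem_closedBall_zero_iff]
    exact (hpC x).trans (by have : p x ≤ ζ := hx; gcongr)
  obtain ⟨x, hx, hmin⟩ := hcomp.exists_isMinOn ⟨0, by simpa using hζ⟩
    (f := fun x => p (K x - z)) (hpc.comp (hK.sub continuous_const)).continuousOn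
  have hx' : p x ≤ ζ := hx
  refine ⟨x, hx', ?_⟩
  set y := x - (K x - z) with hy
  have hpy : p y ≤ ζ := by
    have h1 := hD x 0 hx' (by simpa using hζ)
    simp only [hK0, sub_zero] at h1
    have h2 : y = z - (K x - x) := by rw [hy]; abel
    rw [h2]
    refine (map_sub_le_add p _ _).trans ?_
    linarith
  have h1 := hD y x hpy hx'
  have h2 : K y - K x - (y - x) = K y - z := by rw [hy]; abel
  have h3 : y - x = -(K x - z) := by rw [hy]; abel
  rw [h2, h3, map_neg_eq_map] at h1
  have h4 : p (K x - z) ≤ p (K y - z) := hmin hpy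
  have h5 : p (K x - z) = 0 := by
    have := apply_nonneg p (K x - z)
    linarith
  exact sub_eq_zero.1 (hp _ h5)

/-- The inverse of a `C¹` bijection with injective derivatives is `C¹`. -/
theorem contDiff_inverse_of_bijective {f g : E → E} (hf : ContDiff ℝ 1 f)
    (hgf : Function.LeftInverse g f) (hfg : Function.RightInverse g f)
    (hinj : ∀ x h, fderiv ℝ f x h = 0 → h = 0) : ContDiff ℝ 1 g := by
  have heq : ∀ x, ∃ f' : E ≃L[ℝ] E, (f' : E →L[ℝ] E) = fderiv ℝ f x := fun x => by
    have hi : Function.Injective (fderiv ℝ f x) :=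
      (injective_iff_map_eq_zero (fderiv ℝ f x)).2 (hinj x)
    refine ⟨(LinearEquiv.ofInjectiveEndo (fderiv ℝ f x : E →ₗ[ℝ] E) hi).toContinuousLinearEquiv, ?_⟩
    ext; simp
  choose f' hf' using heq
  have hop : IsOpenMap f := isOpenMap_of_hasStrictFDerivAt_equiv (f' := f') fun x => by
    rw [hf']; exact hf.contDiffAt.hasStrictFDerivAt one_ne_zero
  let e : E ≃ E := ⟨f, g, hgf, hfg⟩
  let h : E ≃ₜ E := e.toHomeomorphOfContinuousOpen hf.continuous hop
  exact h.contDiff_symm (f₀' := f') (fun x => by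
    rw [hf']; exact (hf.differentiable one_ne_zero x).hasFDerivAt) hf

/-- Hadamard-type global inversion for an expanding `C¹` map. -/
theorem exists_contDiff_inverse {f : E → E} (hf : ContDiff ℝ 1 f) {C : ℝ} (hC : 0 ≤ C)
    (hlip : ∀ x y, ‖x - y‖ ≤ C * ‖f x - f y‖) (hinj : ∀ x h, fderiv ℝ f x h = 0 → h = 0) :
    ∃ g : E → E, ContDiff ℝ 1 g ∧ Function.LeftInverse g f ∧ Function.RightInverse g f := by
  have hanti : AntilipschitzWith ⟨C, hC⟩ f := AntilipschitzWith.of_le_mul_dist fun x y => by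
    rw [dist_eq_norm, dist_eq_norm]; exact hlip x y
  have heq : ∀ x, ∃ f' : E ≃L[ℝ] E, (f' : E →L[ℝ] E) = fderiv ℝ f x := fun x => by
    have hi : Function.Injective (fderiv ℝ f x) :=
      (injective_iff_map_eq_zero (fderiv ℝ f x)).2 (hinj x)
    refine ⟨(LinearEquiv.ofInjectiveEndo (fderiv ℝ f x : E →ₗ[ℝ] E) hi).toContinuousLinearEquiv, ?_⟩
    ext; simp
  choose f' hf' using heq
  have hop : IsOpenMap f := isOpenMap_of_hasStrictFDerivAt_equiv (f' := f') fun x => by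
    rw [hf']; exact hf.contDiffAt.hasStrictFDerivAt one_ne_zero
  have hcl : IsClosed (Set.range f) := by
    refine isSeqClosed_iff_isClosed.1 fun y a hy ha => ?_
    choose x hx using hy
    have hc : CauchySeq x := Metric.cauchySeq_iff'.2 fun ε hε => by
      obtain ⟨N, hN⟩ := Metric.cauchySeq_iff'.1 ha.cauchySeq (ε / (C + 1)) (by positivity)
      refine ⟨N, fun n hn => ?_⟩
      have h1 := hN n hn
      rw [dist_eq_norm, ← hx, ← hx, lt_div_iff₀ (by positivity)] at h1
      rw [dist_eq_norm]
      have h2 := hlip (x n) (x N)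
      have := norm_nonneg (f (x n) - f (x N))
      nlinarith
    obtain ⟨b, hb⟩ := cauchySeq_tendsto_of_complete hc
    refine ⟨b, tendsto_nhds_unique ((hf.continuous.tendsto b).comp hb) ?_⟩
    exact ha.congr fun n => (hx n).symm
  have hsurj : Function.Surjective f := by
    rw [← Set.range_eq_univ]
    exact IsClopen.eq_univ ⟨hcl, hop.isOpen_range⟩ (Set.range_nonempty f)
  obtain ⟨g, hgf, hfg⟩ := Function.bijective_iff_has_inverse.1 ⟨hanti.injective, hsurj⟩
  exact ⟨g, contDiff_inverse_of_bijective hf hgf hfg hinj, hgf, hfg⟩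

end FiniteDim

/-- Orbits `Φ m x` of a near-identity nonautonomous system, measured in the seminorms `p m`. -/
structure OrbitSys (p : ℕ → Seminorm ℝ E) (η L : ℝ) (Φ : ℕ → E → E) : Prop where
  contDiff : ∀ m, ContDiff ℝ 1 (Φ m)
  start : ∀ x, Φ 0 x = x
  fixed : ∀ m, Φ m 0 = 0
  lip : ∀ m x y, p (m + 1) ((Φ (m + 1) x - Φ (m + 1) y) - (Φ m x - Φ m y)) ≤
    η * p m (Φ m x - Φ m y)
  var : ∀ m x y h k,
    p (m + 1) ((fderiv ℝ (Φ (m + 1)) x h - fderiv ℝ (Φ (m + 1)) y k) -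
      (fderiv ℝ (Φ m) x h - fderiv ℝ (Φ m) y k)) ≤
    η * p m (fderiv ℝ (Φ m) x h - fderiv ℝ (Φ m) y k) +
      min (2 * η) (L * p m (Φ m x - Φ m y)) * p m (fderiv ℝ (Φ m) y k)
  var_small : ∀ m x y h k,
    p (m + 1) ((fderiv ℝ (Φ (m + 1)) x h - fderiv ℝ (Φ (m + 1)) y k) -
      (fderiv ℝ (Φ m) x h - fderiv ℝ (Φ m) y k)) ≤
    L * p m (Φ m x) * p m (fderiv ℝ (Φ m) x h - fderiv ℝ (Φ m) y k) +
      L * p m (Φ m x - Φ m y) * p m (fderiv ℝ (Φ m) y k)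

namespace OrbitSys

variable {p : ℕ → Seminorm ℝ E} {η L : ℝ} {Φ : ℕ → E → E}

theorem differentiable (hS : OrbitSys p η L Φ) (m : ℕ) : Differentiable ℝ (Φ m) :=
  (hS.contDiff m).differentiable one_ne_zero

theorem fderiv_start (hS : OrbitSys p η L Φ) (x h : E) : fderiv ℝ (Φ 0) x h = h := by
  have : Φ 0 = id := funext hS.start
  rw [this, fderiv_id]; rfl

theorem var_lin (hS : OrbitSys p η L Φ) (m : ℕ) (x h : E) :
    p (m + 1) (fderiv ℝ (Φ (m + 1)) x h - fderiv ℝ (Φ m) x h) ≤ η * p m (fderiv ℝ (Φ m) x h) := by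
  simpa using hS.var m x x h 0

end OrbitSys

theorem fderiv_comp_apply' {F G : E → E} (hF : ContDiff ℝ 1 F) (hG : ContDiff ℝ 1 G) (x h : E) :
    fderiv ℝ (fun y => F (G y)) x h = fderiv ℝ F (G x) (fderiv ℝ G x h) := by
  have := ((hF.differentiable one_ne_zero (G x)).hasFDerivAt.comp x
    (hG.differentiable one_ne_zero x).hasFDerivAt).fderiv
  change fderiv ℝ (F ∘ G) x h = _
  rw [this]; rfl

theorem fderiv_clm_comp_apply {G : E → E} (P : E →L[ℝ] E) (hG : ContDiff ℝ 1 G) (x h : E) :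
    fderiv ℝ (fun y => P (G y)) x h = P (fderiv ℝ G x h) := by
  have := (P.hasFDerivAt.comp x (hG.differentiable one_ne_zero x).hasFDerivAt).fderiv
  change fderiv ℝ (P ∘ G) x h = _
  rw [this]; rfl

/-- Compatibility of a splitting of seminorms with a projection. -/
structure SplitProj (l r : ℕ → Seminorm ℝ E) (P : E →L[ℝ] E) : Prop where
  idem : ∀ x, P (P x) = P x
  l_proj : ∀ n x, l n (P x) = l n x
  r_proj : ∀ n x, r n (P x) = 0

namespace SplitProj

variable {l r : ℕ → Seminorm ℝ E} {P : E →L[ℝ] E}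

theorem r_compl (hP : SplitProj l r P) (n : ℕ) (x : E) : r n (x - P x) = r n x := by
  apply le_antisymm
  · refine (map_sub_le_add (r n) _ _).trans ?_
    rw [hP.r_proj, add_zero]
  · have : x = (x - P x) + P x := by abel
    calc r n x = r n ((x - P x) + P x) := by rw [← this]
      _ ≤ r n (x - P x) + r n (P x) := map_add_le_add _ _ _
      _ = _ := by rw [hP.r_proj, add_zero]

theorem l_eq_zero (hP : SplitProj l r P) {n : ℕ} {x : E} (hx : P x = 0) : l n x = 0 := by
  rw [← hP.l_proj, hx, map_zero]

end SplitProj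

section Leaf

variable [FiniteDimensional ℝ E]
variable {l r p : ℕ → Seminorm ℝ E} {β α η L : ℝ} {Φ : ℕ → E → E} {P : E →L[ℝ] E}

/-- Existence of initial data with prescribed slow part at time `0` and fast part at time `N`. -/
theorem exists_mixed_inverse (h : Split l r p β α) (hP : SplitProj l r P)
    (hS : OrbitSys p η L Φ) (hp : ∀ n x, p n x = 0 → x = 0) {δ w : ℝ} (hδ : 0 < δ) (hβ : 0 ≤ β)
    (hw : β + δ ≤ w) (hw' : w + δ ≤ α) (hη : 0 ≤ η) (hηδ : η ≤ δ / 2) (N : ℕ) :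
    ∃ Θ : E → E, ContDiff ℝ 1 Θ ∧ ∀ x, P (Θ x) = P x ∧
      Φ N (Θ x) - P (Φ N (Θ x)) = x - P x := by
  have hw0 : 0 < w := by linarith
  let Ψ : E → E := fun x => P x + (Φ N x - P (Φ N x))
  have hΨ : ContDiff ℝ 1 Ψ := P.contDiff.add ((hS.contDiff N).sub (P.contDiff.comp (hS.contDiff N)))
  have hPΨ : ∀ x, P (Ψ x) = P x := fun x => by simp [Ψ, hP.idem]
  have key : ∀ e : ℕ → E,
      (∀ m, p (m + 1) (e (m + 1) - e m) ≤ η * p m (e m)) → ∀ z : E, P z = P (e 0) →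
      z - P z = e N - P (e N) →
      p 0 (e 0) ≤ max (p 0 z) ((w ^ N)⁻¹ * p N z) := by
    intro e he z hz hz'
    have := h.window hδ hβ hw hw' hη hηδ (Nat.zero_le N) (e := e) (S := 0)
      (M := max (p 0 z) ((w ^ N)⁻¹ * p N z)) (fun m _ _ => by simpa using he m)
      (by
        have := (apply_nonneg (p 0) z).trans (le_max_left _ ((w ^ N)⁻¹ * p N z))
        have := mul_nonneg hδ.le this
        linarith)
      (by
        rw [pow_zero, one_mul, ← hP.l_proj, ← hz, hP.l_proj]
        exact (h.l_le _ _).trans (le_max_left _ _))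
      (by
        rw [← hP.r_compl, ← hz', hP.r_compl]
        calc r N z ≤ p N z := h.r_le _ _
          _ = w ^ N * ((w ^ N)⁻¹ * p N z) := by field_simp
          _ ≤ _ := mul_le_mul_of_nonneg_left (le_max_right _ _) (by positivity))
      0 le_rfl (Nat.zero_le _)
    simpa using this
  obtain ⟨C₀, hC₀, hC₀'⟩ := seminorm_lower_bound (p 0) (hp 0)
  obtain ⟨C₁, hC₁, hC₁'⟩ := seminorm_bound (p 0)
  obtain ⟨C₂, hC₂, hC₂'⟩ := seminorm_bound (p N)
  obtain ⟨Θ, hΘ, -, hΘr⟩ := exists_contDiff_inverse hΨ (C := C₀ * max C₁ ((w ^ N)⁻¹ * C₂))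
    (by positivity)
    (fun x y => by
      have := key (fun m => Φ m x - Φ m y) (fun m => hS.lip m x y) (Ψ x - Ψ y)
        (by simp only [map_sub, hPΨ, hS.start])
        (by simp only [map_sub, hPΨ]; simp only [Ψ]; abel)
      simp only [hS.start] at this
      refine (hC₀' _).trans ?_
      rw [mul_assoc]
      refine mul_le_mul_of_nonneg_left (this.trans ?_) hC₀.le
      rw [max_mul_of_nonneg _ _ (norm_nonneg _)]
      refine max_le_max (hC₁' _) ?_
      rw [mul_assoc]
      exact mul_le_mul_of_nonneg_left (hC₂' _) (by positivity))
    (fun x k hk => by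
      have hD : fderiv ℝ Ψ x k =
          P k + (fderiv ℝ (Φ N) x k - P (fderiv ℝ (Φ N) x k)) := by
        have h1 := (hS.differentiable N x).hasFDerivAt
        have := (P.hasFDerivAt (x := x)).add (h1.sub (P.hasFDerivAt.comp x h1))
        have h2 : fderiv ℝ Ψ x = _ := this.fderiv
        rw [h2]; simp
      rw [hD] at hk
      have hPk : P k = 0 := by
        have := congrArg P hk
        simpa [hP.idem] using this
      rw [hPk, zero_add] at hk
      have := key (fun m => fderiv ℝ (Φ m) x k) (fun m => hS.var_lin m x k) 0
        (by simp only [hS.fderiv_start, hPk, map_zero]) (by simp [hk])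
      simp only [hS.fderiv_start, map_zero, mul_zero, max_self] at this
      exact hp 0 _ (le_antisymm this (apply_nonneg _ _)))
  refine ⟨Θ, hΘ, fun x => ?_⟩
  have h1 : Ψ (Θ x) = x := hΘr x
  have h2 : P (Θ x) = P x := by rw [← hPΨ, h1]
  refine ⟨h2, ?_⟩
  have h3 : Ψ (Θ x) = P (Θ x) + (Φ N (Θ x) - P (Φ N (Θ x))) := rfl
  rw [h1, h2] at h3
  rw [eq_sub_iff_add_eq, add_comm, ← h3]

theorem min_le_mul_rpow {a b X θ : ℝ} (ha : 0 ≤ a) (hX : 0 ≤ X) (hθ : 0 < θ) (hθ1 : θ ≤ 1) :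
    min a (b * X) ≤ max a b * X ^ θ := by
  rcases le_total X 1 with h1 | h1
  · have : X ≤ X ^ θ := by
      simpa using Real.rpow_le_rpow_of_exponent_ge' hX h1 hθ.le hθ1
    refine (min_le_right _ _).trans ?_
    have h2 : b * X ≤ max a b * X := mul_le_mul_of_nonneg_right (le_max_right _ _) hX
    exact h2.trans (mul_le_mul_of_nonneg_left this (ha.trans (le_max_left _ _)))
  · have : 1 ≤ X ^ θ := Real.one_le_rpow h1 hθ.le
    refine (min_le_left _ _).trans ((le_max_left a b).trans ?_)
    exact le_mul_of_one_le_right (ha.trans (le_max_left _ _)) this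

set_option maxHeartbeats 1600000 in
/-- A pseudo-stable leaf through `Y x`, as a `C¹` graph over the slow subspace. -/
theorem exists_leaf (h : Split l r p β α) (hP : SplitProj l r P)
    (hS : OrbitSys p η L Φ) (hp : ∀ n x, p n x = 0 → x = 0) {δ μ ω ω₂ ν γ θ : ℝ} (hδ : 0 < δ)
    (hβ : 0 ≤ β) (hη : 0 ≤ η) (hηδ : η ≤ δ / 2) (hL : 0 ≤ L)
    (hμ : β + δ ≤ μ) (hμω : μ < ω) (hω : ω + δ ≤ α) (hν : β + δ ≤ ν) (hνω : ν < ω₂)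
    (hω₂ : ω₂ + δ ≤ α) (hγ : 0 ≤ γ) (hμγ : μ * γ ≤ ν) (hθ : 0 < θ) (hθ1 : θ ≤ 1)
    (hθω : ω ^ θ * max ν γ ≤ ω₂) {Y : E → E} (hY : ContDiff ℝ 1 Y) (c : E →L[ℝ] E)
    (hYg : ∀ ρ : ℝ, ∃ C, 0 ≤ C ∧ ∀ x, ‖x‖ ≤ ρ → ∀ m k,
      p m (fderiv ℝ (Φ m) (Y x) (fderiv ℝ Y x k)) ≤ C * γ ^ m * ‖k‖) :
    ∃ X : E → E, ContDiff ℝ 1 X ∧ (∀ x, P (X x) = P (c x)) ∧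
      (∀ x m, p m (Φ m (X x) - Φ m (Y x)) ≤ μ ^ m * l 0 (c x - Y x)) ∧
      ∀ ρ : ℝ, ∃ C, 0 ≤ C ∧ ∀ x, ‖x‖ ≤ ρ → ∀ m k,
        p m (fderiv ℝ (Φ m) (X x) (fderiv ℝ X x k) - fderiv ℝ (Φ m) (Y x) (fderiv ℝ Y x k)) ≤
          C * ν ^ m * ‖k‖ := by
  have hμ0 : 0 < μ := by linarith
  have hω0 : 0 < ω := by linarith
  have hν0 : 0 < ν := by linarith
  have hω₂0 : 0 < ω₂ := by linarith
  have hμα : μ + δ ≤ α := by linarith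
  have hωβ : β + δ ≤ ω := by linarith
  have hω₂β : β + δ ≤ ω₂ := by linarith
  choose Θ hΘ hΘP using fun N =>
    exists_mixed_inverse h hP hS hp hδ hβ hμ hμα hη hηδ N
  let g : ℕ → E → E := fun N x => P (c x) + (Φ N (Y x) - P (Φ N (Y x)))
  have hΦY : ∀ N, ContDiff ℝ 1 fun x => Φ N (Y x) := fun N => (hS.contDiff N).comp hY
  have hg : ∀ N, ContDiff ℝ 1 (g N) := fun N =>
    (P.contDiff.comp c.contDiff).add ((hΦY N).sub (P.contDiff.comp (hΦY N)))
  let X : ℕ → E → E := fun N x => Θ N (g N x)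
  have hX : ∀ N, ContDiff ℝ 1 (X N) := fun N => (hΘ N).comp (hg N)
  have hPX : ∀ N x, P (X N x) = P (c x) := fun N x => by
    rw [(hΘP N _).1]; simp [g, hP.idem]
  have hQX : ∀ N x, Φ N (X N x) - P (Φ N (X N x)) = Φ N (Y x) - P (Φ N (Y x)) := fun N x => by
    rw [(hΘP N _).2]; simp [g, hP.idem]
  have hΦX : ∀ m N, ContDiff ℝ 1 fun x => Φ m (X N x) := fun m N => (hS.contDiff m).comp (hX N)
  have hPX' : ∀ N x k, P (fderiv ℝ (X N) x k) = P (c k) := fun N x k => by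
    rw [← fderiv_clm_comp_apply P (hX N)]
    simp only [hPX]
    rw [fderiv_clm_comp_apply P c.contDiff, c.fderiv]
  have hQX' : ∀ N x k, fderiv ℝ (Φ N) (X N x) (fderiv ℝ (X N) x k) -
      P (fderiv ℝ (Φ N) (X N x) (fderiv ℝ (X N) x k)) =
      fderiv ℝ (Φ N) (Y x) (fderiv ℝ Y x k) - P (fderiv ℝ (Φ N) (Y x) (fderiv ℝ Y x k)) := by
    intro N x k
    have e1 : ∀ Z : E → E, ContDiff ℝ 1 Z →
        fderiv ℝ (fun x => Φ N (Z x) - P (Φ N (Z x))) x k =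
        fderiv ℝ (Φ N) (Z x) (fderiv ℝ Z x k) - P (fderiv ℝ (Φ N) (Z x) (fderiv ℝ Z x k)) := by
      intro Z hZ
      have hd : ContDiff ℝ 1 fun x => Φ N (Z x) := (hS.contDiff N).comp hZ
      have hd' : ContDiff ℝ 1 fun x => P (Φ N (Z x)) := P.contDiff.comp hd
      rw [fderiv_fun_sub (hd.differentiable one_ne_zero x) (hd'.differentiable one_ne_zero x),
        sub_apply, fderiv_clm_comp_apply P hd,
        fderiv_comp_apply' (hS.contDiff N) hZ]
    rw [← e1 _ (hX N), ← e1 _ hY]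
    simp only [hQX]
  set ℓ : E → ℝ := fun x => l 0 (c x - Y x) with hℓ
  have hℓ0 : ∀ x, 0 ≤ ℓ x := fun x => apply_nonneg _ _
  have hlPX : ∀ N x, l 0 (X N x - Y x) = ℓ x := fun N x => by
    rw [hℓ, ← hP.l_proj, map_sub, hPX, ← map_sub, hP.l_proj]
  have hbase : ∀ N x m, m ≤ N → p m (Φ m (X N x) - Φ m (Y x)) ≤ μ ^ m * ℓ x := by
    intro N x m hm
    refine h.window hδ hβ hμ hμα hη hηδ (Nat.zero_le N) (S := 0)
      (e := fun m => Φ m (X N x) - Φ m (Y x)) (fun m _ _ => by simpa using hS.lip m (X N x) (Y x))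
      ?_ ?_ ?_ m (Nat.zero_le _) hm
    · have := mul_nonneg hδ.le (hℓ0 x); linarith
    · simp only [hS.start, pow_zero, one_mul, hlPX]; exact le_rfl
    · have : r N (Φ N (X N x) - Φ N (Y x)) = 0 := by
        rw [← hP.r_compl]
        have : Φ N (X N x) - Φ N (Y x) - P (Φ N (X N x) - Φ N (Y x)) =
          (Φ N (X N x) - P (Φ N (X N x))) - (Φ N (Y x) - P (Φ N (Y x))) := by
          rw [map_sub]; abel
        rw [this, hQX, sub_self, map_zero]
      rw [this]
      exact mul_nonneg (by positivity) (hℓ0 x)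
  set κ := μ / ω with hκ
  have hκ0 : 0 < κ := by positivity
  have hκ1 : κ < 1 := (div_lt_one hω0).2 hμω
  have hcauchy : ∀ N x m, m ≤ N →
      p m (Φ m (X (N + 1) x) - Φ m (X N x)) ≤ ω ^ m * (κ ^ N * ℓ x) := by
    intro N x m hm
    refine h.window hδ hβ hωβ hω hη hηδ (Nat.zero_le N) (S := 0)
      (e := fun m => Φ m (X (N + 1) x) - Φ m (X N x))
      (fun m _ _ => by simpa using hS.lip m _ _) ?_ ?_ ?_ m (Nat.zero_le _) hm
    · have := mul_nonneg hδ.le (mul_nonneg (pow_nonneg hκ0.le N) (hℓ0 x)); linarith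
    · simp only [hS.start]
      rw [← hP.l_proj, map_sub, hPX, hPX, sub_self, map_zero]
      exact mul_nonneg (by positivity) (mul_nonneg (by positivity) (hℓ0 x))
    · have e1 : r N (Φ N (X (N + 1) x) - Φ N (X N x)) =
          r N (Φ N (X (N + 1) x) - Φ N (Y x)) := by
        rw [← hP.r_compl, ← hP.r_compl N (Φ N (X (N + 1) x) - Φ N (Y x))]
        congr 1
        have e (a b : E) : a - b - P (a - b) = (a - P a) - (b - P b) := by rw [map_sub]; abel
        rw [e, e, hQX N x]
      rw [e1]
      refine (h.r_le _ _).trans ((hbase (N + 1) x N (Nat.le_succ _)).trans (le_of_eq ?_))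
      rw [hκ, div_pow]; field_simp
  obtain ⟨C₀, hC₀, hC₀'⟩ := seminorm_lower_bound (p 0) (hp 0)
  obtain ⟨C₁, hC₁, hC₁'⟩ := seminorm_bound (p 0)
  have hℓb : ∀ ρ : ℝ, ∃ B, 0 ≤ B ∧ ∀ x, ‖x‖ ≤ ρ → ℓ x ≤ B := by
    intro ρ
    have hc : Continuous ℓ := (seminorm_continuous (l 0)).comp (c.continuous.sub hY.continuous)
    obtain ⟨B, hB⟩ := (isCompact_closedBall (0 : E) ρ).bddAbove_image hc.continuousOn
    refine ⟨max B 0, le_max_right _ _, fun x hx => (hB ⟨x, by simpa using hx, rfl⟩).trans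
      (le_max_left _ _)⟩
  obtain ⟨Bc, hBc, hBc'⟩ : ∃ B, 0 ≤ B ∧ ∀ k, l 0 (c k) ≤ B * ‖k‖ := by
    refine ⟨C₁ * ‖c‖, by positivity, fun k => ?_⟩
    calc l 0 (c k) ≤ C₁ * ‖c k‖ := (h.l_le _ _).trans (hC₁' _)
      _ ≤ C₁ * (‖c‖ * ‖k‖) := by gcongr; exact c.le_opNorm k
      _ = _ := by ring
  let D : ℕ → ℕ → E → E → E := fun m N x k => fderiv ℝ (Φ m) (X N x) (fderiv ℝ (X N) x k)
  let DY : ℕ → E → E → E := fun m x k => fderiv ℝ (Φ m) (Y x) (fderiv ℝ Y x k)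
  have hD0 : ∀ N x k, D 0 N x k = fderiv ℝ (X N) x k := fun N x k => hS.fderiv_start _ _
  have hDY0 : ∀ x k, DY 0 x k = fderiv ℝ Y x k := fun x k => hS.fderiv_start _ _
  have hDbase : ∀ ρ : ℝ, ∃ C, 0 ≤ C ∧ ∀ x, ‖x‖ ≤ ρ → ∀ N m k, m ≤ N →
      p m (D m N x k - DY m x k) ≤ C * ν ^ m * ‖k‖ := by
    intro ρ
    obtain ⟨B, hB, hB'⟩ := hℓb ρ
    obtain ⟨CY, hCY, hCY'⟩ := hYg ρ
    set M := Bc + CY + 2 / δ * (L * B * CY) with hM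
    refine ⟨M, by positivity, fun x hx N m k hm => ?_⟩
    have := h.window hδ hβ hν (by linarith) hη hηδ (Nat.zero_le N) (S := L * B * CY * ‖k‖)
      (M := M * ‖k‖) (w := ν) (e := fun m => D m N x k - DY m x k) ?_ ?_ ?_ ?_ m (Nat.zero_le _) hm
    · calc _ ≤ _ := this
        _ = _ := by ring
    · intro j _ hj
      refine (hS.var j (X N x) (Y x) _ _).trans (add_le_add le_rfl ?_)
      calc min (2 * η) (L * p j (Φ j (X N x) - Φ j (Y x))) * p j (DY j x k)
          ≤ (L * (μ ^ j * B)) * (CY * γ ^ j * ‖k‖) := by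
            refine mul_le_mul ((min_le_right _ _).trans ?_) (hCY' x hx j k) (apply_nonneg _ _)
              (by positivity)
            have := hbase N x j hj.le
            have := hB' x hx
            gcongr
            exact (hbase N x j hj.le).trans (by gcongr)
        _ = L * B * CY * ‖k‖ * (μ * γ) ^ j := by rw [mul_pow]; ring
        _ ≤ _ := by gcongr
    · have h1 : δ * (M * ‖k‖) = δ * (Bc + CY) * ‖k‖ + 2 * (L * B * CY * ‖k‖) := by
        rw [hM]; field_simp
      rw [h1]
      have : 0 ≤ δ * (Bc + CY) * ‖k‖ := by positivity
      linarith
    · simp only [hD0, hDY0, pow_zero, one_mul]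
      rw [← hP.l_proj, map_sub, hPX', ← map_sub, hP.l_proj]
      refine (map_sub_le_add (l 0) _ _).trans ?_
      have h1 : l 0 (fderiv ℝ Y x k) ≤ CY * ‖k‖ := by
        have := hCY' x hx 0 k
        rw [hS.fderiv_start, pow_zero, mul_one] at this
        exact (h.l_le _ _).trans this
      have h2 := hBc' k
      have h3 : 0 ≤ 2 / δ * (L * B * CY) * ‖k‖ := by positivity
      rw [hM]; nlinarith
    · have : r N (D N N x k - DY N x k) = 0 := by
        rw [← hP.r_compl]
        have e1 := hQX' N x k
        have : D N N x k - DY N x k - P (D N N x k - DY N x k) =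
          (D N N x k - P (D N N x k)) - (DY N x k - P (DY N x k)) := by
          rw [map_sub]; abel
        rw [this]
        simp only [D, DY]
        rw [e1, sub_self, map_zero]
      rw [this]; positivity
  have hDcauchy : ∀ ρ : ℝ, ∃ C κ' : ℝ, 0 ≤ C ∧ 0 ≤ κ' ∧ κ' < 1 ∧ ∀ x, ‖x‖ ≤ ρ → ∀ N k,
      p 0 (fderiv ℝ (X (N + 1)) x k - fderiv ℝ (X N) x k) ≤ C * κ' ^ N * ‖k‖ := by
    intro ρ
    obtain ⟨B, hB, hB'⟩ := hℓb ρ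
    obtain ⟨CY, hCY, hCY'⟩ := hYg ρ
    obtain ⟨CD, hCD, hCD'⟩ := hDbase ρ
    set κ' := max (ν / ω₂) (κ ^ θ) with hκ'
    have hκθ : κ ^ θ < 1 := Real.rpow_lt_one hκ0.le hκ1 hθ
    have hκθ0 : 0 < κ ^ θ := by positivity
    have hκ'0 : 0 < κ' := lt_max_of_lt_right hκθ0
    set A := max (2 * η) L with hA
    have hA0 : 0 ≤ A := le_max_of_le_right hL
    set M := CD + 2 / δ * (A * B ^ θ * (CD + CY)) with hM
    have hBθ : 0 ≤ B ^ θ := by positivity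
    refine ⟨M, κ', by positivity, hκ'0.le, max_lt ((div_lt_one hω₂0).2 hνω) hκθ, ?_⟩
    intro x hx N k
    have := h.window hδ hβ hω₂β hω₂ hη hηδ (Nat.zero_le N)
      (S := A * B ^ θ * (CD + CY) * κ' ^ N * ‖k‖)
      (M := M * κ' ^ N * ‖k‖) (w := ω₂) (e := fun m => D m (N + 1) x k - D m N x k)
      ?_ ?_ ?_ ?_ 0 (Nat.zero_le _) (Nat.zero_le _)
    · simpa only [hD0, pow_zero, one_mul] using this
    · intro j _ hj
      refine (hS.var j (X (N + 1) x) (X N x) _ _).trans (add_le_add le_rfl ?_)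
      have hDN : p j (D j N x k) ≤ (CD + CY) * (max ν γ) ^ j * ‖k‖ := by
        have e1 : D j N x k = (D j N x k - DY j x k) + DY j x k := by abel
        rw [e1]
        refine (map_add_le_add (p j) _ _).trans ?_
        have h1 := hCD' x hx N j k hj.le
        have h2 := hCY' x hx j k
        have h3 : ν ^ j ≤ (max ν γ) ^ j := by gcongr; exact le_max_left _ _
        have h4 : γ ^ j ≤ (max ν γ) ^ j := by gcongr; exact le_max_right _ _
        calc _ ≤ CD * ν ^ j * ‖k‖ + CY * γ ^ j * ‖k‖ := add_le_add h1 h2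
          _ ≤ CD * (max ν γ) ^ j * ‖k‖ + CY * (max ν γ) ^ j * ‖k‖ := by gcongr
          _ = _ := by ring
      have hΔ : min (2 * η) (L * p j (Φ j (X (N + 1) x) - Φ j (X N x))) ≤
          A * ((ω ^ θ) ^ j * (κ' ^ N * B ^ θ)) := by
        refine (min_le_mul_rpow (by positivity) (apply_nonneg _ _) hθ hθ1).trans ?_
        refine mul_le_mul_of_nonneg_left ?_ hA0
        calc _ ≤ (ω ^ j * (κ ^ N * B)) ^ θ := by
              refine Real.rpow_le_rpow (apply_nonneg _ _) ((hcauchy N x j hj.le).trans ?_) hθ.le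
              have := hB' x hx
              gcongr
          _ = (ω ^ θ) ^ j * ((κ ^ θ) ^ N * B ^ θ) := by
              rw [Real.mul_rpow (by positivity) (by positivity),
                Real.mul_rpow (by positivity) (by positivity), ← Real.rpow_natCast_mul hω0.le,
                ← Real.rpow_natCast_mul hκ0.le, mul_comm (j : ℝ), mul_comm (N : ℝ),
                Real.rpow_mul_natCast hω0.le, Real.rpow_mul_natCast hκ0.le]
          _ ≤ _ := by
              have : κ ^ θ ≤ κ' := le_max_right _ _
              gcongr
      calc _ ≤ (A * ((ω ^ θ) ^ j * (κ' ^ N * B ^ θ))) * ((CD + CY) * (max ν γ) ^ j * ‖k‖) :=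
            mul_le_mul hΔ hDN (apply_nonneg _ _) (by positivity)
        _ = A * B ^ θ * (CD + CY) * κ' ^ N * ‖k‖ * (ω ^ θ * max ν γ) ^ j := by
            rw [mul_pow]; ring
        _ ≤ _ := by
          have : 0 ≤ ω ^ θ * max ν γ := by positivity
          gcongr
    · have h1 : δ * (M * κ' ^ N * ‖k‖) = δ * CD * κ' ^ N * ‖k‖ +
          2 * (A * B ^ θ * (CD + CY) * κ' ^ N * ‖k‖) := by
        rw [hM]; field_simp
      rw [h1]
      have : 0 ≤ δ * CD * κ' ^ N * ‖k‖ := by positivity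
      linarith
    · simp only [hD0]
      rw [← hP.l_proj, map_sub, hPX', hPX', sub_self, map_zero]
      positivity
    · have e1 : r N (D N (N + 1) x k - D N N x k) = r N (D N (N + 1) x k - DY N x k) := by
        rw [← hP.r_compl, ← hP.r_compl N (D N (N + 1) x k - DY N x k)]
        congr 1
        have : D N N x k - P (D N N x k) = DY N x k - P (DY N x k) := hQX' N x k
        have e (a b : E) : a - b - P (a - b) = (a - P a) - (b - P b) := by rw [map_sub]; abel
        rw [e, e, this]
      rw [e1]
      refine (h.r_le _ _).trans ((hCD' x hx (N + 1) N k (Nat.le_succ _)).trans ?_)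
      have h2 : ν ^ N = ω₂ ^ N * (ν / ω₂) ^ N := by rw [div_pow]; field_simp
      have h3 : (ν / ω₂) ^ N ≤ κ' ^ N := by gcongr; exact le_max_left _ _
      have h4 : CD ≤ M := by rw [hM]; simp only [le_add_iff_nonneg_right]; positivity
      calc CD * ν ^ N * ‖k‖ = ω₂ ^ N * (CD * (ν / ω₂) ^ N * ‖k‖) := by rw [h2]; ring
        _ ≤ ω₂ ^ N * (M * κ' ^ N * ‖k‖) := by gcongr
  obtain ⟨X', hX', hlim, hlim'⟩ := exists_contDiff_limit hX (fun ρ => by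
    obtain ⟨B, hB, hB'⟩ := hℓb ρ
    obtain ⟨C, κ', hC, hκ', hκ'1, hCκ⟩ := hDcauchy ρ
    refine ⟨C₀ * max B C, max κ κ', le_max_of_le_right hκ', max_lt hκ1 hκ'1, fun x hx n => ?_⟩
    have hmB : B ≤ max B C := le_max_left _ _
    have hmC : C ≤ max B C := le_max_right _ _
    constructor
    · refine (hC₀' _).trans ?_
      have h1 := hcauchy n x 0 (Nat.zero_le _)
      simp only [hS.start, pow_zero, one_mul] at h1
      have h2 := hB' x hx
      have : κ ^ n ≤ (max κ κ') ^ n := by gcongr; exact le_max_left _ _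
      calc C₀ * p 0 (X (n + 1) x - X n x) ≤ C₀ * (κ ^ n * ℓ x) := by gcongr
        _ ≤ C₀ * ((max κ κ') ^ n * max B C) := by
          have := hℓ0 x
          have := h2.trans hmB
          gcongr
        _ = _ := by ring
    · refine ContinuousLinearMap.opNorm_le_bound _ (by positivity) fun k => ?_
      refine (hC₀' _).trans ?_
      have h1 := hCκ x hx n k
      have : κ' ^ n ≤ (max κ κ') ^ n := by gcongr; exact le_max_right _ _
      calc C₀ * p 0 ((fderiv ℝ (X (n + 1)) x - fderiv ℝ (X n) x) k)
          ≤ C₀ * (C * κ' ^ n * ‖k‖) := by gcongr; exact h1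
        _ ≤ C₀ * (max B C * (max κ κ') ^ n * ‖k‖) := by gcongr
        _ = _ := by ring)
  refine ⟨X', hX', fun x => ?_, fun x m => ?_, fun ρ => ?_⟩
  · refine tendsto_nhds_unique ((P.continuous.tendsto _).comp (hlim x)) ?_
    refine tendsto_const_nhds.congr fun N => ?_
    exact (hPX N x).symm
  · refine le_of_tendsto (x := Filter.atTop) (f := fun N => p m (Φ m (X N x) - Φ m (Y x))) ?_ ?_
    · exact ((seminorm_continuous (p m)).tendsto _).comp
        ((((hS.contDiff m).continuous.tendsto _).comp (hlim x)).sub_const _)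
    · filter_upwards [Filter.eventually_ge_atTop m] with N hN using hbase N x m hN
  · obtain ⟨C, hC, hC'⟩ := hDbase ρ
    refine ⟨C, hC, fun x hx m k => ?_⟩
    refine le_of_tendsto (x := Filter.atTop) (f := fun N => p m (D m N x k - DY m x k)) ?_ ?_
    · refine ((seminorm_continuous (p m)).tendsto _).comp (Filter.Tendsto.sub_const ?_ _)
      have h1 : Filter.Tendsto (fun N => fderiv ℝ (Φ m) (X N x)) Filter.atTop
          (nhds (fderiv ℝ (Φ m) (X' x))) :=
        (((hS.contDiff m).continuous_fderiv one_ne_zero).tendsto _).comp (hlim x)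
      have h2 : Filter.Tendsto (fun N => fderiv ℝ (X N) x k) Filter.atTop
          (nhds (fderiv ℝ X' x k)) :=
        ((ContinuousLinearMap.apply ℝ E k).continuous.tendsto _).comp (hlim' x)
      exact ((isBoundedBilinearMap_apply (𝕜 := ℝ) (E := E) (F := E)).continuous.tendsto
        (fderiv ℝ (Φ m) (X' x), fderiv ℝ X' x k)).comp (h1.prodMk_nhds h2)
    · filter_upwards [Filter.eventually_ge_atTop m] with N hN using hC' x hx N m k hN

end Leaf

/-- The weight `w` leaves room `δ` in the gap `(β, α)`. -/
structure Room (β α δ w : ℝ) : Prop where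
  lo : β + δ ≤ w
  hi : w + δ ≤ α

/-- The sequence `e` grows strictly slower than `w ^ m`. -/
def GrowsBelow (p : ℕ → Seminorm ℝ E) (w : ℝ) (e : ℕ → E) : Prop :=
  ∃ C θ : ℝ, 0 ≤ θ ∧ θ < w ∧ ∀ m, p m (e m) ≤ C * θ ^ m

/-- An orbit system together with a splitting whose gap dominates the perturbation. -/
structure SplitSys (p : ℕ → Seminorm ℝ E) (Φ : ℕ → E → E) (η L δ : ℝ)
    (l r : ℕ → Seminorm ℝ E) (β α : ℝ) (P : E →L[ℝ] E) : Prop where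
  split : Split l r p β α
  proj : SplitProj l r P
  sys : OrbitSys p η L Φ
  definite : ∀ n x, p n x = 0 → x = 0
  δ_pos : 0 < δ
  β_nonneg : 0 ≤ β
  η_nonneg : 0 ≤ η
  small : η ≤ δ / 1000
  L_nonneg : 0 ≤ L

namespace SplitSys

variable {l r p : ℕ → Seminorm ℝ E} {β α η L δ w : ℝ} {Φ : ℕ → E → E} {P : E →L[ℝ] E}

theorem l_zero (h : SplitSys p Φ η L δ l r β α P) {x y : E} (hxy : P x = P y) : l 0 (x - y) = 0 :=
  h.proj.l_eq_zero (by rw [map_sub, hxy, sub_self])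

theorem small' (h : SplitSys p Φ η L δ l r β α P) : η ≤ δ / 2 := by
  have := h.small; have := h.δ_pos; linarith

theorem ratio_le (h : SplitSys p Φ η L δ l r β α P) {X : ℝ} (hX : 0 ≤ X) :
    η / δ * X ≤ 1 / 1000 * X := by
  refine mul_le_mul_of_nonneg_right ?_ hX
  rw [div_le_iff₀ h.δ_pos]; have := h.small; linarith

theorem past_diff (h : SplitSys p Φ η L δ l r β α P) (hw : Room β α δ w) {n : ℕ} {x y : E}
    (hxy : P x = P y) :
    (∀ m, m ≤ n → p m (Φ m x - Φ m y) ≤ w ^ m / w ^ n * p n (Φ n x - Φ n y)) ∧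
    l n (Φ n x - Φ n y) ≤ 1 / 1000 * p n (Φ n x - Φ n y) := by
  have := h.split.from_past h.δ_pos h.β_nonneg hw.lo hw.hi h.η_nonneg h.small' (n := n)
    (e := fun m => Φ m x - Φ m y) (S := 0) le_rfl
    (by simp only [h.sys.start]; exact h.l_zero hxy)
    (fun m _ => by simpa using h.sys.lip m x y)
  simp only [mul_zero, add_zero] at this
  exact ⟨this.1, this.2.trans (h.ratio_le (apply_nonneg _ _))⟩

theorem past_orbit (h : SplitSys p Φ η L δ l r β α P) (hw : Room β α δ w) {n : ℕ} {x : E}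
    (hx : P x = 0) :
    (∀ m, m ≤ n → p m (Φ m x) ≤ w ^ m / w ^ n * p n (Φ n x)) ∧
    l n (Φ n x) ≤ 1 / 1000 * p n (Φ n x) := by
  simpa [h.sys.fixed] using h.past_diff hw (n := n) (x := x) (y := 0) (by rw [hx, map_zero])

theorem past_var (h : SplitSys p Φ η L δ l r β α P) (hw : Room β α δ w) {n : ℕ} {x y u v : E}
    {S : ℝ} (huv : P u = P v) (hS : 0 ≤ S)
    (hS' : ∀ m, m < n → p m (Φ m x - Φ m y) * p m (fderiv ℝ (Φ m) y v) ≤ S * (w ^ m / w ^ n)) :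
    (∀ m, m ≤ n → p m (fderiv ℝ (Φ m) x u - fderiv ℝ (Φ m) y v) ≤
      w ^ m / w ^ n * (p n (fderiv ℝ (Φ n) x u - fderiv ℝ (Φ n) y v) + 2 / δ * (L * S))) ∧
    l n (fderiv ℝ (Φ n) x u - fderiv ℝ (Φ n) y v) ≤
      1 / 1000 * p n (fderiv ℝ (Φ n) x u - fderiv ℝ (Φ n) y v) + 2 / δ * (L * S) := by
  have := h.split.from_past h.δ_pos h.β_nonneg hw.lo hw.hi h.η_nonneg h.small' (n := n)
    (e := fun m => fderiv ℝ (Φ m) x u - fderiv ℝ (Φ m) y v) (S := L * S)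
    (mul_nonneg h.L_nonneg hS)
    (by simp only [h.sys.fderiv_start]; exact h.l_zero huv)
    (fun m hm => (h.sys.var m x y u v).trans (add_le_add le_rfl (by
      refine (mul_le_mul_of_nonneg_right (min_le_right _ _) (apply_nonneg _ _)).trans ?_
      rw [mul_assoc, mul_assoc]
      exact mul_le_mul_of_nonneg_left (hS' m hm) h.L_nonneg)))
  exact ⟨this.1, this.2.trans (add_le_add (h.ratio_le (apply_nonneg _ _)) le_rfl)⟩

theorem past_lin (h : SplitSys p Φ η L δ l r β α P) (hw : Room β α δ w) {n : ℕ} {x u : E}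
    (hu : P u = 0) :
    (∀ m, m ≤ n → p m (fderiv ℝ (Φ m) x u) ≤ w ^ m / w ^ n * p n (fderiv ℝ (Φ n) x u)) ∧
    l n (fderiv ℝ (Φ n) x u) ≤ 1 / 1000 * p n (fderiv ℝ (Φ n) x u) := by
  simpa using h.past_var hw (n := n) (x := x) (y := x) (u := u) (v := 0) (S := 0)
    (by rw [hu, map_zero]) le_rfl (fun m _ => by simp)

theorem future_diff (h : SplitSys p Φ η L δ l r β α P) (hw : Room β α δ w) (n : ℕ) {x y : E}
    (hg : GrowsBelow p w fun m => Φ m x - Φ m y) :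
    (∀ m, n ≤ m → p m (Φ m x - Φ m y) ≤ w ^ m / w ^ n * p n (Φ n x - Φ n y)) ∧
    r n (Φ n x - Φ n y) ≤ 1 / 1000 * p n (Φ n x - Φ n y) := by
  obtain ⟨C, θ, hθ, hθw, hC⟩ := hg
  have := h.split.from_future h.δ_pos h.β_nonneg hw.lo hw.hi h.η_nonneg h.small' n
    (e := fun m => Φ m x - Φ m y) (S := 0) le_rfl hθ hθw hC
    (fun m _ => by simpa using h.sys.lip m x y)
  simp only [mul_zero, add_zero] at this
  exact ⟨this.1, this.2.trans (h.ratio_le (apply_nonneg _ _))⟩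

theorem future_orbit (h : SplitSys p Φ η L δ l r β α P) (hw : Room β α δ w) (n : ℕ) {x : E}
    (hg : GrowsBelow p w fun m => Φ m x) :
    (∀ m, n ≤ m → p m (Φ m x) ≤ w ^ m / w ^ n * p n (Φ n x)) ∧
    r n (Φ n x) ≤ 1 / 1000 * p n (Φ n x) := by
  simpa [h.sys.fixed] using h.future_diff hw n (x := x) (y := 0) (by simpa [h.sys.fixed] using hg)

theorem future_var (h : SplitSys p Φ η L δ l r β α P) (hw : Room β α δ w) (n : ℕ) {x y u v : E}
    {S : ℝ} (hg : GrowsBelow p w fun m => fderiv ℝ (Φ m) x u - fderiv ℝ (Φ m) y v) (hS : 0 ≤ S)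
    (hS' : ∀ m, n ≤ m → p m (Φ m x - Φ m y) * p m (fderiv ℝ (Φ m) y v) ≤ S * (w ^ m / w ^ n)) :
    (∀ m, n ≤ m → p m (fderiv ℝ (Φ m) x u - fderiv ℝ (Φ m) y v) ≤
      w ^ m / w ^ n * (p n (fderiv ℝ (Φ n) x u - fderiv ℝ (Φ n) y v) + 2 / δ * (L * S))) ∧
    r n (fderiv ℝ (Φ n) x u - fderiv ℝ (Φ n) y v) ≤
      1 / 1000 * p n (fderiv ℝ (Φ n) x u - fderiv ℝ (Φ n) y v) + 2 / δ * (L * S) := by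
  obtain ⟨C, θ, hθ, hθw, hC⟩ := hg
  have := h.split.from_future h.δ_pos h.β_nonneg hw.lo hw.hi h.η_nonneg h.small' n
    (e := fun m => fderiv ℝ (Φ m) x u - fderiv ℝ (Φ m) y v) (S := L * S)
    (mul_nonneg h.L_nonneg hS) hθ hθw hC
    (fun m hm => (h.sys.var m x y u v).trans (add_le_add le_rfl (by
      refine (mul_le_mul_of_nonneg_right (min_le_right _ _) (apply_nonneg _ _)).trans ?_
      rw [mul_assoc, mul_assoc]
      exact mul_le_mul_of_nonneg_left (hS' m hm) h.L_nonneg)))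
  exact ⟨this.1, this.2.trans (add_le_add (h.ratio_le (apply_nonneg _ _)) le_rfl)⟩

theorem future_lin (h : SplitSys p Φ η L δ l r β α P) (hw : Room β α δ w) (n : ℕ) {x u : E}
    (hg : GrowsBelow p w fun m => fderiv ℝ (Φ m) x u) :
    (∀ m, n ≤ m → p m (fderiv ℝ (Φ m) x u) ≤ w ^ m / w ^ n * p n (fderiv ℝ (Φ n) x u)) ∧
    r n (fderiv ℝ (Φ n) x u) ≤ 1 / 1000 * p n (fderiv ℝ (Φ n) x u) := by
  simpa using h.future_var hw n (x := x) (y := x) (u := u) (v := 0) (S := 0)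
    (by simpa using hg) le_rfl (fun m _ => by simp)

theorem two_parts (h : SplitSys p Φ η L δ l r β α P) {n : ℕ} {x y z : E} {s : ℝ} (hs : 0 ≤ s)
    (hx : x = y + z) (hy : l n y ≤ 1 / 1000 * p n y + s) (hz : r n z ≤ 1 / 1000 * p n z + s) :
    p n y + p n z ≤ 4 * p n x + 12 * s :=
  h.split.two_parts hs hx (hy.trans (by have := apply_nonneg (p n) y; linarith))
    (hz.trans (by have := apply_nonneg (p n) z; linarith))

theorem two_parts_zero (h : SplitSys p Φ η L δ l r β α P) {n : ℕ} {x y z : E}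
    (hx : x = y + z) (hy : l n y ≤ 1 / 1000 * p n y) (hz : r n z ≤ 1 / 1000 * p n z) :
    p n y + p n z ≤ 4 * p n x := by
  simpa using h.two_parts le_rfl hx (by simpa using hy) (by simpa using hz)

end SplitSys

/-- `X` parametrizes the leaves through `Y x` with slow coordinates `P (c x)`. -/
structure IsLeaf (p : ℕ → Seminorm ℝ E) (Φ : ℕ → E → E) (l : ℕ → Seminorm ℝ E) (P : E →L[ℝ] E)
    (μ ν : ℝ) (Y : E → E) (c : E →L[ℝ] E) (X : E → E) : Prop where
  contDiff : ContDiff ℝ 1 X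
  proj : ∀ x, P (X x) = P (c x)
  close : ∀ x m, p m (Φ m (X x) - Φ m (Y x)) ≤ μ ^ m * l 0 (c x - Y x)
  deriv : ∀ ρ : ℝ, ∃ C, 0 ≤ C ∧ ∀ x, ‖x‖ ≤ ρ → ∀ m k,
    p m (fderiv ℝ (Φ m) (X x) (fderiv ℝ X x k) - fderiv ℝ (Φ m) (Y x) (fderiv ℝ Y x k)) ≤
      C * ν ^ m * ‖k‖

namespace IsLeaf

variable {l p : ℕ → Seminorm ℝ E} {Φ : ℕ → E → E} {P : E →L[ℝ] E} {μ ν w : ℝ} {Y X : E → E}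
  {c : E →L[ℝ] E}

theorem proj_fderiv (h : IsLeaf p Φ l P μ ν Y c X) (x k : E) :
    P (fderiv ℝ X x k) = P (c k) := by
  rw [← fderiv_clm_comp_apply P h.contDiff]
  simp only [h.proj]
  rw [fderiv_clm_comp_apply P c.contDiff, c.fderiv]

theorem grows (h : IsLeaf p Φ l P μ ν Y c X) (hμ : 0 ≤ μ) (hw : μ < w) (x : E) :
    GrowsBelow p w fun m => Φ m (X x) - Φ m (Y x) :=
  ⟨l 0 (c x - Y x), μ, hμ, hw, fun m => (h.close x m).trans_eq (mul_comm _ _)⟩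

theorem grows_fderiv (h : IsLeaf p Φ l P μ ν Y c X) (hν : 0 ≤ ν) (hw : ν < w) (x k : E) :
    GrowsBelow p w fun m =>
      fderiv ℝ (Φ m) (X x) (fderiv ℝ X x k) - fderiv ℝ (Φ m) (Y x) (fderiv ℝ Y x k) := by
  obtain ⟨C, -, hC⟩ := h.deriv ‖x‖
  exact ⟨C * ‖k‖, ν, hν, hw, fun m => (hC x le_rfl m k).trans_eq (by ring)⟩

end IsLeaf

theorem GrowsBelow.neg {p : ℕ → Seminorm ℝ E} {w : ℝ} {e f : ℕ → E} (h : GrowsBelow p w e)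
    (hf : ∀ m, f m = -e m) : GrowsBelow p w f := by
  obtain ⟨C, θ, hθ, hθw, hC⟩ := h
  exact ⟨C, θ, hθ, hθw, fun m => by rw [hf, map_neg_eq_map]; exact hC m⟩

theorem GrowsBelow.add {p : ℕ → Seminorm ℝ E} {w : ℝ} {e f g : ℕ → E} (he : GrowsBelow p w e)
    (hf : GrowsBelow p w f) (hg : ∀ m, g m = e m + f m) : GrowsBelow p w g := by
  obtain ⟨C, θ, hθ, hθw, hC⟩ := he
  obtain ⟨C', θ', hθ', hθw', hC'⟩ := hf
  refine ⟨max C 0 + max C' 0, max θ θ', le_max_of_le_left hθ, max_lt hθw hθw', fun m => ?_⟩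
  rw [hg, add_mul]
  refine (map_add_le_add (p m) _ _).trans (add_le_add ((hC m).trans ?_) ((hC' m).trans ?_))
  · exact mul_le_mul (le_max_left _ _) (by gcongr; exact le_max_left _ _) (by positivity)
      (le_max_right _ _)
  · exact mul_le_mul (le_max_left _ _) (by gcongr; exact le_max_right _ _) (by positivity)
      (le_max_right _ _)

theorem source_le {δ L ζ c V : ℝ} (hδ : 0 < δ) (hLζ : L * ζ * 100000 ≤ δ) (hV : 0 ≤ V)
    (hc : 0 ≤ c) : 2 / δ * (L * (c * ζ * V)) ≤ c / 50000 * V := by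
  rw [div_mul_eq_mul_div, div_le_iff₀ hδ]
  have := mul_le_mul_of_nonneg_right hLζ (mul_nonneg hc hV)
  nlinarith

/-- Summation of increments from the past against a growth bound. -/
theorem telescope_past {Q : ℕ → Seminorm ℝ E} {B ρ c : ℝ} (hB : 0 ≤ B) (hBρ : B < ρ)
    (hQ : ∀ m x, Q (m + 1) x ≤ B * Q m x) {n : ℕ} {e : ℕ → E} (hc : 0 ≤ c)
    (he : ∀ m, m < n → Q (m + 1) (e (m + 1) - e m) ≤ c * (ρ ^ m / ρ ^ n)) :
    Q n (e n - e 0) ≤ c / (ρ - B) := by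
  have hρ : 0 < ρ := by linarith
  have h1 : 0 < ρ - B := by linarith
  have key : ∀ j, j ≤ n → Q j (e j - e 0) ≤ c / (ρ - B) * (ρ ^ j / ρ ^ n) := by
    intro j
    induction j with
    | zero => intro _; simp only [sub_self, map_zero]; positivity
    | succ j ih =>
      intro hj
      have e1 : e (j + 1) - e 0 = (e j - e 0) + (e (j + 1) - e j) := by abel
      calc Q (j + 1) (e (j + 1) - e 0) ≤ Q (j + 1) (e j - e 0) + Q (j + 1) (e (j + 1) - e j) := by
            rw [e1]; exact map_add_le_add _ _ _
        _ ≤ B * (c / (ρ - B) * (ρ ^ j / ρ ^ n)) + c * (ρ ^ j / ρ ^ n) :=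
            add_le_add ((hQ _ _).trans (mul_le_mul_of_nonneg_left (ih (by omega)) hB))
              (he j (by omega))
        _ = _ := by rw [pow_succ]; field_simp; ring
  have := key n le_rfl
  rwa [div_self (by positivity), mul_one] at this

/-- Summation of increments from the future against an expansion bound. -/
theorem telescope_future {Q : ℕ → Seminorm ℝ E} {a ρ c : ℝ} (hρ : 0 < ρ) (hρa : ρ < a)
    (hQ : ∀ m x, a * Q m x ≤ Q (m + 1) x) {n : ℕ} {e : ℕ → E} (hc : 0 ≤ c)
    (he : ∀ m, n ≤ m → Q (m + 1) (e (m + 1) - e m) ≤ c * (ρ ^ m / ρ ^ n)) (M : ℕ) (hM : n ≤ M) :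
    Q n (e M - e n) ≤ c / (a - ρ) := by
  have ha : 0 < a := by linarith
  have h1 : 0 < a - ρ := by linarith
  have hQ' : ∀ j x, a ^ j * Q n x ≤ Q (n + j) x := by
    intro j x
    induction j with
    | zero => simp
    | succ j ih =>
      calc a ^ (j + 1) * Q n x = a * (a ^ j * Q n x) := by ring
        _ ≤ a * Q (n + j) x := by gcongr
        _ ≤ _ := hQ _ _
  have key : ∀ j, Q n (e (n + j) - e n) ≤ c / (a - ρ) * (1 - (ρ / a) ^ j) := by
    intro j
    induction j with
    | zero => simp
    | succ j ih =>
      have e1 : e (n + (j + 1)) - e n = (e (n + j) - e n) + (e (n + j + 1) - e (n + j)) := by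
        rw [add_assoc]; abel
      have h2 : Q n (e (n + j + 1) - e (n + j)) ≤ c * ρ ^ j / a ^ (j + 1) := by
        rw [le_div_iff₀ (by positivity), mul_comm]
        refine (hQ' _ _).trans ((he (n + j) (by omega)).trans_eq ?_)
        rw [pow_add]; field_simp
      calc Q n (e (n + (j + 1)) - e n) ≤ c / (a - ρ) * (1 - (ρ / a) ^ j) + c * ρ ^ j / a ^ (j + 1) := by
            rw [e1]; exact (map_add_le_add _ _ _).trans (add_le_add ih h2)
        _ = _ := by rw [pow_succ, pow_succ, div_pow]; field_simp; ring
  obtain ⟨j, rfl⟩ := Nat.exists_eq_add_of_le hM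
  refine (key j).trans (mul_le_of_le_one_right (by positivity) ?_)
  have : 0 ≤ (ρ / a) ^ j := by positivity
  linarith

section Unstable

variable {lk rk p : ℕ → Seminorm ℝ E} {βk αk η L δ wa ωk γ μ ν : ℝ} {Φ : ℕ → E → E}
  {Pk : E →L[ℝ] E} {q : E → E}

/-- Local bounds for the projection `q` along the stable leaves onto the unstable set. -/
theorem fast_estimate (hk : SplitSys p Φ η L δ lk rk βk αk Pk) (hwa : Room βk αk δ wa)
    (hωk : Room βk αk δ ωk) (hωa : ωk = wa * γ) (hμ : 0 ≤ μ) (hμw : μ < wa) (hν : 0 ≤ ν)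
    (hνω : ν < ωk) (hγ : 0 < γ)
    (hfwd : ∀ n m x h, n ≤ m →
      p m (fderiv ℝ (Φ m) x h) ≤ γ ^ m / γ ^ n * p n (fderiv ℝ (Φ n) x h))
    (hq : IsLeaf p Φ lk Pk μ ν id 0 q) {n : ℕ} {w : E} {ζ : ℝ}
    (hw : p n (Φ n w) ≤ ζ) (hζ : L * ζ * 100000 ≤ δ) (h : E) :
    (∀ m, m ≤ n → p m (Φ m (q w)) ≤ ωk ^ m / ωk ^ n * (4 * ζ)) ∧
    (∀ m, m ≤ n → p m (fderiv ℝ (Φ m) (q w) (fderiv ℝ q w h)) ≤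
      ωk ^ m / ωk ^ n * (5 * p n (fderiv ℝ (Φ n) w h))) ∧
    rk n (fderiv ℝ (Φ n) (q w) (fderiv ℝ q w h) - fderiv ℝ (Φ n) w h) ≤
      1 / 50 * p n (fderiv ℝ (Φ n) w h) := by
  have hζ0 : 0 ≤ ζ := (apply_nonneg _ _).trans hw
  have hδ := hk.δ_pos
  have hwa0 : 0 < wa := by have := hwa.lo; have := hk.β_nonneg; linarith
  have hωk0 : 0 < ωk := by rw [hωa]; positivity
  set V := p n (fderiv ℝ (Φ n) w h) with hV
  have hV0 : 0 ≤ V := apply_nonneg _ _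
  have hPq : Pk (q w) = 0 := by simpa using hq.proj w
  have hPq' : Pk (fderiv ℝ q w h) = 0 := by simpa using hq.proj_fderiv w h
  obtain ⟨ha, ha'⟩ := hk.future_diff hwa n (hq.grows hμ hμw w)
  obtain ⟨hy, hy'⟩ := hk.past_orbit hωk (n := n) hPq
  have h2 := hk.two_parts_zero (x := Φ n w) (y := Φ n (q w)) (z := Φ n w - Φ n (q w)) (n := n)
    (by abel) hy' (by rw [map_sub_rev, map_sub_rev (p n)]; exact ha')
  rw [map_sub_rev (p n)] at h2
  have hya : p n (Φ n (q w)) ≤ 4 * ζ := by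
    have := apply_nonneg (p n) (Φ n (q w) - Φ n w); linarith
  have haa : p n (Φ n (q w) - Φ n w) ≤ 4 * ζ := by
    have := apply_nonneg (p n) (Φ n (q w)); linarith
  have hgd : GrowsBelow p ωk fun m =>
      fderiv ℝ (Φ m) (q w) (fderiv ℝ q w h) - fderiv ℝ (Φ m) w h := by
    simpa using hq.grows_fderiv hν hνω w h
  obtain ⟨-, hz⟩ := hk.future_var hωk n hgd (S := 4 * ζ * V) (by positivity) (fun m hm => by
    calc p m (Φ m (q w) - Φ m w) * p m (fderiv ℝ (Φ m) w h)
        ≤ (wa ^ m / wa ^ n * (4 * ζ)) * (γ ^ m / γ ^ n * V) := by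
          refine mul_le_mul ((ha m hm).trans ?_) (hfwd n m w h hm) (apply_nonneg _ _)
            (by positivity)
          exact mul_le_mul_of_nonneg_left haa (by positivity)
      _ = _ := by rw [hωa, mul_pow, mul_pow]; field_simp)
  have hsrc := source_le (c := 4) hδ hζ hV0 (by norm_num)
  obtain ⟨hyd, hyd'⟩ := hk.past_lin hωk (n := n) (x := q w) hPq'
  have h3 := hk.two_parts (x := fderiv ℝ (Φ n) w h) (y := fderiv ℝ (Φ n) (q w) (fderiv ℝ q w h))
    (z := fderiv ℝ (Φ n) w h - fderiv ℝ (Φ n) (q w) (fderiv ℝ q w h)) (n := n)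
    (s := 4 / 50000 * V) (by positivity) (by abel) (hyd'.trans (by linarith [hV0]))
    (by rw [map_sub_rev, map_sub_rev (p n)]; linarith)
  rw [map_sub_rev (p n)] at h3
  have e1 := apply_nonneg (p n) (fderiv ℝ (Φ n) (q w) (fderiv ℝ q w h))
  have e2 := apply_nonneg (p n) (fderiv ℝ (Φ n) (q w) (fderiv ℝ q w h) - fderiv ℝ (Φ n) w h)
  refine ⟨fun m hm => (hy m hm).trans (by gcongr), fun m hm => (hyd m hm).trans ?_, by linarith⟩
  refine mul_le_mul_of_nonneg_left ?_ (by positivity)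
  linarith

variable {l r Q : ℕ → Seminorm ℝ E} {β α B ω μi : ℝ} {P : E →L[ℝ] E} {X : E → E}

/-- Closeness of the linearization to the derivative cocycle on an unstable band. -/
theorem unstable_band_estimate (hk : SplitSys p Φ η L δ lk rk βk αk Pk) (hwa : Room βk αk δ wa)
    (hωk : Room βk αk δ ωk) (hωa : ωk = wa * γ) (hμ : 0 ≤ μ) (hμw : μ < wa) (hν : 0 ≤ ν)
    (hνω : ν < ωk) (hγ : 0 < γ)
    (hfwd : ∀ n m x h, n ≤ m →
      p m (fderiv ℝ (Φ m) x h) ≤ γ ^ m / γ ^ n * p n (fderiv ℝ (Φ n) x h))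
    (hq : IsLeaf p Φ lk Pk μ ν id 0 q)
    (hi : SplitSys p Φ η L δ l r β α P) (hω : Room β α δ ω) (hPk : ∀ x, Pk (P x) = Pk x)
    (hμi : 0 ≤ μi) (hμω : μi < ω)
    (hX : IsLeaf p Φ l P μi μi (fun _ => 0) (ContinuousLinearMap.id ℝ E) X)
    (hQk : ∀ n x, Q n x ≤ rk n x) (hQi : ∀ n x, Q n x ≤ r n x)
    (hB : 0 ≤ B) (hQ : ∀ m x, Q (m + 1) x ≤ B * Q m x) (hωk1 : 1 ≤ ωk) (hBω : B < ωk * ω)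
    {n : ℕ} {w : E} {ζ : ℝ} (hw : p n (Φ n w) ≤ ζ) (hζ : L * ζ * 100000 ≤ δ)
    (hζ' : L * ζ * 100000 ≤ ωk * ω - B) (h : E) :
    Q n (fderiv ℝ q w h - fderiv ℝ X (q w) (fderiv ℝ q w h) - fderiv ℝ (Φ n) w h) ≤
      1 / 4 * p n (fderiv ℝ (Φ n) w h) := by
  obtain ⟨hy, hyd, hzr⟩ := fast_estimate hk hwa hωk hωa hμ hμw hν hνω hγ hfwd hq hw hζ h
  have hζ0 : 0 ≤ ζ := (apply_nonneg _ _).trans hw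
  have hδ := hi.δ_pos
  have hω0 : 0 < ω := by have := hω.lo; have := hi.β_nonneg; linarith
  have hωk0 : 0 < ωk := by linarith
  have hL := hk.L_nonneg
  set V := p n (fderiv ℝ (Φ n) w h) with hV
  have hV0 : 0 ≤ V := apply_nonneg _ _
  set y := q w
  set y' := fderiv ℝ q w h with hy'
  set u' := fderiv ℝ X y y'
  have hyn : p n (Φ n y) ≤ 4 * ζ := by
    have := hy n le_rfl; rwa [div_self (by positivity), one_mul] at this
  have hydn : p n (fderiv ℝ (Φ n) y y') ≤ 5 * V := by
    have := hyd n le_rfl; rwa [div_self (by positivity), one_mul] at this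
  have hPX : P (X y) = P y := hX.proj y
  have hPX' : P u' = P y' := hX.proj_fderiv y y'
  have hPku : Pk u' = 0 := by
    have : Pk y' = 0 := by simpa using hq.proj_fderiv w h
    rw [← hPk, hPX', hPk, this]
  have hgX : GrowsBelow p ω fun m => Φ m (X y) := by
    simpa [hi.sys.fixed] using hX.grows hμi hμω y
  have hgX' : GrowsBelow p ω fun m => fderiv ℝ (Φ m) (X y) u' := by
    simpa using hX.grows_fderiv hμi hμω y y'
  obtain ⟨hd, hd'⟩ := hi.past_diff hω (n := n) hPX.symm
  obtain ⟨-, hπ⟩ := hi.future_orbit hω n hgX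
  have h2 := hi.two_parts_zero (x := Φ n y) (n := n) (by abel) hd' hπ
  have hdn : p n (Φ n y - Φ n (X y)) ≤ 16 * ζ := by
    have := apply_nonneg (p n) (Φ n (X y)); linarith
  obtain ⟨-, hu⟩ := hi.future_lin hω n hgX'
  obtain ⟨huk, -⟩ := hk.past_lin hωk (n := n) (x := X y) hPku
  set U := p n (fderiv ℝ (Φ n) (X y) u') with hU
  have hU0 : 0 ≤ U := apply_nonneg _ _
  have hpow : ∀ m, m ≤ n → ωk ^ m / ωk ^ n ≤ 1 := fun m hm =>
    div_le_one_of_le₀ (pow_le_pow_right₀ hωk1 hm) (by positivity)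
  obtain ⟨he, he'⟩ := hi.past_var hω (n := n) (x := y) (y := X y) (u := y') (v := u')
    (S := 16 * ζ * U) hPX'.symm (by positivity) (fun m hm => by
      calc p m (Φ m y - Φ m (X y)) * p m (fderiv ℝ (Φ m) (X y) u')
          ≤ (ω ^ m / ω ^ n * (16 * ζ)) * (1 * U) := by
            refine mul_le_mul ((hd m hm.le).trans ?_) ((huk m hm.le).trans ?_) (apply_nonneg _ _)
              (by positivity)
            · exact mul_le_mul_of_nonneg_left hdn (by positivity)
            · exact mul_le_mul_of_nonneg_right (hpow m hm.le) hU0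
        _ = _ := by ring)
  have hsrc := source_le (c := 16) hδ hζ hU0 (by norm_num)
  have h3 := hi.two_parts (x := fderiv ℝ (Φ n) y y') (y := fderiv ℝ (Φ n) y y' -
    fderiv ℝ (Φ n) (X y) u') (z := fderiv ℝ (Φ n) (X y) u') (n := n)
    (s := 16 / 50000 * U) (by positivity) (by abel) (by linarith) (by linarith)
  have e1 := apply_nonneg (p n) (fderiv ℝ (Φ n) y y' - fderiv ℝ (Φ n) (X y) u')
  have hUV : U ≤ 40 * V := by linarith
  have heV : p n (fderiv ℝ (Φ n) y y' - fderiv ℝ (Φ n) (X y) u') + 2 / δ * (L * (16 * ζ * U)) ≤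
      41 * V := by linarith
  have htel := telescope_past (Q := Q) (ρ := ωk * ω) (n := n)
    (e := fun m => fderiv ℝ (Φ m) y y' - fderiv ℝ (Φ m) (X y) u') (c := 804 * (L * ζ * V)) hB hBω hQ
    (by positivity) (fun m hm => by
      refine ((hQi _ _).trans (hi.split.r_le _ _)).trans ((hi.sys.var_small m y (X y) y' u').trans ?_)
      have f1 := hy m hm.le
      have f2 := (he m hm.le).trans (mul_le_mul_of_nonneg_left heV (by positivity))
      have f3 := (hd m hm.le).trans (mul_le_mul_of_nonneg_left hdn (by positivity))
      have f4 := (huk m hm.le).trans (mul_le_mul_of_nonneg_left hUV (by positivity))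
      calc _ ≤ L * (ωk ^ m / ωk ^ n * (4 * ζ)) * (ω ^ m / ω ^ n * (41 * V)) +
            L * (ω ^ m / ω ^ n * (16 * ζ)) * (ωk ^ m / ωk ^ n * (40 * V)) := by gcongr
        _ = _ := by rw [mul_pow, mul_pow]; field_simp; ring)
  simp only [hi.sys.fderiv_start] at htel
  have htel' : 804 * (L * ζ * V) / (ωk * ω - B) ≤ 1 / 100 * V := by
    rw [div_le_iff₀ (by linarith)]
    have := mul_le_mul_of_nonneg_right hζ' hV0
    nlinarith
  have eq1 : y' - u' - fderiv ℝ (Φ n) w h =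
      -(fderiv ℝ (Φ n) y y' - fderiv ℝ (Φ n) (X y) u' - (y' - u')) +
      ((fderiv ℝ (Φ n) y y' - fderiv ℝ (Φ n) w h) - fderiv ℝ (Φ n) (X y) u') := by abel
  rw [eq1]
  have g1 := map_add_le_add (Q n) (-(fderiv ℝ (Φ n) y y' - fderiv ℝ (Φ n) (X y) u' - (y' - u')))
    ((fderiv ℝ (Φ n) y y' - fderiv ℝ (Φ n) w h) - fderiv ℝ (Φ n) (X y) u')
  rw [map_neg_eq_map] at g1
  have g2 := map_sub_le_add (Q n) (fderiv ℝ (Φ n) y y' - fderiv ℝ (Φ n) w h)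
    (fderiv ℝ (Φ n) (X y) u')
  have g3 := hQk n (fderiv ℝ (Φ n) y y' - fderiv ℝ (Φ n) w h)
  have g4 := hQi n (fderiv ℝ (Φ n) (X y) u')
  linarith

end Unstable

section Stable

variable {lk rk p : ℕ → Seminorm ℝ E} {βk αk η L δ ωk wb σ μk μk' : ℝ} {Φ : ℕ → E → E}
  {Pk : E →L[ℝ] E} {Z : E → E}

/-- Local bounds for the projection `Z` onto the stable set. -/
theorem slow_estimate (hk : SplitSys p Φ η L δ lk rk βk αk Pk) (hωk : Room βk αk δ ωk)
    (hwb : Room βk αk δ wb) (hωb : wb = ωk * σ) (hμ' : Room βk αk δ μk') (hμ : 0 ≤ μk)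
    (hμμ : μk < μk') (hσ : 0 < σ)
    (hbwd : ∀ n m x h, m ≤ n →
      p m (fderiv ℝ (Φ m) x h) ≤ σ ^ m / σ ^ n * p n (fderiv ℝ (Φ n) x h))
    (hZ : IsLeaf p Φ lk Pk μk μk (fun _ => 0) (ContinuousLinearMap.id ℝ E) Z) {n : ℕ} {w : E}
    {ζ : ℝ} (hw : p n (Φ n w) ≤ ζ) (hζ : L * ζ * 100000 ≤ δ) (h : E) :
    (∀ m, n ≤ m → p m (Φ m (Z w)) ≤ μk' ^ m / μk' ^ n * (4 * ζ)) ∧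
    (∀ m, n ≤ m → p m (fderiv ℝ (Φ m) (Z w) (fderiv ℝ Z w h)) ≤
      μk' ^ m / μk' ^ n * (5 * p n (fderiv ℝ (Φ n) w h))) ∧
    lk n (fderiv ℝ (Φ n) (Z w) (fderiv ℝ Z w h) - fderiv ℝ (Φ n) w h) ≤
      1 / 50 * p n (fderiv ℝ (Φ n) w h) := by
  have hζ0 : 0 ≤ ζ := (apply_nonneg _ _).trans hw
  have hδ := hk.δ_pos
  have hωk0 : 0 < ωk := by have := hωk.lo; have := hk.β_nonneg; linarith
  have hμ'0 : 0 < μk' := by linarith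
  set V := p n (fderiv ℝ (Φ n) w h) with hV
  have hV0 : 0 ≤ V := apply_nonneg _ _
  have hPZ : Pk (Z w) = Pk w := hZ.proj w
  have hPZ' : Pk (fderiv ℝ Z w h) = Pk h := hZ.proj_fderiv w h
  have hgZ : GrowsBelow p μk' fun m => Φ m (Z w) := by
    simpa [hk.sys.fixed] using hZ.grows hμ hμμ w
  have hgZ' : GrowsBelow p μk' fun m => fderiv ℝ (Φ m) (Z w) (fderiv ℝ Z w h) := by
    simpa using hZ.grows_fderiv hμ hμμ w h
  obtain ⟨ha, ha'⟩ := hk.past_diff hωk (n := n) hPZ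
  obtain ⟨hy, hy'⟩ := hk.future_orbit hμ' n hgZ
  have h2 := hk.two_parts_zero (x := Φ n w) (y := Φ n w - Φ n (Z w)) (z := Φ n (Z w)) (n := n)
    (by abel) (by rw [map_sub_rev, map_sub_rev (p n)]; exact ha') hy'
  rw [map_sub_rev (p n)] at h2
  have hya : p n (Φ n (Z w)) ≤ 4 * ζ := by
    have := apply_nonneg (p n) (Φ n (Z w) - Φ n w); linarith
  have haa : p n (Φ n (Z w) - Φ n w) ≤ 4 * ζ := by
    have := apply_nonneg (p n) (Φ n (Z w)); linarith
  obtain ⟨-, hz⟩ := hk.past_var hwb (n := n) (x := Z w) (y := w) hPZ' (S := 4 * ζ * V)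
    (by positivity) (fun m hm => by
    calc p m (Φ m (Z w) - Φ m w) * p m (fderiv ℝ (Φ m) w h)
        ≤ (ωk ^ m / ωk ^ n * (4 * ζ)) * (σ ^ m / σ ^ n * V) := by
          refine mul_le_mul ((ha m hm.le).trans ?_) (hbwd n m w h hm.le) (apply_nonneg _ _)
            (by positivity)
          exact mul_le_mul_of_nonneg_left haa (by positivity)
      _ = _ := by rw [hωb, mul_pow, mul_pow]; field_simp)
  have hsrc := source_le (c := 4) hδ hζ hV0 (by norm_num)
  obtain ⟨hyd, hyd'⟩ := hk.future_lin hμ' n hgZ'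
  have h3 := hk.two_parts (x := fderiv ℝ (Φ n) w h)
    (y := fderiv ℝ (Φ n) w h - fderiv ℝ (Φ n) (Z w) (fderiv ℝ Z w h))
    (z := fderiv ℝ (Φ n) (Z w) (fderiv ℝ Z w h)) (n := n)
    (s := 4 / 50000 * V) (by positivity) (by abel)
    (by rw [map_sub_rev, map_sub_rev (p n)]; linarith) (hyd'.trans (by linarith [hV0]))
  rw [map_sub_rev (p n)] at h3
  have e1 := apply_nonneg (p n) (fderiv ℝ (Φ n) (Z w) (fderiv ℝ Z w h))
  have e2 := apply_nonneg (p n) (fderiv ℝ (Φ n) (Z w) (fderiv ℝ Z w h) - fderiv ℝ (Φ n) w h)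
  refine ⟨fun m hm => (hy m hm).trans (by gcongr), fun m hm => (hyd m hm).trans ?_, by linarith⟩
  refine mul_le_mul_of_nonneg_left ?_ (by positivity)
  linarith

variable {l r Q : ℕ → Seminorm ℝ E} {β α a μ μ' : ℝ} {P Pr : E →L[ℝ] E} {π : E → E}

/-- Closeness of the linearization to the derivative cocycle on a stable band. -/
theorem stable_band_estimate (hk : SplitSys p Φ η L δ lk rk βk αk Pk) (hωk : Room βk αk δ ωk)
    (hwb : Room βk αk δ wb) (hωb : wb = ωk * σ) (hμ' : Room βk αk δ μk') (hμ : 0 ≤ μk)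
    (hμμ : μk < μk') (hσ : 0 < σ)
    (hbwd : ∀ n m x h, m ≤ n →
      p m (fderiv ℝ (Φ m) x h) ≤ σ ^ m / σ ^ n * p n (fderiv ℝ (Φ n) x h))
    (hZ : IsLeaf p Φ lk Pk μk μk (fun _ => 0) (ContinuousLinearMap.id ℝ E) Z)
    (hi : SplitSys p Φ η L δ l r β α P) (hω : Room β α δ μ') (hμi : 0 ≤ μ) (hμω : μ < μ')
    (hμk : μ ≤ μk) (hπ : IsLeaf p Φ l P μ μ Z 0 π)
    (hQk : ∀ n x, Q n x ≤ lk n x) (hQi : ∀ n x, Q n x ≤ l n x)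
    (hQ : ∀ m x, a * Q m x ≤ Q (m + 1) x) (hμ1 : μk' ≤ 1) (hBω : μ' * μk' < a)
    {n : ℕ} {w : E} {ζ : ℝ} (hw : p n (Φ n w) ≤ ζ) (hζ : L * ζ * 100000 ≤ δ)
    (hζ' : L * ζ * 100000 ≤ a - μ' * μk') (h : E) (M : ℕ) (hM : n ≤ M) :
    Q n (fderiv ℝ (Φ M) (Z w) (fderiv ℝ Z w h) - fderiv ℝ (Φ M) (π w) (fderiv ℝ π w h) -
      fderiv ℝ (Φ n) w h) ≤ 1 / 4 * p n (fderiv ℝ (Φ n) w h) := by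
  obtain ⟨hy, hyd, hzr⟩ := slow_estimate hk hωk hwb hωb hμ' hμ hμμ hσ hbwd hZ hw hζ h
  have hζ0 : 0 ≤ ζ := (apply_nonneg _ _).trans hw
  have hδ := hi.δ_pos
  have hμ'0 : 0 < μ' := by linarith
  have hμk'0 : 0 < μk' := by linarith
  have hL := hk.L_nonneg
  set V := p n (fderiv ℝ (Φ n) w h) with hV
  have hV0 : 0 ≤ V := apply_nonneg _ _
  set y := Z w
  set y' := fderiv ℝ Z w h with hy'
  set x := π w
  set u' := fderiv ℝ π w h
  have hyn : p n (Φ n y) ≤ 4 * ζ := by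
    have := hy n le_rfl; rwa [div_self (by positivity), one_mul] at this
  have hydn : p n (fderiv ℝ (Φ n) y y') ≤ 5 * V := by
    have := hyd n le_rfl; rwa [div_self (by positivity), one_mul] at this
  have hPx : P x = 0 := by simpa using hπ.proj w
  have hPx' : P u' = 0 := by simpa using hπ.proj_fderiv w h
  have hgd : GrowsBelow p μ' fun m => Φ m y - Φ m x :=
    (hπ.grows hμi hμω w).neg fun m => by simp only [neg_sub]; rfl
  have hge : GrowsBelow p μ' fun m => fderiv ℝ (Φ m) y y' - fderiv ℝ (Φ m) x u' :=
    (hπ.grows_fderiv hμi hμω w h).neg fun m => by simp only [neg_sub]; rfl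
  have hgu : GrowsBelow p μk' fun m => fderiv ℝ (Φ m) x u' := by
    refine (hπ.grows_fderiv hμi (hμk.trans_lt hμμ) w h).add
      (f := fun m => fderiv ℝ (Φ m) y y') ?_ fun m => by simp only [x, u', y, y']; abel
    simpa using hZ.grows_fderiv hμ hμμ w h
  obtain ⟨hd, hd'⟩ := hi.future_diff hω n hgd
  obtain ⟨-, hx'⟩ := hi.past_orbit hω (n := n) hPx
  have h2 := hi.two_parts_zero (x := Φ n y) (y := Φ n x) (z := Φ n y - Φ n x) (n := n) (by abel)
    hx' hd'
  have hdn : p n (Φ n y - Φ n x) ≤ 16 * ζ := by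
    have := apply_nonneg (p n) (Φ n x); linarith
  obtain ⟨-, hu⟩ := hi.past_lin hω (n := n) (x := x) hPx'
  obtain ⟨huk, -⟩ := hk.future_lin hμ' n hgu
  set U := p n (fderiv ℝ (Φ n) x u') with hU
  have hU0 : 0 ≤ U := apply_nonneg _ _
  have hpow : ∀ m, n ≤ m → μk' ^ m / μk' ^ n ≤ 1 := fun m hm =>
    div_le_one_of_le₀ (pow_le_pow_of_le_one hμk'0.le hμ1 hm) (by positivity)
  obtain ⟨he, he'⟩ := hi.future_var hω n hge (S := 16 * ζ * U) (by positivity) (fun m hm => by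
      calc p m (Φ m y - Φ m x) * p m (fderiv ℝ (Φ m) x u')
          ≤ (μ' ^ m / μ' ^ n * (16 * ζ)) * (1 * U) := by
            refine mul_le_mul ((hd m hm).trans ?_) ((huk m hm).trans ?_) (apply_nonneg _ _)
              (by positivity)
            · exact mul_le_mul_of_nonneg_left hdn (by positivity)
            · exact mul_le_mul_of_nonneg_right (hpow m hm) hU0
        _ = _ := by ring)
  have hsrc := source_le (c := 16) hδ hζ hU0 (by norm_num)
  have h3 := hi.two_parts (x := fderiv ℝ (Φ n) y y') (y := fderiv ℝ (Φ n) x u')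
    (z := fderiv ℝ (Φ n) y y' - fderiv ℝ (Φ n) x u') (n := n)
    (s := 16 / 50000 * U) (by positivity) (by abel) (by linarith) (by linarith)
  have e1 := apply_nonneg (p n) (fderiv ℝ (Φ n) y y' - fderiv ℝ (Φ n) x u')
  have hUV : U ≤ 40 * V := by linarith
  have heV : p n (fderiv ℝ (Φ n) y y' - fderiv ℝ (Φ n) x u') + 2 / δ * (L * (16 * ζ * U)) ≤
      41 * V := by linarith
  have htel := telescope_future (Q := Q) (ρ := μ' * μk') (n := n)
    (e := fun m => fderiv ℝ (Φ m) y y' - fderiv ℝ (Φ m) x u') (c := 804 * (L * ζ * V))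
    (by positivity) hBω hQ (by positivity) (fun m hm => by
      refine ((hQi _ _).trans (hi.split.l_le _ _)).trans ((hi.sys.var_small m y x y' u').trans ?_)
      have f1 := hy m hm
      have f2 := (he m hm).trans (mul_le_mul_of_nonneg_left heV (by positivity))
      have f3 := (hd m hm).trans (mul_le_mul_of_nonneg_left hdn (by positivity))
      have f4 := (huk m hm).trans (mul_le_mul_of_nonneg_left hUV (by positivity))
      calc _ ≤ L * (μk' ^ m / μk' ^ n * (4 * ζ)) * (μ' ^ m / μ' ^ n * (41 * V)) +
            L * (μ' ^ m / μ' ^ n * (16 * ζ)) * (μk' ^ m / μk' ^ n * (40 * V)) := by gcongr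
        _ = _ := by rw [mul_pow, mul_pow]; field_simp; ring) M hM
  have htel' : 804 * (L * ζ * V) / (a - μ' * μk') ≤ 1 / 100 * V := by
    rw [div_le_iff₀ (by linarith)]
    have := mul_le_mul_of_nonneg_right hζ' hV0
    nlinarith
  have eq1 : fderiv ℝ (Φ M) y y' - fderiv ℝ (Φ M) x u' - fderiv ℝ (Φ n) w h =
      (fderiv ℝ (Φ M) y y' - fderiv ℝ (Φ M) x u' -
        (fderiv ℝ (Φ n) y y' - fderiv ℝ (Φ n) x u')) +
      ((fderiv ℝ (Φ n) y y' - fderiv ℝ (Φ n) w h) - fderiv ℝ (Φ n) x u') := by abel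
  rw [eq1]
  have g1 := map_add_le_add (Q n) (fderiv ℝ (Φ M) y y' - fderiv ℝ (Φ M) x u' -
        (fderiv ℝ (Φ n) y y' - fderiv ℝ (Φ n) x u'))
    ((fderiv ℝ (Φ n) y y' - fderiv ℝ (Φ n) w h) - fderiv ℝ (Φ n) x u')
  have g2 := map_sub_le_add (Q n) (fderiv ℝ (Φ n) y y' - fderiv ℝ (Φ n) w h)
    (fderiv ℝ (Φ n) x u')
  have g3 := hQk n (fderiv ℝ (Φ n) y y' - fderiv ℝ (Φ n) w h)
  have g4 := hQi n (fderiv ℝ (Φ n) x u')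
  linarith

/-- The linearizing coordinate on a stable band, as a limit of renormalized orbit differences. -/
theorem exists_stable_band_map [FiniteDimensional ℝ E]
    (hk : SplitSys p Φ η L δ lk rk βk αk Pk) (hμk : 0 ≤ μk)
    (hZ : IsLeaf p Φ lk Pk μk μk (fun _ => 0) (ContinuousLinearMap.id ℝ E) Z)
    (hμ : 0 ≤ μ) (hμμk : μ ≤ μk) (hπ : IsLeaf p Φ l P μ μ Z 0 π)
    (hQp : ∀ n x, Q n x ≤ p n x) (hQ : ∀ m x, a * Q m x ≤ Q (m + 1) x) (hμa : μk * μ < a)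
    (hPr : ∀ x, p 0 (Pr x) ≤ Q 0 x) :
    ∃ S : E → E, ContDiff ℝ 1 S ∧
      (∀ w, Filter.Tendsto (fun M => Pr (Φ M (Z w) - Φ M (π w))) Filter.atTop (nhds (S w))) ∧
      ∀ w h, Filter.Tendsto (fun M => Pr (fderiv ℝ (Φ M) (Z w) (fderiv ℝ Z w h) -
        fderiv ℝ (Φ M) (π w) (fderiv ℝ π w h))) Filter.atTop (nhds (fderiv ℝ S w h)) := by
  have ha : 0 < a := (mul_nonneg hμk hμ).trans_lt hμa
  have hL := hk.L_nonneg
  let f : ℕ → E → E := fun M w => Pr (Φ M (Z w) - Φ M (π w))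
  have hfZ : ∀ M, ContDiff ℝ 1 fun w => Φ M (Z w) := fun M => (hk.sys.contDiff M).comp hZ.contDiff
  have hfπ : ∀ M, ContDiff ℝ 1 fun w => Φ M (π w) := fun M => (hk.sys.contDiff M).comp hπ.contDiff
  have hf : ∀ M, ContDiff ℝ 1 (f M) := fun M => Pr.contDiff.comp ((hfZ M).sub (hfπ M))
  have hf' : ∀ M w h, fderiv ℝ (f M) w h = Pr (fderiv ℝ (Φ M) (Z w) (fderiv ℝ Z w h) -
        fderiv ℝ (Φ M) (π w) (fderiv ℝ π w h)) := fun M w h => by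
    rw [fderiv_clm_comp_apply Pr ((hfZ M).sub (hfπ M)),
      fderiv_fun_sub ((hfZ M).differentiable one_ne_zero w) ((hfπ M).differentiable one_ne_zero w),
      sub_apply, fderiv_comp_apply' (hk.sys.contDiff M) hZ.contDiff,
      fderiv_comp_apply' (hk.sys.contDiff M) hπ.contDiff]
  have hZ0 : Z 0 = 0 := by
    have := hZ.close 0 0
    simp only [hk.sys.start, sub_zero, map_zero, mul_zero] at this
    exact hk.definite 0 _ (le_antisymm this (apply_nonneg _ _))
  have hπ0 : π 0 = 0 := by
    have := hπ.close 0 0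
    simp only [hk.sys.start, hZ0, sub_zero, map_zero, mul_zero] at this
    exact hk.definite 0 _ (le_antisymm this (apply_nonneg _ _))
  have hf0 : ∀ M, f M 0 = 0 := fun M => by simp [f, hZ0, hπ0]
  have hQ0 : ∀ M x, a ^ M * Q 0 x ≤ Q M x := by
    intro M x
    induction M with
    | zero => simp
    | succ M ih =>
      calc a ^ (M + 1) * Q 0 x = a * (a ^ M * Q 0 x) := by ring
        _ ≤ a * Q M x := by gcongr
        _ ≤ _ := hQ _ _
  obtain ⟨C₀, hC₀, hC₀'⟩ := seminorm_lower_bound (p 0) (hk.definite 0)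
  set κ := μk * μ / a with hκ
  have hκ0 : 0 ≤ κ := by positivity
  have hκ1 : κ < 1 := (div_lt_one ha).2 hμa
  obtain ⟨S, hS, hS', hS''⟩ := exists_contDiff_limit hf (fun ρ => by
    obtain ⟨B, hB⟩ := (isCompact_closedBall (0 : E) ρ).bddAbove_image
      (f := fun w => max (p 0 (Z w)) (max (lk 0 w) (l 0 (0 - Z w))))
      (((seminorm_continuous (p 0)).comp hZ.contDiff.continuous).max
        ((seminorm_continuous (lk 0)).max ((seminorm_continuous (l 0)).comp
          (continuous_const.sub hZ.contDiff.continuous)))).continuousOn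
    obtain ⟨CZ, hCZ, hCZ'⟩ := hZ.deriv ρ
    obtain ⟨Cπ, hCπ, hCπ'⟩ := hπ.deriv ρ
    have hD : ∀ w, ‖w‖ ≤ ρ → ∀ n, ‖fderiv ℝ (f (n + 1)) w - fderiv ℝ (f n) w‖ ≤
        C₀ * (L * (|B| * Cπ + |B| * (Cπ + CZ)) / a) * κ ^ n := by
      intro w hw n
      have hB' : max (p 0 (Z w)) (max (lk 0 w) (l 0 (0 - Z w))) ≤ |B| :=
        (hB ⟨w, by simpa using hw, rfl⟩).trans (le_abs_self _)
      refine ContinuousLinearMap.opNorm_le_bound _ (by positivity) fun h => ?_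
      rw [sub_apply, hf', hf', ← map_sub]
      refine (hC₀' _).trans ?_
      set D1 := fderiv ℝ (Φ (n + 1)) (Z w) (fderiv ℝ Z w h) -
        fderiv ℝ (Φ (n + 1)) (π w) (fderiv ℝ π w h)
      set D0 := fderiv ℝ (Φ n) (Z w) (fderiv ℝ Z w h) - fderiv ℝ (Φ n) (π w) (fderiv ℝ π w h)
      have h1 : a ^ (n + 1) * Q 0 (D1 - D0) ≤
          L * (|B| * Cπ + |B| * (Cπ + CZ)) * (μk * μ) ^ n * ‖h‖ := by
        refine (hQ0 _ _).trans ((hQp _ _).trans ((hk.sys.var_small n _ _ _ _).trans ?_))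
        have f1 : p n (Φ n (Z w)) ≤ μk ^ n * |B| := by
          have := hZ.close w n
          simp only [hk.sys.fixed, sub_zero, ContinuousLinearMap.id_apply] at this
          refine this.trans ?_
          have := ((le_max_left _ _).trans (le_max_right _ _)).trans hB'
          gcongr
        have f2 : p n (Φ n (Z w) - Φ n (π w)) ≤ μ ^ n * |B| := by
          rw [map_sub_rev]
          refine (hπ.close w n).trans ?_
          have := ((le_max_right _ _).trans (le_max_right _ _)).trans hB'
          simp only [zero_apply]
          gcongr
        have f3 : p n D0 ≤ Cπ * μ ^ n * ‖h‖ := by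
          have := hCπ' w hw n h
          rwa [map_sub_rev] at this
        have f4 : p n (fderiv ℝ (Φ n) (π w) (fderiv ℝ π w h)) ≤ (Cπ + CZ) * μk ^ n * ‖h‖ := by
          have e1 := hCZ' w hw n h
          simp only [fderiv_fun_const, Pi.zero_apply, zero_apply, map_zero, sub_zero] at e1
          have e2 : fderiv ℝ (Φ n) (π w) (fderiv ℝ π w h) =
            fderiv ℝ (Φ n) (Z w) (fderiv ℝ Z w h) - D0 := by simp only [D0]; abel
          rw [e2]
          have e3 : Cπ * μ ^ n * ‖h‖ ≤ Cπ * μk ^ n * ‖h‖ := by gcongr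
          have := map_sub_le_add (p n) (fderiv ℝ (Φ n) (Z w) (fderiv ℝ Z w h)) D0
          linarith
        calc _ ≤ L * (μk ^ n * |B|) * (Cπ * μ ^ n * ‖h‖) +
              L * (μ ^ n * |B|) * ((Cπ + CZ) * μk ^ n * ‖h‖) := by gcongr
          _ = _ := by rw [mul_pow]; ring
      have h2 : Q 0 (D1 - D0) ≤ L * (|B| * Cπ + |B| * (Cπ + CZ)) / a * κ ^ n * ‖h‖ := by
        rw [hκ, div_pow]
        have : 0 < a ^ (n + 1) := by positivity
        rw [← mul_le_mul_iff_right₀ this]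
        refine h1.trans_eq ?_
        rw [pow_succ]; field_simp
      calc C₀ * p 0 (Pr (D1 - D0)) ≤ C₀ * (L * (|B| * Cπ + |B| * (Cπ + CZ)) / a * κ ^ n * ‖h‖) := by
            gcongr; exact (hPr _).trans h2
        _ = _ := by ring
    set C := C₀ * (L * (|B| * Cπ + |B| * (Cπ + CZ)) / a)
    have hC : 0 ≤ C := by positivity
    refine ⟨max (C * |ρ|) C, κ, hκ0, hκ1, fun w hw n => ⟨?_, (hD w hw n).trans (by gcongr; exact le_max_right _ _)⟩⟩
    have hdiff : ∀ x, DifferentiableAt ℝ (fun w => f (n + 1) w - f n w) x := fun x =>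
      ((hf (n + 1)).differentiable one_ne_zero x).sub ((hf n).differentiable one_ne_zero x)
    have := (convex_closedBall (0 : E) ρ).norm_image_sub_le_of_norm_fderiv_le (𝕜 := ℝ)
      (f := fun w => f (n + 1) w - f n w) (C := C * κ ^ n) (x := 0) (y := w)
      (fun x _ => hdiff x) (fun x hx => by
        rw [fderiv_fun_sub ((hf (n + 1)).differentiable one_ne_zero x)
          ((hf n).differentiable one_ne_zero x)]
        exact hD x (by simpa using hx) n)
      (by simpa using (norm_nonneg w).trans hw) (by simpa using hw)
    simp only [hf0, sub_zero] at this
    refine this.trans ?_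
    calc C * κ ^ n * ‖w‖ ≤ C * κ ^ n * |ρ| := by gcongr; exact hw.trans (le_abs_self _)
      _ = C * |ρ| * κ ^ n := by ring
      _ ≤ _ := by gcongr; exact le_max_left _ _)
  refine ⟨S, hS, hS', fun w h => ?_⟩
  have := ((ContinuousLinearMap.apply ℝ E h).continuous.tendsto _).comp (hS'' w)
  refine this.congr fun M => ?_
  exact hf' M w h

end Stable

/-- An ordered decomposition of a linear system into bands with growth rates in `[α i, β i]`;
`P i` projects onto the first `i` bands. -/
structure Bands (r : ℕ) (P : ℕ → E →L[ℝ] E) (q : ℕ → ℕ → Seminorm ℝ E) (α β : ℕ → ℝ) : Prop where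
  P_zero : ∀ x, P 0 x = 0
  P_top : ∀ x, P r x = x
  P_comp : ∀ i j x, i ≤ r → j ≤ r → P i (P j x) = P (min i j) x
  q_proj : ∀ i n x, i < r → q i n (P (i + 1) x - P i x) = q i n x
  low : ∀ i n x, i < r → α i * q i n x ≤ q i (n + 1) x
  up : ∀ i n x, i < r → q i (n + 1) x ≤ β i * q i n x
  definite : ∀ n x, (∀ i, i < r → q i n x = 0) → x = 0

/-- The supremum of the seminorms of the bands in `s`. -/
def bandSup (q : ℕ → ℕ → Seminorm ℝ E) (s : Finset ℕ) (n : ℕ) : Seminorm ℝ E :=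
  s.sup fun i => q i n

theorem le_bandSup (q : ℕ → ℕ → Seminorm ℝ E) {s : Finset ℕ} {i : ℕ} (hi : i ∈ s) (n : ℕ) (x : E) :
    q i n x ≤ bandSup q s n x :=
  Finset.le_sup (f := fun i => q i n) hi x

theorem bandSup_le {q : ℕ → ℕ → Seminorm ℝ E} {s : Finset ℕ} {n : ℕ} {x : E} {C : ℝ} (hC : 0 ≤ C)
    (h : ∀ i ∈ s, q i n x ≤ C) : bandSup q s n x ≤ C :=
  Seminorm.finset_sup_apply_le hC h

theorem bandSup_mono (q : ℕ → ℕ → Seminorm ℝ E) {s t : Finset ℕ} (hst : s ⊆ t) (n : ℕ) (x : E) :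
    bandSup q s n x ≤ bandSup q t n x :=
  bandSup_le (apply_nonneg _ _) fun _ hi => le_bandSup q (hst hi) n x

theorem bandSup_low {q : ℕ → ℕ → Seminorm ℝ E} {s : Finset ℕ} {n : ℕ} {x : E} {a : ℝ} (ha : 0 ≤ a)
    (h : ∀ i ∈ s, a * q i n x ≤ q i (n + 1) x) : a * bandSup q s n x ≤ bandSup q s (n + 1) x := by
  rcases ha.eq_or_lt with rfl | ha
  · simp
  · rw [← le_div_iff₀' ha]
    refine bandSup_le (by positivity) fun i hi => ?_
    rw [le_div_iff₀' ha]
    exact (h i hi).trans (le_bandSup q hi _ _)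

theorem bandSup_up {q : ℕ → ℕ → Seminorm ℝ E} {s : Finset ℕ} {n : ℕ} {x : E} {b : ℝ} (hb : 0 ≤ b)
    (h : ∀ i ∈ s, q i (n + 1) x ≤ b * q i n x) : bandSup q s (n + 1) x ≤ b * bandSup q s n x :=
  bandSup_le (by positivity) fun i hi => (h i hi).trans
    (mul_le_mul_of_nonneg_left (le_bandSup q hi _ _) hb)

namespace Bands

variable {r : ℕ} {P : ℕ → E →L[ℝ] E} {q : ℕ → ℕ → Seminorm ℝ E} {α β : ℕ → ℝ}

theorem q_P_of_lt (h : Bands r P q α β) {i j : ℕ} (hij : i < j) (hj : j ≤ r) (n : ℕ) (x : E) :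
    q i n (P j x) = q i n x := by
  rw [← h.q_proj i n (P j x) (by omega), h.P_comp _ _ _ (by omega) hj,
    h.P_comp _ _ _ (by omega) hj, min_eq_left (by omega), min_eq_left (by omega),
    h.q_proj i n x (by omega)]

theorem q_P_of_le (h : Bands r P q α β) {i j : ℕ} (hij : j ≤ i) (hi : i < r) (n : ℕ) (x : E) :
    q i n (P j x) = 0 := by
  rw [← h.q_proj i n (P j x) hi, h.P_comp _ _ _ (by omega) (by omega),
    h.P_comp _ _ _ (by omega) (by omega), min_eq_right (by omega), min_eq_right (by omega),
    sub_self, map_zero]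

theorem P_P (h : Bands r P q α β) {i j : ℕ} (hij : i ≤ j) (hj : j ≤ r) (x : E) :
    P i (P j x) = P i x := by
  rw [h.P_comp _ _ _ (by omega) hj, min_eq_left hij]

theorem P_P' (h : Bands r P q α β) {i j : ℕ} (hij : j ≤ i) (hi : i ≤ r) (x : E) :
    P i (P j x) = P j x := by
  rw [h.P_comp _ _ _ hi (by omega), min_eq_right hij]

theorem splitProj (h : Bands r P q α β) {j : ℕ} (hj : j ≤ r) :
    SplitProj (bandSup q (Finset.range j)) (bandSup q (Finset.Ico j r)) (P j) where
  idem x := h.P_P le_rfl hj x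
  l_proj n x := by
    apply le_antisymm <;> refine bandSup_le (apply_nonneg _ _) fun i hi => ?_
    · rw [h.q_P_of_lt (Finset.mem_range.1 hi) hj]; exact le_bandSup q hi n x
    · rw [← h.q_P_of_lt (Finset.mem_range.1 hi) hj]; exact le_bandSup q hi n _
  r_proj n x := by
    refine le_antisymm (bandSup_le le_rfl fun i hi => ?_) (apply_nonneg _ _)
    rw [Finset.mem_Ico] at hi
    rw [h.q_P_of_le hi.1 hi.2]

theorem split (h : Bands r P q α β) {j : ℕ} (hj : j ≤ r) {a b : ℝ} (ha : 0 ≤ a) (hb : 0 ≤ b)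
    (hα : ∀ i, j ≤ i → i < r → a ≤ α i) (hβ : ∀ i, i < j → β i ≤ b) :
    Split (bandSup q (Finset.range j)) (bandSup q (Finset.Ico j r)) (bandSup q (Finset.range r))
      b a where
  eq_max n x := by
    apply le_antisymm
    · refine bandSup_le (le_max_of_le_left (apply_nonneg _ _)) fun i hi => ?_
      rw [Finset.mem_range] at hi
      rcases lt_or_ge i j with hij | hij
      · exact (le_bandSup q (Finset.mem_range.2 hij) n x).trans (le_max_left _ _)
      · exact (le_bandSup q (Finset.mem_Ico.2 ⟨hij, hi⟩) n x).trans (le_max_right _ _)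
    · refine max_le (bandSup_mono q ?_ n x) (bandSup_mono q ?_ n x)
      · intro i hi; rw [Finset.mem_range] at *; omega
      · intro i hi; rw [Finset.mem_range]; rw [Finset.mem_Ico] at hi; omega
  contr n x := bandSup_up hb fun i hi => by
    rw [Finset.mem_range] at hi
    exact (h.up i n x (by omega)).trans (mul_le_mul_of_nonneg_right (hβ i hi) (apply_nonneg _ _))
  expand n x := bandSup_low ha fun i hi => by
    rw [Finset.mem_Ico] at hi
    exact (mul_le_mul_of_nonneg_right (hα i hi.1 hi.2) (apply_nonneg _ _)).trans (h.low i n x hi.2)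

theorem sup_definite (h : Bands r P q α β) (n : ℕ) (x : E)
    (hx : bandSup q (Finset.range r) n x = 0) : x = 0 :=
  h.definite n x fun _ hi => le_antisymm
    ((le_bandSup q (Finset.mem_range.2 hi) n x).trans_eq hx) (apply_nonneg _ _)

/-- Reconstruction of a vector from its band components. -/
theorem sum_bands (h : Bands r P q α β) (x : E) :
    ∑ i ∈ Finset.range r, (P (i + 1) x - P i x) = x := by
  rw [Finset.sum_range_sub (fun i => P i x), h.P_top, h.P_zero, sub_zero]

theorem band_comp (h : Bands r P q α β) {i j : ℕ} (hi : i < r) (hj : j < r) (x : E) :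
    P (i + 1) (P (j + 1) x - P j x) - P i (P (j + 1) x - P j x) =
      if i = j then P (i + 1) x - P i x else 0 := by
  simp only [map_sub]
  rw [h.P_comp _ _ _ (by omega) (by omega), h.P_comp _ _ _ (by omega) (by omega),
    h.P_comp _ _ _ (by omega) (by omega), h.P_comp _ _ _ (by omega) (by omega)]
  split_ifs with hij
  · subst hij; simp
  · rcases lt_or_gt_of_ne hij with h1 | h1
    · rw [min_eq_left (by omega), min_eq_left (by omega), min_eq_left (by omega),
        min_eq_left (by omega)]; abel
    · rw [min_eq_right (by omega), min_eq_right (by omega), min_eq_right (by omega),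
        min_eq_right (by omega)]; abel

theorem band_sum (h : Bands r P q α β) {i : ℕ} (hi : i < r) (x : ℕ → E) :
    P (i + 1) (∑ j ∈ Finset.range r, (P (j + 1) (x j) - P j (x j))) -
      P i (∑ j ∈ Finset.range r, (P (j + 1) (x j) - P j (x j))) = P (i + 1) (x i) - P i (x i) := by
  rw [map_sum, map_sum, ← Finset.sum_sub_distrib]
  rw [Finset.sum_congr rfl fun j hj => h.band_comp hi (Finset.mem_range.1 hj) (x j)]
  simp [hi]

theorem P_sum (h : Bands r P q α β) {k : ℕ} (hk : k ≤ r) (x : ℕ → E) :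
    P k (∑ j ∈ Finset.range r, (P (j + 1) (x j) - P j (x j))) =
      ∑ j ∈ Finset.range k, (P (j + 1) (x j) - P j (x j)) := by
  rw [map_sum, ← Finset.sum_range_add_sum_Ico _ hk]
  rw [Finset.sum_eq_zero (s := Finset.Ico k r), add_zero]
  · refine Finset.sum_congr rfl fun j hj => ?_
    rw [Finset.mem_range] at hj
    rw [map_sub, h.P_P' (by omega) hk, h.P_P' (by omega) hk]
  · intro j hj
    rw [Finset.mem_Ico] at hj
    rw [map_sub, h.P_P (by omega) (by omega), h.P_P (by omega) (by omega), sub_self]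

theorem q_sub_proj (h : Bands r P q α β) {i : ℕ} (hi : i < r) (n : ℕ) (x y z : E)
    (hz : P (i + 1) z - P i z = P (i + 1) x - P i x) : q i n (z - y) = q i n (x - y) := by
  rw [← h.q_proj i n (z - y) hi, ← h.q_proj i n (x - y) hi]
  congr 1
  have e (a b : E) : P (i + 1) (a - b) - P i (a - b) =
    (P (i + 1) a - P i a) - (P (i + 1) b - P i b) := by simp only [map_sub]; abel
  rw [e, e, hz]

end Bands

/-- Admissible exponential weights for the bands `[α i, β i]`, split at `k`. -/
structure Weights (r k : ℕ) (α β μ μ' ω : ℕ → ℝ) (γ σ δ : ℝ) : Prop where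
  k_pos : 1 ≤ k
  k_lt : k < r
  δ_pos : 0 < δ
  β_nonneg : ∀ i, i < r → 0 ≤ β i
  lo : ∀ i j, i < j → j < r → β i + δ ≤ μ j
  hi : ∀ i j, 1 ≤ j → j ≤ i → i < r → ω j + δ ≤ α i
  μ_lt : ∀ j, 1 ≤ j → j < r → μ j < μ' j
  μ'_lt : ∀ j, 1 ≤ j → j < r → μ' j < ω j
  μ_le : ∀ j, 1 ≤ j → j ≤ k → μ j ≤ μ k
  μ'_le_one : μ' k ≤ 1
  one_le_ω : 1 ≤ ω k
  one_le_γ : 1 ≤ γ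
  β_le_γ : ∀ i, i < r → β i + δ ≤ γ
  μ_lt_γ : μ k < ω k / γ
  σ_pos : 0 < σ
  σ_le_one : σ ≤ 1
  σ_le_α : ∀ i, i < r → σ + δ ≤ α i
  μ_le_σ : μ k ≤ ω k * σ
  unstable : ∀ i, k ≤ i → i < r → β i < ω k * ω i
  stable : ∀ i, i < k → μ' (i + 1) * μ' k < α i

/-- An orbit system with a band decomposition and admissible weights. -/
structure BandSys (r k : ℕ) (P : ℕ → E →L[ℝ] E) (q : ℕ → ℕ → Seminorm ℝ E)
    (α β μ μ' ω : ℕ → ℝ) (γ σ δ η L : ℝ) (Φ : ℕ → E → E) : Prop where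
  bands : Bands r P q α β
  weights : Weights r k α β μ μ' ω γ σ δ
  sys : OrbitSys (bandSup q (Finset.range r)) η L Φ
  η_nonneg : 0 ≤ η
  small : η ≤ δ / 1000
  L_nonneg : 0 ≤ L

namespace BandSys

variable {r k : ℕ} {P : ℕ → E →L[ℝ] E} {q : ℕ → ℕ → Seminorm ℝ E}
  {α β μ μ' ω : ℕ → ℝ} {γ σ δ η L : ℝ} {Φ : ℕ → E → E}

theorem δ_le_μ (h : BandSys r k P q α β μ μ' ω γ σ δ η L Φ) {j : ℕ} (hj : 1 ≤ j) (hjr : j < r) :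
    δ ≤ μ j := by
  have := h.weights.lo 0 j hj hjr
  have := h.weights.β_nonneg 0 (by omega)
  linarith

theorem μ_pos (h : BandSys r k P q α β μ μ' ω γ σ δ η L Φ) {j : ℕ} (hj : 1 ≤ j) (hjr : j < r) :
    0 < μ j := h.weights.δ_pos.trans_le (h.δ_le_μ hj hjr)

theorem splitSys (h : BandSys r k P q α β μ μ' ω γ σ δ η L Φ) {j : ℕ} (hj : 1 ≤ j) (hjr : j < r) :
    SplitSys (bandSup q (Finset.range r)) Φ η L δ (bandSup q (Finset.range j))
      (bandSup q (Finset.Ico j r)) (μ j - δ) (ω j + δ) (P j) where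
  split := h.bands.split hjr.le
    (by
      have := h.μ_pos hj hjr; have := h.weights.μ_lt j hj hjr; have := h.weights.μ'_lt j hj hjr
      have := h.weights.δ_pos; linarith)
    (by have := h.δ_le_μ hj hjr; linarith)
    (fun i hi hir => h.weights.hi i j hj hi hir)
    (fun i hi => by have := h.weights.lo i j hi hjr; linarith)
  proj := h.bands.splitProj hjr.le
  sys := h.sys
  definite := h.bands.sup_definite
  δ_pos := h.weights.δ_pos
  β_nonneg := by have := h.δ_le_μ hj hjr; linarith
  η_nonneg := h.η_nonneg
  small := h.small
  L_nonneg := h.L_nonneg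

theorem room (w : ℝ) {j : ℕ} (h1 : μ j ≤ w) (h2 : w ≤ ω j) : Room (μ j - δ) (ω j + δ) δ w :=
  ⟨by linarith, by linarith⟩

theorem room_μ' (h : BandSys r k P q α β μ μ' ω γ σ δ η L Φ) {j : ℕ} (hj : 1 ≤ j) (hjr : j < r) :
    Room (μ j - δ) (ω j + δ) δ (μ' j) :=
  room _ (h.weights.μ_lt j hj hjr).le (h.weights.μ'_lt j hj hjr).le

theorem room_ω (h : BandSys r k P q α β μ μ' ω γ σ δ η L Φ) {j : ℕ} (hj : 1 ≤ j) (hjr : j < r) :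
    Room (μ j - δ) (ω j + δ) δ (ω j) :=
  room _ ((h.weights.μ_lt j hj hjr).trans (h.weights.μ'_lt j hj hjr)).le le_rfl

theorem μ_lt_ω (h : BandSys r k P q α β μ μ' ω γ σ δ η L Φ) {j : ℕ} (hj : 1 ≤ j) (hjr : j < r) :
    μ j < ω j := (h.weights.μ_lt j hj hjr).trans (h.weights.μ'_lt j hj hjr)

theorem μ_le_one (h : BandSys r k P q α β μ μ' ω γ σ δ η L Φ) {j : ℕ} (hj : 1 ≤ j) (hjk : j ≤ k) :
    μ j ≤ 1 :=
  (h.weights.μ_le j hj hjk).trans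
    ((h.weights.μ_lt k h.weights.k_pos h.weights.k_lt).le.trans h.weights.μ'_le_one)

theorem fwd_step (h : BandSys r k P q α β μ μ' ω γ σ δ η L Φ) (m : ℕ) (x v : E) :
    bandSup q (Finset.range r) (m + 1) (fderiv ℝ (Φ (m + 1)) x v) ≤
      γ * bandSup q (Finset.range r) m (fderiv ℝ (Φ m) x v) := by
  have hw := h.weights
  have h1 := h.sys.var_lin m x v
  have h2 : bandSup q (Finset.range r) (m + 1) (fderiv ℝ (Φ m) x v) ≤
      (γ - δ) * bandSup q (Finset.range r) m (fderiv ℝ (Φ m) x v) := by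
    refine bandSup_up ?_ fun i hi => ?_
    · have := hw.β_le_γ 0 (by have := hw.k_lt; omega)
      have := hw.β_nonneg 0 (by have := hw.k_lt; omega)
      linarith
    · rw [Finset.mem_range] at hi
      refine (h.bands.up i m _ hi).trans (mul_le_mul_of_nonneg_right ?_ (apply_nonneg _ _))
      have := hw.β_le_γ i hi; linarith
  have h3 := map_add_le_add (bandSup q (Finset.range r) (m + 1))
    (fderiv ℝ (Φ (m + 1)) x v - fderiv ℝ (Φ m) x v) (fderiv ℝ (Φ m) x v)
  rw [sub_add_cancel] at h3
  have h4 : η ≤ δ := by have := h.small; have := hw.δ_pos; linarith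
  have h5 := mul_le_mul_of_nonneg_right h4
    (apply_nonneg (bandSup q (Finset.range r) m) (fderiv ℝ (Φ m) x v))
  linarith

theorem bwd_step (h : BandSys r k P q α β μ μ' ω γ σ δ η L Φ) (m : ℕ) (x v : E) :
    σ * bandSup q (Finset.range r) m (fderiv ℝ (Φ m) x v) ≤
      bandSup q (Finset.range r) (m + 1) (fderiv ℝ (Φ (m + 1)) x v) := by
  have hw := h.weights
  have h1 := h.sys.var_lin m x v
  have h2 : (σ + δ) * bandSup q (Finset.range r) m (fderiv ℝ (Φ m) x v) ≤
      bandSup q (Finset.range r) (m + 1) (fderiv ℝ (Φ m) x v) := by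
    refine bandSup_low (by have := hw.σ_pos; have := hw.δ_pos; linarith) fun i hi => ?_
    rw [Finset.mem_range] at hi
    exact (mul_le_mul_of_nonneg_right (hw.σ_le_α i hi) (apply_nonneg _ _)).trans
      (h.bands.low i m _ hi)
  have h3 := map_add_le_add (bandSup q (Finset.range r) (m + 1))
    (fderiv ℝ (Φ m) x v - fderiv ℝ (Φ (m + 1)) x v) (fderiv ℝ (Φ (m + 1)) x v)
  rw [sub_add_cancel, map_sub_rev] at h3
  have h4 : η ≤ δ := by have := h.small; have := hw.δ_pos; linarith
  have h5 := mul_le_mul_of_nonneg_right h4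
    (apply_nonneg (bandSup q (Finset.range r) m) (fderiv ℝ (Φ m) x v))
  linarith

theorem fwd (h : BandSys r k P q α β μ μ' ω γ σ δ η L Φ) (n m : ℕ) (x v : E) (hnm : n ≤ m) :
    bandSup q (Finset.range r) m (fderiv ℝ (Φ m) x v) ≤
      γ ^ m / γ ^ n * bandSup q (Finset.range r) n (fderiv ℝ (Φ n) x v) := by
  have hγ : 0 < γ := zero_lt_one.trans_le h.weights.one_le_γ
  induction m, hnm using Nat.le_induction with
  | base => rw [div_self (by positivity), one_mul]
  | succ m _ ih =>
    refine (h.fwd_step m x v).trans ((mul_le_mul_of_nonneg_left ih hγ.le).trans_eq ?_)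
    rw [pow_succ]; ring

theorem bwd (h : BandSys r k P q α β μ μ' ω γ σ δ η L Φ) (n m : ℕ) (x v : E) (hmn : m ≤ n) :
    bandSup q (Finset.range r) m (fderiv ℝ (Φ m) x v) ≤
      σ ^ m / σ ^ n * bandSup q (Finset.range r) n (fderiv ℝ (Φ n) x v) := by
  have hσ := h.weights.σ_pos
  induction n, hmn using Nat.le_induction with
  | base => rw [div_self (by positivity), one_mul]
  | succ n _ ih =>
    refine ih.trans ?_
    have := h.bwd_step n x v
    rw [pow_succ, ← div_div, div_mul_eq_mul_div _ σ, mul_div_assoc]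
    refine mul_le_mul_of_nonneg_left ?_ (by positivity)
    rw [le_div_iff₀' hσ]; exact this

theorem exists_exponent {a b c : ℝ} (ha : 0 < a) (hbc : b < c) :
    ∃ θ : ℝ, 0 < θ ∧ θ ≤ 1 ∧ a ^ θ * b ≤ c := by
  have h1 : Filter.Tendsto (fun θ : ℝ => a ^ θ * b) (nhdsWithin 0 (Set.Ioi 0)) (nhds b) := by
    have : Filter.Tendsto (fun θ : ℝ => a ^ θ * b) (nhds 0) (nhds (a ^ (0 : ℝ) * b)) :=
      ((Real.continuousAt_const_rpow ha.ne').tendsto).mul_const b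
    rw [Real.rpow_zero, one_mul] at this
    exact this.mono_left nhdsWithin_le_nhds
  obtain ⟨θ, h2, h3⟩ := ((h1.eventually_le_const hbc).and
    (Ioc_mem_nhdsGT (zero_lt_one' ℝ))).exists
  exact ⟨θ, h3.1, h3.2, h2⟩

variable [FiniteDimensional ℝ E]

theorem exists_const_leaf (h : BandSys r k P q α β μ μ' ω γ σ δ η L Φ) {j : ℕ} (hj : 1 ≤ j)
    (hjr : j < r) (y : E) :
    ∃ X, IsLeaf (bandSup q (Finset.range r)) Φ (bandSup q (Finset.range j)) (P j) (μ j) (μ j)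
      (fun _ => y) (ContinuousLinearMap.id ℝ E) X := by
  have hs := h.splitSys hj hjr
  have hμ := h.μ_pos hj hjr
  obtain ⟨θ, hθ, hθ1, hθω⟩ := exists_exponent (a := μ' j) (hμ.trans (h.weights.μ_lt j hj hjr))
    (h.μ_lt_ω hj hjr)
  obtain ⟨X, h1, h2, h3, h4⟩ := exists_leaf (γ := 0) hs.split hs.proj hs.sys hs.definite hs.δ_pos
    hs.β_nonneg hs.η_nonneg hs.small' hs.L_nonneg (μ := μ j) (by linarith) (h.weights.μ_lt j hj hjr)
    (h.room_μ' hj hjr).hi (ν := μ j) (by linarith) (h.μ_lt_ω hj hjr) (h.room_ω hj hjr).hi le_rfl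
    (by rw [mul_zero]; exact hμ.le) hθ hθ1 (by rwa [max_eq_left hμ.le]) (Y := fun _ => y)
    contDiff_const (ContinuousLinearMap.id ℝ E)
    (fun ρ => ⟨0, le_rfl, fun x _ m k => by simp⟩)
  exact ⟨X, h1, h2, h3, h4⟩

theorem exists_fast_leaf (h : BandSys r k P q α β μ μ' ω γ σ δ η L Φ) :
    ∃ F, IsLeaf (bandSup q (Finset.range r)) Φ (bandSup q (Finset.range k)) (P k) (μ k) (μ k * γ)
      id 0 F := by
  have hw := h.weights
  have hs := h.splitSys hw.k_pos hw.k_lt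
  have hμ := h.μ_pos hw.k_pos hw.k_lt
  have hγ : 0 < γ := zero_lt_one.trans_le hw.one_le_γ
  have hν : μ k * γ < ω k := (lt_div_iff₀ hγ).1 hw.μ_lt_γ
  have hωγ : ω k / γ ≤ ω k := div_le_self (by linarith [hw.one_le_ω]) hw.one_le_γ
  have hνμ : μ k ≤ μ k * γ := le_mul_of_one_le_right hμ.le hw.one_le_γ
  obtain ⟨C, hC, hCb⟩ := seminorm_bound (bandSup q (Finset.range r) 0)
  obtain ⟨X, h1, h2, h3, h4⟩ := exists_leaf (γ := γ) hs.split hs.proj hs.sys hs.definite hs.δ_pos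
    hs.β_nonneg hs.η_nonneg hs.small' hs.L_nonneg (μ := μ k) (ω := ω k / γ) (ω₂ := ω k)
    (by linarith) hw.μ_lt_γ (by linarith) (ν := μ k * γ) (by linarith) hν le_rfl hγ.le le_rfl
    zero_lt_one le_rfl (by
      rw [Real.rpow_one, max_eq_right
        (mul_le_of_le_one_left hγ.le (h.μ_le_one hw.k_pos le_rfl)), div_mul_cancel₀ _ hγ.ne'])
    (Y := id) contDiff_id (0 : E →L[ℝ] E)
    (fun ρ => ⟨C, hC.le, fun x _ m k => by
      have := h.fwd 0 m x k (Nat.zero_le _)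
      simp only [pow_zero, div_one, h.sys.fderiv_start] at this
      have e : fderiv ℝ (id : E → E) x k = k := by rw [fderiv_id]; rfl
      rw [e, id]
      calc _ ≤ _ := this
        _ ≤ γ ^ m * (C * ‖k‖) := mul_le_mul_of_nonneg_left (hCb k) (by positivity)
        _ = C * γ ^ m * ‖k‖ := by ring⟩)
  exact ⟨X, h1, h2, h3, h4⟩

theorem exists_projected_leaf (h : BandSys r k P q α β μ μ' ω γ σ δ η L Φ) {Z : E → E}
    (hZ : IsLeaf (bandSup q (Finset.range r)) Φ (bandSup q (Finset.range k)) (P k) (μ k) (μ k)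
      (fun _ => 0) (ContinuousLinearMap.id ℝ E) Z) {j : ℕ} (hj : 1 ≤ j) (hjk : j ≤ k) :
    ∃ X, IsLeaf (bandSup q (Finset.range r)) Φ (bandSup q (Finset.range j)) (P j) (μ j) (μ j)
      Z 0 X := by
  have hw := h.weights
  have hjr : j < r := hjk.trans_lt hw.k_lt
  have hs := h.splitSys hj hjr
  have hμ := h.μ_pos hj hjr
  have hω : 0 < ω j := hμ.trans (h.μ_lt_ω hj hjr)
  obtain ⟨X, h1, h2, h3, h4⟩ := exists_leaf (γ := μ k) hs.split hs.proj hs.sys hs.definite hs.δ_pos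
    hs.β_nonneg hs.η_nonneg hs.small' hs.L_nonneg (μ := μ j) (ω := ω j) (ω₂ := ω j)
    (by linarith) (h.μ_lt_ω hj hjr) le_rfl (ν := μ j) (by linarith) (h.μ_lt_ω hj hjr) le_rfl
    (h.μ_pos hw.k_pos hw.k_lt).le
    (mul_le_of_le_one_right hμ.le (h.μ_le_one hw.k_pos le_rfl))
    zero_lt_one le_rfl (by
      rw [Real.rpow_one]
      exact mul_le_of_le_one_right hω.le
        (max_le (h.μ_le_one hj hjk) (h.μ_le_one hw.k_pos le_rfl)))
    hZ.contDiff (0 : E →L[ℝ] E)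
    (fun ρ => by simpa using hZ.deriv ρ)
  exact ⟨X, h1, h2, h3, h4⟩

end BandSys

/-- The invariant leaves and band maps from which the linearization is assembled. -/
structure Leaves (r k : ℕ) (P : ℕ → E →L[ℝ] E) (q : ℕ → ℕ → Seminorm ℝ E) (μ : ℕ → ℝ) (γ : ℝ)
    (Φ : ℕ → E → E) (Z F : E → E) (X π S : ℕ → E → E) : Prop where
  slow : IsLeaf (bandSup q (Finset.range r)) Φ (bandSup q (Finset.range k)) (P k) (μ k) (μ k)
    (fun _ => 0) (ContinuousLinearMap.id ℝ E) Z
  fast : IsLeaf (bandSup q (Finset.range r)) Φ (bandSup q (Finset.range k)) (P k) (μ k) (μ k * γ)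
    id 0 F
  zero : ∀ i, k ≤ i → i < r → IsLeaf (bandSup q (Finset.range r)) Φ (bandSup q (Finset.range i))
    (P i) (μ i) (μ i) (fun _ => 0) (ContinuousLinearMap.id ℝ E) (X i)
  projected : ∀ i, i < k → IsLeaf (bandSup q (Finset.range r)) Φ
    (bandSup q (Finset.range (i + 1))) (P (i + 1)) (μ (i + 1)) (μ (i + 1)) Z 0 (π i)
  contDiff : ∀ i, i < k → ContDiff ℝ 1 (S i)
  tendsto : ∀ i, i < k → ∀ w, Filter.Tendsto
    (fun M => (P (i + 1) - P i) (Φ M (Z w) - Φ M (π i w))) Filter.atTop (nhds (S i w))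
  tendsto_fderiv : ∀ i, i < k → ∀ w h, Filter.Tendsto
    (fun M => (P (i + 1) - P i) (fderiv ℝ (Φ M) (Z w) (fderiv ℝ Z w h) -
      fderiv ℝ (Φ M) (π i w) (fderiv ℝ (π i) w h))) Filter.atTop (nhds (fderiv ℝ (S i) w h))

/-- The `i`-th coordinate of the linearization, before projection to the band. -/
def bandCoord (k : ℕ) (F : E → E) (X S : ℕ → E → E) (i : ℕ) (w : E) : E :=
  if i < k then S i w else F w - X i (F w)

/-- The linearization assembled from its bands. -/
def bandChart (r k : ℕ) (P : ℕ → E →L[ℝ] E) (F : E → E) (X S : ℕ → E → E) (w : E) : E :=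
  ∑ i ∈ Finset.range r,
    (P (i + 1) (bandCoord k F X S i w) - P i (bandCoord k F X S i w))

namespace BandSys

variable {r k : ℕ} {P : ℕ → E →L[ℝ] E} {q : ℕ → ℕ → Seminorm ℝ E}
  {α β μ μ' ω : ℕ → ℝ} {γ σ δ η L : ℝ} {Φ : ℕ → E → E} {Z F : E → E} {X π S : ℕ → E → E}

theorem q_zero_proj (h : BandSys r k P q α β μ μ' ω γ σ δ η L Φ) {i : ℕ} (hi : i < r) (x : E) :
    bandSup q (Finset.range r) 0 ((P (i + 1) - P i) x) ≤ q i 0 x := by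
  rw [sub_apply]
  refine bandSup_le (apply_nonneg _ _) fun j hj => ?_
  rw [Finset.mem_range] at hj
  rw [← h.bands.q_proj j 0 _ hj, h.bands.band_comp hj hi]
  split_ifs with hji
  · subst hji; rw [h.bands.q_proj _ _ _ hj]
  · rw [map_zero]; exact apply_nonneg _ _

theorem exists_leaves [FiniteDimensional ℝ E] (h : BandSys r k P q α β μ μ' ω γ σ δ η L Φ) :
    ∃ Z F X π S, Leaves r k P q μ γ Φ Z F X π S := by
  have hw := h.weights
  obtain ⟨Z, hZ⟩ := h.exists_const_leaf hw.k_pos hw.k_lt 0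
  obtain ⟨F, hF⟩ := h.exists_fast_leaf
  have hX : ∀ i, ∃ X : E → E, k ≤ i → i < r → IsLeaf (bandSup q (Finset.range r)) Φ
      (bandSup q (Finset.range i)) (P i) (μ i) (μ i) (fun _ => 0) (ContinuousLinearMap.id ℝ E) X := by
    intro i
    by_cases hi : k ≤ i ∧ i < r
    · obtain ⟨X, hX⟩ := h.exists_const_leaf (hw.k_pos.trans hi.1) hi.2 0
      exact ⟨X, fun _ _ => hX⟩
    · exact ⟨id, fun h1 h2 => absurd ⟨h1, h2⟩ hi⟩
  choose X hX using hX
  have hπ : ∀ i, ∃ π : E → E, i < k → IsLeaf (bandSup q (Finset.range r)) Φ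
      (bandSup q (Finset.range (i + 1))) (P (i + 1)) (μ (i + 1)) (μ (i + 1)) Z 0 π := by
    intro i
    by_cases hi : i < k
    · obtain ⟨π, hπ⟩ := h.exists_projected_leaf hZ (j := i + 1) (by omega) hi
      exact ⟨π, fun _ => hπ⟩
    · exact ⟨id, fun h1 => absurd h1 hi⟩
  choose π hπ using hπ
  have hS : ∀ i, ∃ S : E → E, i < k → ContDiff ℝ 1 S ∧
      (∀ w, Filter.Tendsto (fun M => (P (i + 1) - P i) (Φ M (Z w) - Φ M (π i w))) Filter.atTop
        (nhds (S w))) ∧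
      ∀ w h, Filter.Tendsto (fun M => (P (i + 1) - P i) (fderiv ℝ (Φ M) (Z w) (fderiv ℝ Z w h) -
        fderiv ℝ (Φ M) (π i w) (fderiv ℝ (π i) w h))) Filter.atTop (nhds (fderiv ℝ S w h)) := by
    intro i
    by_cases hi : i < k
    · have hir : i < r := hi.trans hw.k_lt
      have hk0 := h.μ_pos hw.k_pos hw.k_lt
      have hi0 := h.μ_pos (Nat.succ_pos i) (show i + 1 < r by have := hw.k_lt; omega)
      obtain ⟨S, hS⟩ := exists_stable_band_map (h.splitSys hw.k_pos hw.k_lt)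
        hk0.le hZ hi0.le
        (hw.μ_le _ (Nat.succ_pos i) hi) (hπ i hi) (Q := q i) (a := α i)
        (fun n x => le_bandSup q (Finset.mem_range.2 hir) n x) (fun m x => h.bands.low i m x hir)
        (by
          refine lt_of_le_of_lt ?_ (hw.stable i hi)
          rw [mul_comm]
          exact mul_le_mul (hw.μ_lt _ (Nat.succ_pos i) (by have := hw.k_lt; omega)).le
            (hw.μ_lt k hw.k_pos hw.k_lt).le hk0.le
            (hi0.le.trans (hw.μ_lt _ (Nat.succ_pos i) (by have := hw.k_lt; omega)).le))
        (Pr := P (i + 1) - P i) (h.q_zero_proj hir)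
      exact ⟨S, fun _ => hS⟩
    · exact ⟨id, fun h1 => absurd h1 hi⟩
  choose S hS using hS
  exact ⟨Z, F, X, π, S, hZ, hF, hX, hπ, fun i hi => (hS i hi).1, fun i hi => (hS i hi).2.1,
    fun i hi => (hS i hi).2.2⟩

theorem unique (h : BandSys r k P q α β μ μ' ω γ σ δ η L Φ) {j : ℕ} (hj : 1 ≤ j) (hjr : j < r)
    {x y : E} (hP : P j x = P j y)
    (hg : GrowsBelow (bandSup q (Finset.range r)) (ω j) fun m => Φ m x - Φ m y) : x = y := by
  have hs := h.splitSys hj hjr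
  have h1 := (hs.future_diff (h.room_ω hj hjr) 0 hg).2
  rw [h.sys.start, h.sys.start] at h1
  have h2 := hs.l_zero hP
  have h3 := hs.split.eq_max 0 (x - y)
  refine sub_eq_zero.1 (hs.definite 0 _ ?_)
  have := apply_nonneg (bandSup q (Finset.range r) 0) (x - y)
  rcases max_cases (bandSup q (Finset.range j) 0 (x - y)) (bandSup q (Finset.Ico j r) 0 (x - y))
    with h4 | h4 <;> linarith [h4.1]

theorem unique_vec (h : BandSys r k P q α β μ μ' ω γ σ δ η L Φ) {j : ℕ} (hj : 1 ≤ j) (hjr : j < r)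
    {x u : E} (hP : P j u = 0)
    (hg : GrowsBelow (bandSup q (Finset.range r)) (ω j) fun m => fderiv ℝ (Φ m) x u) : u = 0 := by
  have hs := h.splitSys hj hjr
  have h1 := (hs.future_lin (h.room_ω hj hjr) 0 hg).2
  rw [h.sys.fderiv_start] at h1
  have h2 := hs.proj.l_eq_zero (n := 0) hP
  have h3 := hs.split.eq_max 0 u
  refine hs.definite 0 _ ?_
  have := apply_nonneg (bandSup q (Finset.range r) 0) u
  rcases max_cases (bandSup q (Finset.range j) 0 u) (bandSup q (Finset.Ico j r) 0 u)
    with h4 | h4 <;> linarith [h4.1]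

theorem const_leaf_ext (h : BandSys r k P q α β μ μ' ω γ σ δ η L Φ) {j : ℕ} (hj : 1 ≤ j)
    (hjr : j < r) {c : E} {X : E → E}
    (hX : IsLeaf (bandSup q (Finset.range r)) Φ (bandSup q (Finset.range j)) (P j) (μ j) (μ j)
      (fun _ => c) (ContinuousLinearMap.id ℝ E) X) {x y : E} (hxy : P j x = P j y) : X x = X y := by
  refine h.unique hj hjr ((hX.proj x).trans (hxy.trans (hX.proj y).symm)) ?_
  have hμ := (h.μ_pos hj hjr).le
  exact (hX.grows hμ (h.μ_lt_ω hj hjr) x).add ((hX.grows hμ (h.μ_lt_ω hj hjr) y).neg fun _ => rfl)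
    fun m => by abel

theorem zero_leaf_zero (h : BandSys r k P q α β μ μ' ω γ σ δ η L Φ) {j : ℕ} {X : E → E}
    (hX : IsLeaf (bandSup q (Finset.range r)) Φ (bandSup q (Finset.range j)) (P j) (μ j) (μ j)
      (fun _ => 0) (ContinuousLinearMap.id ℝ E) X) : X 0 = 0 := by
  have := hX.close 0 0
  simp only [h.sys.start, sub_zero, map_zero, mul_zero] at this
  exact h.bands.sup_definite 0 _ (le_antisymm this (apply_nonneg _ _))

theorem zero_leaf_fderiv (h : BandSys r k P q α β μ μ' ω γ σ δ η L Φ) {j : ℕ} (hj : 1 ≤ j)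
    (hjr : j < r) {X : E → E}
    (hX : IsLeaf (bandSup q (Finset.range r)) Φ (bandSup q (Finset.range j)) (P j) (μ j) (μ j)
      (fun _ => 0) (ContinuousLinearMap.id ℝ E) X) {y u : E} (hu : P j u = 0) :
    fderiv ℝ X y u = 0 := by
  refine h.unique_vec hj hjr (x := X y) ((hX.proj_fderiv y u).trans hu) ?_
  simpa using hX.grows_fderiv (h.μ_pos hj hjr).le (h.μ_lt_ω hj hjr) y u

theorem fast_eq (h : BandSys r k P q α β μ μ' ω γ σ δ η L Φ) (hl : Leaves r k P q μ γ Φ Z F X π S)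
    {y w : E} (hy : P k y = 0)
    (hg : GrowsBelow (bandSup q (Finset.range r)) (ω k) fun m => Φ m w - Φ m y) : F w = y := by
  have hw := h.weights
  refine h.unique hw.k_pos hw.k_lt ((hl.fast.proj w).trans (by simp [hy])) ?_
  exact (hl.fast.grows (h.μ_pos hw.k_pos hw.k_lt).le (h.μ_lt_ω hw.k_pos hw.k_lt) w).add hg
    fun m => by simp

theorem P_fast (hl : Leaves r k P q μ γ Φ Z F X π S) (w : E) : P k (F w) = 0 := by
  simpa using hl.fast.proj w

theorem slow_grows (h : BandSys r k P q α β μ μ' ω γ σ δ η L Φ)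
    (hl : Leaves r k P q μ γ Φ Z F X π S) (w : E) :
    GrowsBelow (bandSup q (Finset.range r)) (ω k) fun m => Φ m (Z w) := by
  have hw := h.weights
  simpa [h.sys.fixed] using
    hl.slow.grows (h.μ_pos hw.k_pos hw.k_lt).le (h.μ_lt_ω hw.k_pos hw.k_lt) w

theorem fast_slow (h : BandSys r k P q α β μ μ' ω γ σ δ η L Φ)
    (hl : Leaves r k P q μ γ Φ Z F X π S) (w : E) : F (Z w) = 0 :=
  h.fast_eq hl (map_zero _) (by simpa [h.sys.fixed] using h.slow_grows hl w)

theorem slow_ext (h : BandSys r k P q α β μ μ' ω γ σ δ η L Φ)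
    (hl : Leaves r k P q μ γ Φ Z F X π S) {w w' : E} (hP : P k w = P k w') : Z w = Z w' :=
  h.const_leaf_ext h.weights.k_pos h.weights.k_lt hl.slow hP

theorem projected_ext (h : BandSys r k P q α β μ μ' ω γ σ δ η L Φ)
    (hl : Leaves r k P q μ γ Φ Z F X π S) {i : ℕ} (hi : i < k) {w w' : E} (hP : P k w = P k w') :
    π i w = π i w' := by
  have hir : i + 1 < r := by have := h.weights.k_lt; omega
  have hμ := (h.μ_pos (Nat.succ_pos i) hir).le
  have hω := h.μ_lt_ω (Nat.succ_pos i) hir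
  have hπ := hl.projected i hi
  refine h.unique (Nat.succ_pos i) hir ((hπ.proj w).trans ((hπ.proj w').trans (by simp)).symm) ?_
  refine (hπ.grows hμ hω w).add ((hπ.grows hμ hω w').neg fun _ => rfl) fun m => ?_
  rw [h.slow_ext hl hP]; abel

theorem band_map_ext (h : BandSys r k P q α β μ μ' ω γ σ δ η L Φ)
    (hl : Leaves r k P q μ γ Φ Z F X π S) {i : ℕ} (hi : i < k) {w w' : E} (hP : P k w = P k w') :
    S i w = S i w' := by
  have h1 := hl.tendsto i hi w
  rw [h.slow_ext hl hP, h.projected_ext hl hi hP] at h1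
  exact tendsto_nhds_unique h1 (hl.tendsto i hi w')

theorem band_chart (h : BandSys r k P q α β μ μ' ω γ σ δ η L Φ) {i : ℕ} (hi : i < r) (w : E) :
    P (i + 1) (bandChart r k P F X S w) - P i (bandChart r k P F X S w) =
      P (i + 1) (bandCoord k F X S i w) - P i (bandCoord k F X S i w) :=
  h.bands.band_sum hi fun i => bandCoord k F X S i w

theorem chart_slow (h : BandSys r k P q α β μ μ' ω γ σ δ η L Φ)
    (hl : Leaves r k P q μ γ Φ Z F X π S) (w : E) :
    bandChart r k P F X S (Z w) = P k (bandChart r k P F X S w) := by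
  have hk := h.weights.k_lt
  simp only [bandChart]
  rw [h.bands.P_sum hk.le (fun i => bandCoord k F X S i w),
    ← Finset.sum_range_add_sum_Ico _ hk.le, Finset.sum_eq_zero (s := Finset.Ico k r), add_zero]
  · refine Finset.sum_congr rfl fun i hi => ?_
    rw [Finset.mem_range] at hi
    simp only [bandCoord, if_pos hi]
    rw [h.band_map_ext hl hi (hl.slow.proj w)]; rfl
  · intro i hi
    rw [Finset.mem_Ico] at hi
    simp only [bandCoord, if_neg (not_lt.2 hi.1)]
    rw [h.fast_slow hl, h.zero_leaf_zero (hl.zero i hi.1 hi.2), sub_zero, map_zero, map_zero,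
      sub_zero]

theorem slow_zero (h : BandSys r k P q α β μ μ' ω γ σ δ η L Φ)
    (hl : Leaves r k P q μ γ Φ Z F X π S) : Z 0 = 0 := h.zero_leaf_zero hl.slow

theorem chart_zero (h : BandSys r k P q α β μ μ' ω γ σ δ η L Φ)
    (hl : Leaves r k P q μ γ Φ Z F X π S) : bandChart r k P F X S 0 = 0 := by
  have hF : F 0 = 0 := by have := h.fast_slow hl 0; rwa [h.slow_zero hl] at this
  refine Finset.sum_eq_zero fun i hi => ?_
  rw [Finset.mem_range] at hi
  suffices bandCoord k F X S i 0 = 0 by rw [this, map_zero, map_zero, sub_zero]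
  unfold bandCoord
  split_ifs with hik
  · have hπ0 : π i 0 = 0 := by
      have := (hl.projected i hik).close 0 0
      simp only [h.sys.start, h.slow_zero hl, sub_zero, map_zero, mul_zero] at this
      exact h.bands.sup_definite 0 _ (le_antisymm this (apply_nonneg _ _))
    have h1 := hl.tendsto i hik 0
    simp only [h.slow_zero hl, hπ0, h.sys.fixed, sub_zero, map_zero] at h1
    exact tendsto_nhds_unique h1 tendsto_const_nhds
  · rw [hF, h.zero_leaf_zero (hl.zero i (not_lt.1 hik) hi), sub_zero]

theorem contDiff_bandCoord (hl : Leaves r k P q μ γ Φ Z F X π S) {i : ℕ} (hi : i < r) :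
    ContDiff ℝ 1 (bandCoord k F X S i) := by
  unfold bandCoord
  split_ifs with hik
  · exact hl.contDiff i hik
  · exact hl.fast.contDiff.sub ((hl.zero i (not_lt.1 hik) hi).contDiff.comp hl.fast.contDiff)

theorem fderiv_bandCoord (hl : Leaves r k P q μ γ Φ Z F X π S) {i : ℕ} (hik : k ≤ i) (hi : i < r) (w v : E) :
    fderiv ℝ (bandCoord k F X S i) w v =
      fderiv ℝ F w v - fderiv ℝ (X i) (F w) (fderiv ℝ F w v) := by
  have e : bandCoord k F X S i = fun w => F w - X i (F w) := by
    funext w; simp [bandCoord, not_lt.2 hik]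
  have hX := (hl.zero i hik hi).contDiff
  have hd : DifferentiableAt ℝ (fun w => X i (F w)) w :=
    (hX.comp hl.fast.contDiff).differentiable one_ne_zero w
  rw [e, fderiv_fun_sub (hl.fast.contDiff.differentiable one_ne_zero w) hd, sub_apply,
    fderiv_comp_apply' hX hl.fast.contDiff]

theorem contDiff_chart (hl : Leaves r k P q μ γ Φ Z F X π S) : ContDiff ℝ 1 (bandChart r k P F X S) := by
  refine ContDiff.sum fun i hi => ?_
  have hc := contDiff_bandCoord hl (Finset.mem_range.1 hi)
  exact ((P (i + 1)).contDiff.comp hc).sub ((P i).contDiff.comp hc)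

theorem fderiv_chart (h : BandSys r k P q α β μ μ' ω γ σ δ η L Φ)
    (hl : Leaves r k P q μ γ Φ Z F X π S) {i : ℕ} (hi : i < r) (w v : E) :
    P (i + 1) (fderiv ℝ (bandChart r k P F X S) w v) - P i (fderiv ℝ (bandChart r k P F X S) w v) =
      P (i + 1) (fderiv ℝ (bandCoord k F X S i) w v) -
        P i (fderiv ℝ (bandCoord k F X S i) w v) := by
  have hH := contDiff_chart hl
  have hc := contDiff_bandCoord hl hi
  have h1 := fderiv_clm_comp_apply (P (i + 1) - P i) hH w v
  have h2 := fderiv_clm_comp_apply (P (i + 1) - P i) hc w v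
  simp only [sub_apply] at h1 h2
  rw [← h1, ← h2]
  simp only [h.band_chart hi]

end BandSys

namespace BandSys

variable {r k : ℕ} {P : ℕ → E →L[ℝ] E} {q : ℕ → ℕ → Seminorm ℝ E}
  {α β μ μ' ω : ℕ → ℝ} {γ σ δ η L : ℝ} {Φ Ψ : ℕ → E → E} {Z F : E → E} {X π S : ℕ → E → E}

theorem exists_radius (h : BandSys r k P q α β μ μ' ω γ σ δ η L Φ) :
    ∃ ζ : ℝ, 0 < ζ ∧ L * ζ * 100000 ≤ δ ∧
      (∀ i, k ≤ i → i < r → L * ζ * 100000 ≤ ω k * ω i - β i) ∧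
      ∀ i, i < k → L * ζ * 100000 ≤ α i - μ' (i + 1) * μ' k := by
  have hw := h.weights
  have ht : Filter.Tendsto (fun ζ : ℝ => L * ζ * 100000) (nhdsWithin 0 (Set.Ioi 0)) (nhds 0) := by
    have : Filter.Tendsto (fun ζ : ℝ => L * ζ * 100000) (nhds 0) (nhds (L * 0 * 100000)) :=
      (Filter.tendsto_id.const_mul L).mul_const _
    rw [mul_zero, zero_mul] at this
    exact this.mono_left nhdsWithin_le_nhds
  have h1 := ht.eventually_le_const hw.δ_pos
  have h2 : ∀ᶠ ζ in nhdsWithin (0 : ℝ) (Set.Ioi 0), ∀ i ∈ Finset.Ico k r,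
      L * ζ * 100000 ≤ ω k * ω i - β i :=
    (Filter.eventually_all_finset _).2 fun i hi => ht.eventually_le_const (by
      rw [Finset.mem_Ico] at hi; linarith [hw.unstable i hi.1 hi.2])
  have h3 : ∀ᶠ ζ in nhdsWithin (0 : ℝ) (Set.Ioi 0), ∀ i ∈ Finset.range k,
      L * ζ * 100000 ≤ α i - μ' (i + 1) * μ' k :=
    (Filter.eventually_all_finset _).2 fun i hi => ht.eventually_le_const (by
      rw [Finset.mem_range] at hi; linarith [hw.stable i hi])
  obtain ⟨ζ, ⟨⟨h1, h2⟩, h3⟩, h4⟩ := (((h1.and h2).and h3).and self_mem_nhdsWithin).exists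
  exact ⟨ζ, h4, h1, fun i hi hir => h2 i (Finset.mem_Ico.2 ⟨hi, hir⟩),
    fun i hi => h3 i (Finset.mem_range.2 hi)⟩

/-- The linearization is close to the derivative cocycle along small orbits. -/
theorem chart_estimate [FiniteDimensional ℝ E] (h : BandSys r k P q α β μ μ' ω γ σ δ η L Φ)
    (hl : Leaves r k P q μ γ Φ Z F X π S)
    {ζ : ℝ} (hζ : L * ζ * 100000 ≤ δ)
    (hζu : ∀ i, k ≤ i → i < r → L * ζ * 100000 ≤ ω k * ω i - β i)
    (hζs : ∀ i, i < k → L * ζ * 100000 ≤ α i - μ' (i + 1) * μ' k) {n : ℕ} {w : E}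
    (hw : bandSup q (Finset.range r) n (Φ n w) ≤ ζ) (v : E) :
    bandSup q (Finset.range r) n (fderiv ℝ (bandChart r k P F X S) w v - fderiv ℝ (Φ n) w v) ≤
      1 / 4 * bandSup q (Finset.range r) n (fderiv ℝ (Φ n) w v) := by
  have hW := h.weights
  have hγ : 0 < γ := zero_lt_one.trans_le hW.one_le_γ
  have hk := h.splitSys hW.k_pos hW.k_lt
  have hμk := h.μ_pos hW.k_pos hW.k_lt
  refine bandSup_le (mul_nonneg (by norm_num) (apply_nonneg _ _)) fun i hi => ?_
  rw [Finset.mem_range] at hi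
  rw [h.bands.q_sub_proj hi n _ _ _ (h.fderiv_chart hl hi w v)]
  rcases lt_or_ge i k with hik | hik
  · have hir : i + 1 < r := by have := hW.k_lt; omega
    have e : bandCoord k F X S i = S i := by funext w; simp [bandCoord, hik]
    rw [e]
    have hlim := (((seminorm_continuous (q i n)).tendsto _).comp
      ((hl.tendsto_fderiv i hik w v).sub_const (fderiv ℝ (Φ n) w v)))
    refine le_of_tendsto hlim ((Filter.eventually_ge_atTop n).mono fun M hM => ?_)
    simp only [Function.comp_apply, sub_apply]
    rw [h.bands.q_sub_proj hi n (fderiv ℝ (Φ M) (Z w) (fderiv ℝ Z w v) -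
      fderiv ℝ (Φ M) (π i w) (fderiv ℝ (π i) w v)) _ _ (by
        rw [h.bands.band_comp hi hi, if_pos rfl])]
    exact stable_band_estimate hk (h.room_ω hW.k_pos hW.k_lt)
      (room _ hW.μ_le_σ (mul_le_of_le_one_right (by linarith [hW.one_le_ω]) hW.σ_le_one)) rfl
      (h.room_μ' hW.k_pos hW.k_lt) hμk.le (hW.μ_lt k hW.k_pos hW.k_lt) hW.σ_pos h.bwd hl.slow
      (h.splitSys (Nat.succ_pos i) hir) (h.room_μ' (Nat.succ_pos i) hir)
      (h.μ_pos (Nat.succ_pos i) hir).le (hW.μ_lt _ (Nat.succ_pos i) hir)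
      (hW.μ_le _ (Nat.succ_pos i) hik) (hl.projected i hik)
      (fun n x => le_bandSup q (Finset.mem_range.2 hik) n x)
      (fun n x => le_bandSup q (Finset.mem_range.2 (Nat.lt_succ_self i)) n x)
      (fun m x => h.bands.low i m x hi) hW.μ'_le_one (hW.stable i hik) hw hζ (hζs i hik) v M hM
  · rw [fderiv_bandCoord hl hik hi]
    have hi1 : 1 ≤ i := hW.k_pos.trans hik
    have hωγ : ω k / γ ≤ ω k := div_le_self (by linarith [hW.one_le_ω]) hW.one_le_γ
    exact unstable_band_estimate hk (room _ hW.μ_lt_γ.le hωγ) (h.room_ω hW.k_pos hW.k_lt)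
      (div_mul_cancel₀ _ hγ.ne').symm hμk.le hW.μ_lt_γ (mul_nonneg hμk.le hγ.le)
      ((lt_div_iff₀ hγ).1 hW.μ_lt_γ) hγ h.fwd hl.fast
      (h.splitSys hi1 hi) (h.room_ω hi1 hi) (fun x => h.bands.P_P hik hi.le x)
      (h.μ_pos hi1 hi).le (h.μ_lt_ω hi1 hi) (hl.zero i hik hi)
      (fun n x => le_bandSup q (Finset.mem_Ico.2 ⟨hik, hi⟩) n x)
      (fun n x => le_bandSup q (Finset.mem_Ico.2 ⟨le_rfl, hi⟩) n x)
      (hW.β_nonneg i hi) (fun m x => h.bands.up i m x hi) hW.one_le_ω (hW.unstable i hik hi) hw hζ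
      (hζu i hik hi) v

theorem chart_solve (h : BandSys r k P q α β μ μ' ω γ σ δ η L Φ)
    (hl : Leaves r k P q μ γ Φ Z F X π S) (z : E) :
    ∃ y, P k y = 0 ∧ ∀ i, k ≤ i → i < r →
      P (i + 1) (y - X i y) - P i (y - X i y) = P (i + 1) z - P i z := by
  have hW := h.weights
  suffices H : ∀ j, k ≤ j → j ≤ r → ∃ y, P j y = y ∧ P k y = 0 ∧ ∀ i, k ≤ i → i < j →
      P (i + 1) (y - X i y) - P i (y - X i y) = P (i + 1) z - P i z by
    obtain ⟨y, -, h1, h2⟩ := H r hW.k_lt.le le_rfl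
    exact ⟨y, h1, h2⟩
  intro j hj
  induction j, hj using Nat.le_induction with
  | base => exact fun _ => ⟨0, map_zero _, map_zero _, fun i h1 h2 => absurd h1 (not_le.2 h2)⟩
  | succ j hj ih =>
    intro hjr
    obtain ⟨y, hy, hyk, hyi⟩ := ih (by omega)
    let u := z + X j y
    let y' := y + (P (j + 1) u - P j u)
    have hPy : ∀ i, i ≤ j → P i y' = P i y := fun i hij => by
      simp only [y', map_add, map_sub]
      rw [h.bands.P_P (by omega) hjr, h.bands.P_P hij (by omega), sub_self, add_zero]
    have hy' : P (j + 1) y' = y' := by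
      simp only [y', map_add, map_sub]
      rw [h.bands.P_P le_rfl hjr, h.bands.P_P' (by omega) hjr]
      nth_rw 1 [← hy]
      rw [h.bands.P_P' (by omega) hjr, hy]
    refine ⟨y', hy', (hPy k hj).trans hyk, fun i hki hij => ?_⟩
    have hX : X i y' = X i y := h.const_leaf_ext (hW.k_pos.trans hki) (by omega)
      (hl.zero i hki (by omega)) (hPy i (by omega))
    rcases Nat.lt_succ_iff_lt_or_eq.1 hij with hij | rfl
    · rw [hX, map_sub, map_sub, hPy _ (by omega), hPy _ (by omega), ← map_sub, ← map_sub,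
        hyi i hki hij]
    · rw [hX, map_sub, map_sub, hPy _ le_rfl, hy', hy]
      simp only [y', u, map_add]
      abel

theorem eq_of_bands (h : BandSys r k P q α β μ μ' ω γ σ δ η L Φ) {x y : E}
    (hxy : ∀ i, i < r → P (i + 1) x - P i x = P (i + 1) y - P i y) : x = y := by
  rw [← h.bands.sum_bands x, ← h.bands.sum_bands y]
  exact Finset.sum_congr rfl fun i hi => hxy i (Finset.mem_range.1 hi)

theorem eq_of_fast (h : BandSys r k P q α β μ μ' ω γ σ δ η L Φ)
    (hl : Leaves r k P q μ γ Φ Z F X π S) {w w' : E} (hP : P k w = P k w') (hF : F w = F w') :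
    w = w' := by
  have hW := h.weights
  have hμ := (h.μ_pos hW.k_pos hW.k_lt).le
  have hω := h.μ_lt_ω hW.k_pos hW.k_lt
  refine h.unique hW.k_pos hW.k_lt hP ?_
  refine ((hl.fast.grows hμ hω w).neg fun _ => rfl).add (hl.fast.grows hμ hω w') fun m => ?_
  rw [hF]; simp

theorem fast_eq_of_chart (h : BandSys r k P q α β μ μ' ω γ σ δ η L Φ)
    (hl : Leaves r k P q μ γ Φ Z F X π S) {w w' : E}
    (hH : bandChart r k P F X S w = bandChart r k P F X S w') : F w = F w' := by
  have hW := h.weights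
  suffices H : ∀ j, k ≤ j → j ≤ r → P j (F w) = P j (F w') by
    have := H r hW.k_lt.le le_rfl
    rwa [h.bands.P_top, h.bands.P_top] at this
  intro j hj
  induction j, hj using Nat.le_induction with
  | base => exact fun _ => (P_fast hl w).trans (P_fast hl w').symm
  | succ j hj ih =>
    intro hjr
    have ih := ih (by omega)
    have hX : X j (F w) = X j (F w') := h.const_leaf_ext (hW.k_pos.trans hj) hjr
      (hl.zero j hj hjr) ih
    have h1 := h.band_chart (F := F) (X := X) (S := S) (k := k) (i := j) hjr w
    rw [hH, h.band_chart hjr] at h1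
    simp only [bandCoord, if_neg (not_lt.2 hj), map_sub, hX, ih] at h1
    have h2 : ∀ a b c d e : E, a - b - (c - d) = e - b - (c - d) → a = e := fun a b c d e h => by
      simpa using h
    exact (h2 _ _ _ _ _ h1).symm

end BandSys

namespace BandSys

variable {r k : ℕ} {P : ℕ → E →L[ℝ] E} {q : ℕ → ℕ → Seminorm ℝ E}
  {α β μ μ' ω : ℕ → ℝ} {γ σ δ η L ζ : ℝ} {Φ Ψ : ℕ → E → E} {Z F : E → E} {X π S : ℕ → E → E}

/-- The small-orbit estimate for the linearization `H`. -/
def NearCocycle (p : ℕ → Seminorm ℝ E) (Φ : ℕ → E → E) (ζ : ℝ) (H : E → E) : Prop :=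
  ∀ n w v, p n (Φ n w) ≤ ζ →
    p n (fderiv ℝ H w v - fderiv ℝ (Φ n) w v) ≤ 1 / 4 * p n (fderiv ℝ (Φ n) w v)

theorem transported_near_id [FiniteDimensional ℝ E] {p : ℕ → Seminorm ℝ E} {H : E → E} (hH : ContDiff ℝ 1 H)
    (hn : NearCocycle p Φ ζ H) (hΦ : ∀ n, ContDiff ℝ 1 (Φ n)) (hΨ : ∀ n, ContDiff ℝ 1 (Ψ n))
    (hΦΨ : ∀ n x, Φ n (Ψ n x) = x) (n : ℕ) {x y : E} (hx : p n x ≤ ζ) (hy : p n y ≤ ζ) :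
    p n ((H (Ψ n x) - H (Ψ n y)) - (x - y)) ≤ 1 / 4 * p n (x - y) := by
  refine seminorm_map_sub_le (p n) (K := fun x => H (Ψ n x))
    ((hH.comp (hΨ n)).differentiable one_ne_zero) (fun x hx v => ?_) hx hy
  have h1 : fderiv ℝ (Φ n) (Ψ n x) (fderiv ℝ (Ψ n) x v) = v := by
    rw [← fderiv_comp_apply' (hΦ n) (hΨ n)]
    simp only [hΦΨ]
    simp
  have h2 := hn n (Ψ n x) (fderiv ℝ (Ψ n) x v) (by rwa [hΦΨ])
  rwa [h1, ← fderiv_comp_apply' hH (hΨ n)] at h2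

theorem tendsto_slow (h : BandSys r k P q α β μ μ' ω γ σ δ η L Φ)
    (hl : Leaves r k P q μ γ Φ Z F X π S) (hζ : 0 < ζ) (w : E) :
    ∀ᶠ n in Filter.atTop, bandSup q (Finset.range r) n (Φ n (Z w)) ≤ ζ := by
  have hW := h.weights
  have hμ := h.μ_pos hW.k_pos hW.k_lt
  have hμ1 : μ k < 1 := (hW.μ_lt k hW.k_pos hW.k_lt).trans_le hW.μ'_le_one
  have h1 : Filter.Tendsto (fun n : ℕ => μ k ^ n * bandSup q (Finset.range k) 0 w) Filter.atTop
      (nhds 0) := by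
    simpa using (tendsto_pow_atTop_nhds_zero_of_lt_one hμ.le hμ1).mul_const _
  filter_upwards [h1.eventually_le_const hζ] with n hn
  have := hl.slow.close w n
  rw [h.sys.fixed] at this
  simp only [sub_zero, ContinuousLinearMap.id_apply] at this
  exact this.trans hn

theorem eventually_P_le (h : BandSys r k P q α β μ μ' ω γ σ δ η L Φ) (hζ : 0 < ζ) (z : E) :
    ∃ n, bandSup q (Finset.range r) n (P k z) ≤ ζ := by
  have hW := h.weights
  have hs := h.splitSys hW.k_pos hW.k_lt
  have hμ := h.δ_le_μ hW.k_pos hW.k_lt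
  have hμ1 : μ k < 1 := (hW.μ_lt k hW.k_pos hW.k_lt).trans_le hW.μ'_le_one
  have hb : ∀ n, bandSup q (Finset.range r) n (P k z) ≤
      (μ k - δ) ^ n * bandSup q (Finset.range k) 0 z := by
    intro n
    rw [hs.split.eq_max, hs.proj.r_proj, max_eq_left (apply_nonneg _ _), hs.proj.l_proj]
    induction n with
    | zero => simp
    | succ n ih =>
      refine (hs.split.contr n z).trans ((mul_le_mul_of_nonneg_left ih (by linarith)).trans_eq ?_)
      rw [pow_succ]; ring
  have h1 : Filter.Tendsto (fun n : ℕ => (μ k - δ) ^ n * bandSup q (Finset.range k) 0 z)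
      Filter.atTop (nhds 0) := by
    simpa using (tendsto_pow_atTop_nhds_zero_of_lt_one (r := μ k - δ) (by linarith)
      (by linarith [hW.δ_pos])).mul_const (bandSup q (Finset.range k) 0 z)
  obtain ⟨n, hn⟩ := (h1.eventually_le_const hζ).exists
  exact ⟨n, (hb n).trans hn⟩

theorem chart_injective [FiniteDimensional ℝ E] (h : BandSys r k P q α β μ μ' ω γ σ δ η L Φ)
    (hl : Leaves r k P q μ γ Φ Z F X π S) (hζ : 0 < ζ)
    (hn : NearCocycle (bandSup q (Finset.range r)) Φ ζ (bandChart r k P F X S))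
    (hΨ : ∀ n, ContDiff ℝ 1 (Ψ n)) (hΦΨ : ∀ n x, Φ n (Ψ n x) = x) (hΨΦ : ∀ n x, Ψ n (Φ n x) = x) :
    Function.Injective (bandChart r k P F X S) := by
  intro w w' hww
  refine h.eq_of_fast hl ?_ (h.fast_eq_of_chart hl hww)
  obtain ⟨n, h1, h2⟩ := ((h.tendsto_slow hl hζ w).and (h.tendsto_slow hl hζ w')).exists
  have h3 := transported_near_id (contDiff_chart hl) hn h.sys.contDiff hΨ hΦΨ n h1 h2
  rw [hΨΦ, hΨΦ, h.chart_slow hl, h.chart_slow hl, hww, sub_self, zero_sub, map_neg_eq_map] at h3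
  have hnn := apply_nonneg (bandSup q (Finset.range r) n) (Φ n (Z w) - Φ n (Z w'))
  have h4 : Φ n (Z w) - Φ n (Z w') = 0 := h.bands.sup_definite n _
    (le_antisymm (by linarith) hnn)
  have h5 : Z w = Z w' := by rw [← hΨΦ n (Z w), sub_eq_zero.1 h4, hΨΦ]
  have h6 := hl.slow.proj w
  rw [h5, hl.slow.proj w'] at h6
  exact h6.symm

theorem exists_small_preimage [FiniteDimensional ℝ E]
    (h : BandSys r k P q α β μ μ' ω γ σ δ η L Φ)
    (hl : Leaves r k P q μ γ Φ Z F X π S) (hζ : 0 < ζ)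
    (hn : NearCocycle (bandSup q (Finset.range r)) Φ ζ (bandChart r k P F X S))
    (hΨ : ∀ n, ContDiff ℝ 1 (Ψ n)) (hΦΨ : ∀ n x, Φ n (Ψ n x) = x) (hΨΦ : ∀ n x, Ψ n (Φ n x) = x)
    {n : ℕ} {z : E} (hz : bandSup q (Finset.range r) n z ≤ ζ / 2) :
    ∃ w, bandSup q (Finset.range r) n (Φ n w) ≤ ζ ∧ bandChart r k P F X S w = z := by
  have hΨ0 : Ψ n 0 = 0 := by rw [← h.sys.fixed n, hΨΦ, h.sys.fixed]
  obtain ⟨x, hx, hxz⟩ := exists_preimage_of_near_id (bandSup q (Finset.range r) n)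
    (h.bands.sup_definite n) (K := fun x => bandChart r k P F X S (Ψ n x))
    ((contDiff_chart hl).continuous.comp (hΨ n).continuous)
    (by rw [hΨ0, h.chart_zero hl]) hζ.le
    (fun x y hx hy => (transported_near_id (contDiff_chart hl) hn h.sys.contDiff hΨ hΦΨ n hx
      hy).trans (mul_le_mul_of_nonneg_right (by norm_num) (apply_nonneg _ _))) hz
  exact ⟨Ψ n x, by rwa [hΦΨ], hxz⟩

theorem chart_surjective [FiniteDimensional ℝ E]
    (h : BandSys r k P q α β μ μ' ω γ σ δ η L Φ)
    (hl : Leaves r k P q μ γ Φ Z F X π S) (hζ : 0 < ζ)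
    (hn : NearCocycle (bandSup q (Finset.range r)) Φ ζ (bandChart r k P F X S))
    (hΨ : ∀ n, ContDiff ℝ 1 (Ψ n)) (hΦΨ : ∀ n x, Φ n (Ψ n x) = x)
    (hΨΦ : ∀ n x, Ψ n (Φ n x) = x) : Function.Surjective (bandChart r k P F X S) := by
  intro z
  have hW := h.weights
  obtain ⟨n, hnz⟩ := h.eventually_P_le (half_pos hζ) z
  obtain ⟨w₀, -, hw₀⟩ := h.exists_small_preimage hl hζ hn hΨ hΦΨ hΨΦ hnz
  obtain ⟨y, hy, hyz⟩ := h.chart_solve hl z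
  obtain ⟨W, hWl⟩ := h.exists_const_leaf hW.k_pos hW.k_lt y
  have hP : P k (W w₀) = P k w₀ := hWl.proj w₀
  have hF : F (W w₀) = y := h.fast_eq hl hy
    (hWl.grows (h.μ_pos hW.k_pos hW.k_lt).le (h.μ_lt_ω hW.k_pos hW.k_lt) w₀)
  refine ⟨W w₀, h.eq_of_bands fun i hi => ?_⟩
  rw [h.band_chart hi]
  rcases lt_or_ge i k with hik | hik
  · have h1 := h.band_chart (F := F) (X := X) (S := S) (k := k) hi w₀
    rw [hw₀, h.bands.P_P (by omega) hW.k_lt.le, h.bands.P_P (by omega) hW.k_lt.le] at h1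
    rw [h1]
    simp only [bandCoord, if_pos hik, h.band_map_ext hl hik hP]
  · simp only [bandCoord, if_neg (not_lt.2 hik), hF, hyz i hik hi]

theorem chart_fderiv_injective (h : BandSys r k P q α β μ μ' ω γ σ δ η L Φ)
    (hl : Leaves r k P q μ γ Φ Z F X π S) (hζ : 0 < ζ)
    (hn : NearCocycle (bandSup q (Finset.range r)) Φ ζ (bandChart r k P F X S)) {w v : E}
    (hv : fderiv ℝ (bandChart r k P F X S) w v = 0) : v = 0 := by
  have hW := h.weights
  have hH := contDiff_chart (P := P) hl
  have h1 : fderiv ℝ (bandChart r k P F X S) (Z w) (fderiv ℝ Z w v) = 0 := by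
    rw [← fderiv_comp_apply' hH hl.slow.contDiff]
    simp only [h.chart_slow hl]
    rw [fderiv_clm_comp_apply (P k) hH, hv, map_zero]
  obtain ⟨n, hnw⟩ := (h.tendsto_slow hl hζ w).exists
  have h2 := hn n (Z w) (fderiv ℝ Z w v) hnw
  rw [h1, zero_sub, map_neg_eq_map] at h2
  have hnn := apply_nonneg (bandSup q (Finset.range r) n)
    (fderiv ℝ (Φ n) (Z w) (fderiv ℝ Z w v))
  have h3 : bandSup q (Finset.range r) n (fderiv ℝ (Φ n) (Z w) (fderiv ℝ Z w v)) = 0 :=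
    le_antisymm (by linarith) hnn
  have h4 := h.bwd n 0 (Z w) (fderiv ℝ Z w v) (Nat.zero_le n)
  rw [h3, mul_zero, h.sys.fderiv_start] at h4
  have h5 : fderiv ℝ Z w v = 0 := h.bands.sup_definite 0 _ (le_antisymm h4 (apply_nonneg _ _))
  have hPv : P k v = 0 := by
    have := hl.slow.proj_fderiv w v
    rw [h5, map_zero] at this
    exact this.symm
  have hFv : fderiv ℝ F w v = 0 := by
    suffices H : ∀ j, k ≤ j → j ≤ r → P j (fderiv ℝ F w v) = 0 by
      have := H r hW.k_lt.le le_rfl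
      rwa [h.bands.P_top] at this
    intro j hj
    induction j, hj using Nat.le_induction with
    | base => exact fun _ => by simpa using hl.fast.proj_fderiv w v
    | succ j hj ih =>
      intro hjr
      have ih := ih (by omega)
      have h6 := h.fderiv_chart hl (i := j) hjr w v
      rw [hv, fderiv_bandCoord hl hj hjr, h.zero_leaf_fderiv (hW.k_pos.trans hj) hjr
        (hl.zero j hj hjr) ih, sub_zero, ih, map_zero, map_zero, sub_zero, sub_zero] at h6
      exact h6.symm
  refine h.unique_vec hW.k_pos hW.k_lt hPv (x := w) ?_
  have hμ := h.μ_pos hW.k_pos hW.k_lt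
  have hγ : 0 < γ := zero_lt_one.trans_le hW.one_le_γ
  refine (hl.fast.grows_fderiv (mul_nonneg hμ.le hγ.le) ((lt_div_iff₀ hγ).1 hW.μ_lt_γ) w v).neg
    fun m => ?_
  rw [hFv, map_zero, zero_sub, neg_neg, fderiv_id]
  simp

/-- Smooth linearization of a band-decomposed orbit system. -/
theorem exists_linearization [FiniteDimensional ℝ E]
    (h : BandSys r k P q α β μ μ' ω γ σ δ η L Φ)
    (hΨ : ∀ n, ContDiff ℝ 1 (Ψ n)) (hΦΨ : ∀ n x, Φ n (Ψ n x) = x)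
    (hΨΦ : ∀ n x, Ψ n (Φ n x) = x) :
    ∃ (H G : E → E) (ζ : ℝ), ContDiff ℝ 1 H ∧ ContDiff ℝ 1 G ∧ (∀ x, G (H x) = x) ∧
      (∀ x, H (G x) = x) ∧ 0 < ζ ∧ NearCocycle (bandSup q (Finset.range r)) Φ ζ H ∧
      ∀ n w, bandSup q (Finset.range r) n (H w) ≤ ζ / 2 →
        bandSup q (Finset.range r) n (Φ n w) ≤ ζ := by
  obtain ⟨Z, F, X, π, S, hl⟩ := h.exists_leaves
  obtain ⟨ζ, hζ, h1, h2, h3⟩ := h.exists_radius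
  have hn : NearCocycle (bandSup q (Finset.range r)) Φ ζ (bandChart r k P F X S) :=
    fun n w v hw => h.chart_estimate hl h1 h2 h3 hw v
  have hinj := h.chart_injective hl hζ hn hΨ hΦΨ hΨΦ
  have hsurj := h.chart_surjective hl hζ hn hΨ hΦΨ hΨΦ
  let e := Equiv.ofBijective _ ⟨hinj, hsurj⟩
  refine ⟨bandChart r k P F X S, e.symm, ζ, contDiff_chart hl,
    contDiff_inverse_of_bijective (contDiff_chart hl) e.symm_apply_apply e.apply_symm_apply
      fun x v hv => h.chart_fderiv_injective hl hζ hn hv,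
    e.symm_apply_apply, e.apply_symm_apply, hζ, hn, fun n w hw => ?_⟩
  obtain ⟨w', h4, h5⟩ := h.exists_small_preimage hl hζ hn hΨ hΦΨ hΨΦ hw
  rwa [hinj h5] at h4

end BandSys

theorem exists_weights {r k : ℕ} {a b : ℕ → ℝ} (hk : 1 ≤ k) (hkr : k < r)
    (hab : ∀ i, i < r → 0 < a i ∧ a i ≤ b i) (hord : ∀ i, i + 1 < r → b i < a (i + 1))
    (hbk : b (k - 1) < 1) (hak : 1 < a k) (hγ : b (r - 1) < a k / b (k - 1))
    (hσ : (a 0)⁻¹ < a k / b (k - 1)) (hs : ∀ i, i < k → b i / a i < (b (k - 1))⁻¹)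
    (hu : ∀ i, k ≤ i → i < r → b i / a i < a k) :
    ∃ (α β μ μ' ω : ℕ → ℝ) (γ σ δ : ℝ), Weights r k α β μ μ' ω γ σ δ ∧
      ∀ i, i < r → 0 < α i ∧ α i < a i ∧ b i < β i := by
  have ha : ∀ i, i < r → 0 < a i := fun i hi => (hab i hi).1
  have hb : ∀ i, i < r → 0 < b i := fun i hi => (hab i hi).1.trans_le (hab i hi).2
  have hamono : ∀ i j, i ≤ j → j < r → a i ≤ a j := by
    intro i j hij
    induction j, hij using Nat.le_induction with
    | base => exact fun _ => le_rfl
    | succ j hj ih =>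
      exact fun h => (ih (by omega)).trans ((hab j (by omega)).2.trans (hord j h).le)
  have hbmono : ∀ i j, i ≤ j → j < r → b i ≤ b j := by
    intro i j hij
    induction j, hij using Nat.le_induction with
    | base => exact fun _ => le_rfl
    | succ j hj ih =>
      exact fun h => (ih (by omega)).trans ((hord j h).le.trans (hab (j + 1) h).2)
  have hB := hb (k - 1) (by omega)
  have hA0 := ha 0 (by omega)
  set g := max (b (r - 1)) 1 with hg
  set m := min (a 0) 1 with hm
  have hg0 : 0 < g := lt_max_of_lt_right one_pos
  have hm0 : 0 < m := lt_min hA0 one_pos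
  have key : ∀ {F G : ℝ → ℝ}, ContinuousAt F 1 → ContinuousAt G 1 → F 1 < G 1 →
      ∀ᶠ κ in nhdsWithin 1 (Set.Ioi (1 : ℝ)), F κ < G κ := fun hF hG h =>
    (hF.eventually_lt hG h).filter_mono nhdsWithin_le_nhds
  have e1 : ∀ᶠ κ in nhdsWithin 1 (Set.Ioi (1 : ℝ)), ∀ j ∈ Finset.Ico 1 r,
      κ ^ 3 * b (j - 1) < a j / κ ^ 2 := by
    refine (Finset.eventually_all _).2 fun j hj => key (by fun_prop)
      (ContinuousAt.div (by fun_prop) (by fun_prop) (by norm_num)) ?_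
    obtain ⟨h1, h2⟩ := Finset.mem_Ico.1 hj
    have := hord (j - 1) (by omega)
    rw [Nat.sub_add_cancel h1] at this
    simpa using this
  have e2 : ∀ᶠ κ in nhdsWithin 1 (Set.Ioi (1 : ℝ)), κ ^ 3 * b (k - 1) < 1 :=
    key (by fun_prop) (by fun_prop) (by simpa using hbk)
  have e3 : ∀ᶠ κ in nhdsWithin 1 (Set.Ioi (1 : ℝ)), 1 < a k / κ ^ 2 :=
    key (by fun_prop) (ContinuousAt.div (by fun_prop) (by fun_prop) (by norm_num))
      (by simpa using hak)
  have e4 : ∀ᶠ κ in nhdsWithin 1 (Set.Ioi (1 : ℝ)),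
      κ ^ 2 * b (k - 1) < a k / κ ^ 2 / (κ ^ 2 * g) := by
    refine key (by fun_prop) (ContinuousAt.div (ContinuousAt.div (by fun_prop) (by fun_prop)
      (by norm_num)) (by fun_prop) (by simpa using hg0.ne')) ?_
    simp only [one_pow, one_mul, div_one]
    rw [lt_div_iff₀ hg0, hg, mul_max_of_nonneg _ _ hB.le]
    rw [lt_div_iff₀ hB] at hγ
    exact max_lt (by linarith) (by linarith)
  have e5 : ∀ᶠ κ in nhdsWithin 1 (Set.Ioi (1 : ℝ)),
      κ ^ 2 * b (k - 1) < a k / κ ^ 2 * (m / κ ^ 2) := by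
    refine key (by fun_prop) (ContinuousAt.mul (ContinuousAt.div (by fun_prop) (by fun_prop)
      (by norm_num)) (ContinuousAt.div (by fun_prop) (by fun_prop) (by norm_num))) ?_
    simp only [one_pow, one_mul, div_one]
    rw [hm, mul_min_of_nonneg _ _ (by linarith)]
    rw [lt_div_iff₀ hB, inv_mul_lt_iff₀ hA0] at hσ
    exact lt_min (by linarith) (by linarith)
  have e6 : ∀ᶠ κ in nhdsWithin 1 (Set.Ioi (1 : ℝ)), ∀ i ∈ Finset.Ico k r,
      κ * b i < a k / κ ^ 2 * (a i / κ ^ 2) := by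
    refine (Finset.eventually_all _).2 fun i hi => key (by fun_prop)
      (ContinuousAt.mul (ContinuousAt.div (by fun_prop) (by fun_prop)
      (by norm_num)) (ContinuousAt.div (by fun_prop) (by fun_prop) (by norm_num))) ?_
    obtain ⟨h1, h2⟩ := Finset.mem_Ico.1 hi
    have := hu i h1 h2
    rw [div_lt_iff₀ (ha i h2)] at this
    simpa using this
  have e7 : ∀ᶠ κ in nhdsWithin 1 (Set.Ioi (1 : ℝ)), ∀ i ∈ Finset.range k,
      κ ^ 3 * b i * (κ ^ 3 * b (k - 1)) < a i / κ := by
    refine (Finset.eventually_all _).2 fun i hi => key (by fun_prop)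
      (ContinuousAt.div (by fun_prop) (by fun_prop) (by norm_num)) ?_
    have h1 := Finset.mem_range.1 hi
    have := hs i h1
    rw [div_lt_iff₀ (ha i (by omega)), lt_inv_mul_iff₀ hB] at this
    simp only [one_pow, one_mul, div_one]
    linarith
  obtain ⟨κ, h1, h2, h3, h4, h5, h6, h7, hκ⟩ := (e1.and (e2.and (e3.and (e4.and (e5.and
    (e6.and (e7.and self_mem_nhdsWithin))))))).exists
  have hκ : 1 < κ := hκ
  have hκ0 : 0 < κ := one_pos.trans hκ
  have hκ1 : κ < κ ^ 2 := by nlinarith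
  have hκ2 : κ ^ 2 < κ ^ 3 := by nlinarith
  have d1 : ∀ i, i < r → a i / κ ^ 2 < a i / κ := fun i hi =>
    div_lt_div_of_pos_left (ha i hi) hκ0 hκ1
  have d2 : m / κ ^ 2 < a 0 / κ :=
    (div_le_div_of_nonneg_right (min_le_left _ _) (by positivity)).trans_lt (d1 0 (by omega))
  have f1 : ∀ᶠ δ in nhdsWithin 0 (Set.Ioi (0 : ℝ)), ∀ i ∈ Finset.range r,
      δ < κ ^ 2 * b i - κ * b i := by
    refine (Finset.eventually_all _).2 fun i hi => nhdsWithin_le_nhds (gt_mem_nhds ?_)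
    have := hb i (Finset.mem_range.1 hi)
    nlinarith
  have f2 : ∀ᶠ δ in nhdsWithin 0 (Set.Ioi (0 : ℝ)), ∀ i ∈ Finset.range r,
      δ < a i / κ - a i / κ ^ 2 := by
    refine (Finset.eventually_all _).2 fun i hi => nhdsWithin_le_nhds (gt_mem_nhds ?_)
    linarith [d1 i (Finset.mem_range.1 hi)]
  obtain ⟨δ, hδ1, hδ2, hδ⟩ := (f1.and (f2.and self_mem_nhdsWithin)).exists
  have hδ : 0 < δ := hδ
  have gg : ∀ i, i < r → b i ≤ g := fun i hi =>
    (hbmono i (r - 1) (by omega) (by omega)).trans (le_max_left _ _)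
  refine ⟨fun i => a i / κ, fun i => κ * b i, fun j => κ ^ 2 * b (j - 1),
    fun j => κ ^ 3 * b (j - 1), fun j => a j / κ ^ 2, κ ^ 2 * g, m / κ ^ 2, δ, ?_,
    fun i hi => ⟨div_pos (ha i hi) hκ0, div_lt_self (ha i hi) hκ, ?_⟩⟩
  · constructor
    · exact hk
    · exact hkr
    · exact hδ
    · exact fun i hi => (mul_pos hκ0 (hb i hi)).le
    · intro i j hij hj
      have q1 := hδ1 i (Finset.mem_range.2 (by omega))
      have q2 := mul_le_mul_of_nonneg_left (hbmono i (j - 1) (by omega) (by omega))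
        (sq_nonneg κ)
      linarith
    · intro i j hj hji hi
      have q1 := hδ2 i (Finset.mem_range.2 hi)
      have q2 := div_le_div_of_nonneg_right (hamono j i hji hi) (sq_nonneg κ)
      linarith
    · exact fun j hj hjr => mul_lt_mul_of_pos_right hκ2 (hb _ (by omega))
    · exact fun j hj hjr => h1 j (Finset.mem_Ico.2 ⟨hj, hjr⟩)
    · exact fun j hj hjk => mul_le_mul_of_nonneg_left (hbmono _ _ (by omega) (by omega))
        (sq_nonneg κ)
    · exact h2.le
    · exact h3.le
    · have : 1 ≤ g := le_max_right _ _
      nlinarith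
    · intro i hi
      have q1 := hδ1 i (Finset.mem_range.2 hi)
      have q2 := mul_le_mul_of_nonneg_left (gg i hi) (sq_nonneg κ)
      linarith
    · exact h4
    · positivity
    · rw [div_le_one (by positivity)]
      have : m ≤ 1 := min_le_right _ _
      nlinarith
    · intro i hi
      have q1 := hδ2 i (Finset.mem_range.2 hi)
      have q2 := div_le_div_of_nonneg_right ((min_le_left _ _).trans (hamono 0 i (by omega) hi) :
        m ≤ a i) (sq_nonneg κ)
      linarith
    · exact h5.le
    · exact fun i hki hi => h6 i (Finset.mem_Ico.2 ⟨hki, hi⟩)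
    · exact fun i hi => h7 i (Finset.mem_range.2 hi)
  · have := hb i hi
    nlinarith

/-- Dichotomy of the sequence of seminorms `p` at rate `ρ`. -/
def DichotomyAt (p : ℕ → Seminorm ℝ E) (ρ : ℝ) : Prop :=
  ∃ (K θ : ℝ) (D : E →L[ℝ] E), 0 < K ∧ 0 < θ ∧ θ < 1 ∧ (∀ z, D (D z) = D z) ∧
    (∀ m j z, p (m + j) (D z) ≤ K * (ρ * θ) ^ j * p m z) ∧
    ∀ m j z, ρ ^ j * p m (z - D z) ≤ K * θ ^ j * p (m + j) z

/-- The vectors growing at most like `ρ ^ n`. -/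
def growthSpace (p : ℕ → Seminorm ℝ E) (ρ : ℝ) : Submodule ℝ E where
  carrier := {z | ∃ C, ∀ n, p n z ≤ C * ρ ^ n}
  add_mem' := by
    rintro x y ⟨C, hC⟩ ⟨C', hC'⟩
    exact ⟨C + C', fun n => (map_add_le_add _ _ _).trans (by linarith [hC n, hC' n])⟩
  zero_mem' := ⟨0, fun n => by simp⟩
  smul_mem' := by
    rintro c x ⟨C, hC⟩
    refine ⟨‖c‖ * C, fun n => ?_⟩
    rw [map_smul_eq_mul, mul_assoc]
    exact mul_le_mul_of_nonneg_left (hC n) (norm_nonneg c)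

theorem growthSpace_mono (p : ℕ → Seminorm ℝ E) {ρ ρ' : ℝ} (h0 : 0 ≤ ρ) (h : ρ ≤ ρ') :
    growthSpace p ρ ≤ growthSpace p ρ' := by
  rintro z ⟨C, hC⟩
  have hC0 : 0 ≤ C := by simpa using (apply_nonneg (p 0) z).trans (hC 0)
  exact ⟨C, fun n => (hC n).trans (by gcongr)⟩

theorem le_zero_of_le_mul_pow {x C κ : ℝ} (hκ0 : 0 ≤ κ) (hκ : κ < 1) (h : ∀ n : ℕ, x ≤ C * κ ^ n) :
    x ≤ 0 :=
  ge_of_tendsto' (by simpa using (tendsto_pow_atTop_nhds_zero_of_lt_one hκ0 hκ).const_mul C) h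

/-- Vectors of growth less than `ρ / θ` are fixed by the dichotomy projection. -/
theorem dichotomy_fixes {p : ℕ → Seminorm ℝ E} (hp : ∀ x, p 0 x = 0 → x = 0) {ρ ρ' K θ : ℝ}
    (hρ : 0 < ρ) (hρ' : ρ ≤ ρ') {D : E →L[ℝ] E} (hK : 0 < K) (hθ : 0 < θ)
    (hθρ : ρ' * θ < ρ)
    (hQ : ∀ m j z, ρ ^ j * p m (z - D z) ≤ K * θ ^ j * p (m + j) z) {z : E}
    (hz : z ∈ growthSpace p ρ') : D z = z := by
  obtain ⟨C, hC⟩ := hz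
  have hρ0 : 0 < ρ' := hρ.trans_le hρ'
  have key : ∀ n : ℕ, p 0 (z - D z) ≤ K * C * (ρ' * θ / ρ) ^ n := by
    intro n
    have h1 := hQ 0 n z
    rw [zero_add] at h1
    rw [div_pow, ← mul_div_assoc, le_div_iff₀ (by positivity), mul_pow]
    calc p 0 (z - D z) * ρ ^ n = ρ ^ n * p 0 (z - D z) := mul_comm _ _
      _ ≤ K * θ ^ n * p n z := h1
      _ ≤ K * θ ^ n * (C * ρ' ^ n) := by gcongr; exact hC n
      _ = _ := by ring
  have h0 := le_zero_of_le_mul_pow (by positivity) ((div_lt_one hρ).2 hθρ) key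
  exact (sub_eq_zero.1 (hp _ (le_antisymm h0 (apply_nonneg _ _)))).symm

theorem dichotomy_mem {p : ℕ → Seminorm ℝ E} {ρ K θ : ℝ} {D : E →L[ℝ] E}
    (hD : ∀ m j z, p (m + j) (D z) ≤ K * (ρ * θ) ^ j * p m z) (z : E) :
    D z ∈ growthSpace p (ρ * θ) :=
  ⟨K * p 0 z, fun n => by have := hD 0 n z; rw [zero_add] at this; linarith⟩

theorem growthSpace_eventually_eq {p : ℕ → Seminorm ℝ E} (hp : ∀ x, p 0 x = 0 → x = 0) {ρ : ℝ}
    (hρ : 0 < ρ) (h : DichotomyAt p ρ) :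
    ∀ᶠ ρ' in nhds ρ, growthSpace p ρ' = growthSpace p ρ := by
  obtain ⟨K, θ, D, hK, hθ, hθ1, hDD, hD, hQ⟩ := h
  have h1 : ρ * θ < ρ := by nlinarith
  have h2 : ρ < ρ / θ := by rw [lt_div_iff₀ hθ]; exact h1
  filter_upwards [Ioo_mem_nhds h1 h2] with ρ' hρ'
  have h3 : 0 < ρ' := (mul_pos hρ hθ).trans hρ'.1
  have h4 := (lt_div_iff₀ hθ).1 hρ'.2
  rcases le_total ρ ρ' with hle | hle
  · refine le_antisymm (fun z hz => ?_) (growthSpace_mono p hρ.le hle)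
    rw [← dichotomy_fixes hp hρ hle hK hθ h4 hQ hz]
    exact growthSpace_mono p (by positivity) h1.le (dichotomy_mem hD z)
  · refine le_antisymm (growthSpace_mono p h3.le hle) fun z hz => ?_
    rw [← dichotomy_fixes hp hρ le_rfl hK hθ h1 hQ hz]
    exact growthSpace_mono p (by positivity) hρ'.1.le (dichotomy_mem hD z)

theorem growthSpace_eq_of_ordConnected {p : ℕ → Seminorm ℝ E} (hp : ∀ x, p 0 x = 0 → x = 0)
    {s : Set ℝ} (hs : s.OrdConnected) (h : ∀ ρ ∈ s, 0 < ρ ∧ DichotomyAt p ρ) {ρ ρ' : ℝ} (hρ : ρ ∈ s)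
    (hρ' : ρ' ∈ s) : growthSpace p ρ = growthSpace p ρ' := by
  have : PreconnectedSpace s := Subtype.preconnectedSpace hs.isPreconnected
  have hl : IsLocallyConstant fun x : s => growthSpace p x :=
    (IsLocallyConstant.iff_eventually_eq _).2 fun x =>
      continuous_subtype_val.continuousAt.eventually
        (growthSpace_eventually_eq hp (h x x.2).1 (h x x.2).2)
  exact hl.apply_eq_of_preconnectedSpace ⟨ρ, hρ⟩ ⟨ρ', hρ'⟩

/-- The `j`-th spectral gap of the bands `[a i, b i]`, `i < r`. -/
def specGap (r : ℕ) (a b : ℕ → ℝ) (j : ℕ) : Set ℝ :=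
  {ρ | 0 < ρ ∧ (∀ i, i < j → b i < ρ) ∧ ∀ i, j ≤ i → i < r → ρ < a i}

theorem specGap_ordConnected (r : ℕ) (a b : ℕ → ℝ) (j : ℕ) : (specGap r a b j).OrdConnected :=
  ⟨fun _ hx _ hy _ hz => ⟨hx.1.trans_le hz.1, fun i hi => (hx.2.1 i hi).trans_le hz.1,
    fun i hi hr => hz.2.trans_lt (hy.2.2 i hi hr)⟩⟩

section Order

variable {r : ℕ} {a b : ℕ → ℝ} (hab : ∀ i, i < r → 0 < a i ∧ a i ≤ b i)
  (hord : ∀ i, i + 1 < r → b i < a (i + 1))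

include hab hord in
theorem bands_lt {i j : ℕ} (hij : i < j) (hj : j < r) : b i < a j := by
  induction j, hij using Nat.le_induction with
  | base => exact hord i hj
  | succ j hij ih => exact (ih (by omega)).trans ((hab j (by omega)).2.trans_lt (hord j hj))

include hab hord in
theorem exists_specGap_lt {i : ℕ} (hi : i < r) {c : ℝ} (hc : c < a i) :
    ∃ ρ ∈ specGap r a b i, c < ρ := by
  have hfin : ∀ᶠ ρ in nhdsWithin (a i) (Set.Iio (a i)), ∀ l ∈ Finset.range i, b l < ρ :=
    (Finset.eventually_all _).2 fun l hl => nhdsWithin_le_nhds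
      (lt_mem_nhds (bands_lt hab hord (Finset.mem_range.1 hl) hi))
  have h2 : ∀ᶠ ρ in nhdsWithin (a i) (Set.Iio (a i)), c < ρ := nhdsWithin_le_nhds (lt_mem_nhds hc)
  have h3 : ∀ᶠ ρ in nhdsWithin (a i) (Set.Iio (a i)), 0 < ρ :=
    nhdsWithin_le_nhds (lt_mem_nhds (hab i hi).1)
  obtain ⟨ρ, h1, h2, h3, h4⟩ := (hfin.and (h2.and (h3.and self_mem_nhdsWithin))).exists
  refine ⟨ρ, ⟨h3, fun l hl => h1 l (Finset.mem_range.2 hl), fun l hl hr => ?_⟩, h2⟩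
  have h4 : ρ < a i := h4
  rcases hl.eq_or_lt with rfl | hl
  · exact h4
  · exact h4.trans ((hab i hi).2.trans_lt (bands_lt hab hord hl hr))

include hab hord in
theorem exists_lt_specGap {i : ℕ} (hi : i < r) {c : ℝ} (hc : b i < c) :
    ∃ ρ ∈ specGap r a b (i + 1), ρ < c := by
  have hfin : ∀ᶠ ρ in nhdsWithin (b i) (Set.Ioi (b i)), ∀ l ∈ Finset.Ico (i + 1) r, ρ < a l :=
    (Finset.eventually_all _).2 fun l hl => nhdsWithin_le_nhds
      (gt_mem_nhds (bands_lt hab hord (Finset.mem_Ico.1 hl).1 (Finset.mem_Ico.1 hl).2))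
  have h2 : ∀ᶠ ρ in nhdsWithin (b i) (Set.Ioi (b i)), ρ < c := nhdsWithin_le_nhds (gt_mem_nhds hc)
  obtain ⟨ρ, h1, h2, h4⟩ := (hfin.and (h2.and self_mem_nhdsWithin)).exists
  have h4 : b i < ρ := h4
  refine ⟨ρ, ⟨(hab i hi).1.trans_le (hab i hi).2 |>.trans h4, fun l hl => ?_,
    fun l hl hr => h1 l (Finset.mem_Ico.2 ⟨hl, hr⟩)⟩, h2⟩
  rcases (Nat.lt_succ_iff.1 hl).eq_or_lt with rfl | hl
  · exact h4
  · exact (bands_lt hab hord hl hi).trans ((hab i hi).2.trans_lt h4)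

end Order

/-- Projections onto a flag adapted to the spectral bands, with uniform bounds. -/
structure FlagBounds (r : ℕ) (P : ℕ → E →L[ℝ] E) (p : ℕ → Seminorm ℝ E) (α β : ℕ → ℝ) (C : ℝ) :
    Prop where
  C_pos : 0 < C
  P_zero : ∀ x, P 0 x = 0
  P_top : ∀ x, P r x = x
  P_comp : ∀ i j x, i ≤ r → j ≤ r → P i (P j x) = P (min i j) x
  P_le : ∀ i n x, i ≤ r → p n (P i x) ≤ C * p n x
  up : ∀ i m j x, i < r → P (i + 1) x = x → p (m + j) x ≤ C * β i ^ j * p m x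
  low : ∀ i m j x, i < r → P i x = 0 → α i ^ j * p m x ≤ C * p (m + j) x

section Flag

variable {F : Type*} [NormedAddCommGroup F] [InnerProductSpace ℝ F]
  {p : ℕ → Seminorm ℝ F} {r : ℕ} {a b : ℕ → ℝ}

theorem exists_flag_spaces (hp : ∀ x, p 0 x = 0 → x = 0)
    (hgrow : ∃ K A : ℝ, 0 < K ∧ 1 ≤ A ∧ ∀ m j z,
      p (m + j) z ≤ K * A ^ j * p m z ∧ p m z ≤ K * A ^ j * p (m + j) z)
    (hr : 0 < r) (hab : ∀ i, i < r → 0 < a i ∧ a i ≤ b i) (hord : ∀ i, i + 1 < r → b i < a (i + 1))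
    (hdich : ∀ ρ, 0 < ρ → (∀ i, i < r → ρ < a i ∨ b i < ρ) → DichotomyAt p ρ) :
    ∃ W : ℕ → Submodule ℝ F, W 0 = ⊥ ∧ W r = ⊤ ∧ (∀ i j, i ≤ j → j ≤ r → W i ≤ W j) ∧
      ∀ j, j ≤ r → ∀ ρ ∈ specGap r a b j, DichotomyAt p ρ ∧ growthSpace p ρ = W j := by
  obtain ⟨K, A, hK, hA, hg⟩ := hgrow
  have hne : ∀ j, ∃ ρ, j ≤ r → ρ ∈ specGap r a b j := by
    intro j
    rcases lt_trichotomy j r with h | rfl | h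
    · obtain ⟨ρ, h1, -⟩ := exists_specGap_lt hab hord h (sub_one_lt (a j))
      exact ⟨ρ, fun _ => h1⟩
    · obtain ⟨ρ, h1, -⟩ := exists_lt_specGap hab hord (i := j - 1) (by omega)
        (lt_add_one (b (j - 1)))
      rw [Nat.sub_add_cancel (by omega)] at h1
      exact ⟨ρ, fun _ => h1⟩
    · exact ⟨0, fun h' => absurd h' (not_le.2 h)⟩
  choose g hgap using hne
  have hD : ∀ j ρ, ρ ∈ specGap r a b j → 0 < ρ ∧ DichotomyAt p ρ := fun j ρ hρ =>
    ⟨hρ.1, hdich ρ hρ.1 fun i hi => (lt_or_ge i j).elim (fun h => Or.inr (hρ.2.1 i h))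
      fun h => Or.inl (hρ.2.2 i h hi)⟩
  have heq : ∀ j ρ ρ', ρ ∈ specGap r a b j → ρ' ∈ specGap r a b j →
      growthSpace p ρ = growthSpace p ρ' := fun j ρ ρ' h h' =>
    growthSpace_eq_of_ordConnected hp (specGap_ordConnected r a b j) (hD j) h h'
  refine ⟨fun j => growthSpace p (g j), ?_, ?_, ?_, fun j hj ρ hρ =>
    ⟨(hD j ρ hρ).2, heq j _ _ hρ (hgap j hj)⟩⟩
  · have h0 := hgap 0 hr.le
    have h1 : min (g 0) (1 / (2 * A)) ∈ specGap r a b 0 :=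
      ⟨lt_min h0.1 (by positivity), fun i hi => absurd hi (Nat.not_lt_zero i),
        fun i hi hir => (min_le_left _ _).trans_lt (h0.2.2 i hi hir)⟩
    beta_reduce
    rw [heq 0 _ _ h0 h1, eq_bot_iff]
    intro z hz
    obtain ⟨C, hC⟩ := growthSpace_mono p h1.1.le (min_le_right _ _) hz
    refine hp z (le_antisymm (le_zero_of_le_mul_pow (C := K * C) (κ := 1 / 2) (by norm_num)
      (by norm_num) fun n => ?_) (apply_nonneg _ _))
    have h2 := (hg 0 n z).2
    rw [zero_add] at h2
    refine h2.trans ((mul_le_mul_of_nonneg_left (hC n) (by positivity)).trans_eq ?_)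
    rw [one_div, one_div, mul_inv, mul_pow, inv_pow A]
    have : A ^ n ≠ 0 := by positivity
    field_simp
  · have h0 := hgap r le_rfl
    have h1 : max (g r) A ∈ specGap r a b r :=
      ⟨h0.1.trans_le (le_max_left _ _), fun i hi => (h0.2.1 i hi).trans_le (le_max_left _ _),
        fun i hi hir => absurd hi (not_le.2 hir)⟩
    beta_reduce
    rw [heq r _ _ h0 h1, eq_top_iff]
    intro z _
    refine growthSpace_mono p (by positivity) (le_max_right _ _) ⟨K * p 0 z, fun n => ?_⟩
    have h2 := (hg 0 n z).1
    rw [zero_add] at h2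
    linarith
  · intro i j hij hj
    rcases hij.eq_or_lt with rfl | hij
    · exact le_rfl
    · have h1 := hgap i (hij.le.trans hj)
      have h2 := hgap j hj
      exact growthSpace_mono p h1.1.le
        ((h1.2.2 i le_rfl (hij.trans_le hj)).trans_le ((hab i (hij.trans_le hj)).2.trans
          (h2.2.1 i hij).le)).le

theorem exists_flagBounds [FiniteDimensional ℝ F] (hp : ∀ x, p 0 x = 0 → x = 0)
    (hgrow : ∃ K A : ℝ, 0 < K ∧ 1 ≤ A ∧ ∀ m j z,
      p (m + j) z ≤ K * A ^ j * p m z ∧ p m z ≤ K * A ^ j * p (m + j) z)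
    (hr : 0 < r) (hab : ∀ i, i < r → 0 < a i ∧ a i ≤ b i) (hord : ∀ i, i + 1 < r → b i < a (i + 1))
    (hdich : ∀ ρ, 0 < ρ → (∀ i, i < r → ρ < a i ∨ b i < ρ) → DichotomyAt p ρ) {α β : ℕ → ℝ}
    (hαβ : ∀ i, i < r → 0 < α i ∧ α i < a i ∧ b i < β i) :
    ∃ (P : ℕ → F →L[ℝ] F) (C : ℝ), FlagBounds r P p α β C := by
  obtain ⟨W, hW0, hWr, hWmono, hW⟩ := exists_flag_spaces hp hgrow hr hab hord hdich
  let P : ℕ → F →L[ℝ] F := fun j => (W j).starProjection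
  obtain ⟨c, hc, hcP⟩ : ∃ c, 0 < c ∧ ∀ j x, p 0 (P j x) ≤ c * p 0 x := by
    obtain ⟨c₁, h1, h1'⟩ := seminorm_bound (p 0)
    obtain ⟨c₂, h2, h2'⟩ := seminorm_lower_bound (p 0) hp
    refine ⟨c₁ * c₂, by positivity, fun j x => (h1' _).trans ?_⟩
    rw [mul_assoc]
    refine mul_le_mul_of_nonneg_left (le_trans ?_ (h2' x)) h1.le
    exact (ContinuousLinearMap.le_of_opNorm_le _ (W j).starProjection_norm_le x).trans_eq
      (one_mul _)
  have hcomp : ∀ i j x, i ≤ r → j ≤ r → P i (P j x) = P (min i j) x := by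
    intro i j x hi hj
    rcases le_total i j with h | h
    · rw [min_eq_left h]
      exact congrArg (· x) (Submodule.starProjection_comp_starProjection_of_le (hWmono i j h hj))
    · rw [min_eq_right h]
      exact Submodule.starProjection_eq_self_iff.2
        (hWmono j i h hi ((W j).starProjection_apply_mem x))
  have hmem : ∀ j x, x ∈ W j → P j x = x := fun j x hx => Submodule.starProjection_eq_self_iff.2 hx
  -- bounds coming from a single dichotomy
  have key : ∀ j, j ≤ r → ∀ ρ ∈ specGap r a b j, ∃ C, 0 < C ∧
      (∀ n x, p n (P j x) ≤ C * p n x) ∧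
      (∀ m l x, P j x = x → p (m + l) x ≤ C * ρ ^ l * p m x) ∧
      ∀ m l x, P j x = 0 → ρ ^ l * p m x ≤ C * p (m + l) x := by
    intro j hj ρ hρ
    obtain ⟨⟨K, θ, D, hK, hθ, hθ1, hDD, hD, hQ⟩, hgs⟩ := hW j hj ρ hρ
    have hρ0 := hρ.1
    have hDW : ∀ z, D z ∈ W j := fun z => hgs ▸
      growthSpace_mono p (mul_nonneg hρ0.le hθ.le) (by nlinarith) (dichotomy_mem hD z)
    have hWD : ∀ z ∈ W j, D z = z := fun z hz =>
      dichotomy_fixes hp hρ0 le_rfl hK hθ (by nlinarith) hQ (hgs ▸ hz)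
    have hθl : ∀ l : ℕ, θ ^ l ≤ 1 := fun l => pow_le_one₀ hθ.le hθ1.le
    have hPQ : ∀ n x, p n (P j (x - D x)) ≤ c * K ^ 2 * p n x := by
      intro n x
      have h1 := hD 0 n (P j (x - D x))
      rw [hWD _ ((W j).starProjection_apply_mem _), zero_add] at h1
      have h2 := hQ 0 n x
      rw [zero_add] at h2
      have h3 := hθl n
      calc p n (P j (x - D x)) ≤ K * (ρ * θ) ^ n * (c * p 0 (x - D x)) :=
            h1.trans (mul_le_mul_of_nonneg_left (hcP j _) (by positivity))
        _ = K * c * θ ^ n * (ρ ^ n * p 0 (x - D x)) := by rw [mul_pow]; ring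
        _ ≤ K * c * θ ^ n * (K * θ ^ n * p n x) := by gcongr
        _ ≤ K * c * 1 * (K * 1 * p n x) := by
            have := apply_nonneg (p n) x
            gcongr
        _ = _ := by ring
    have hP : ∀ n x, p n (P j x) ≤ (K + c * K ^ 2) * p n x := by
      intro n x
      have h1 : P j x = D x + P j (x - D x) := by
        rw [map_sub, hmem j _ (hDW x)]; abel
      have h2 := hD n 0 x
      simp only [add_zero, pow_zero, mul_one] at h2
      rw [h1, add_mul]
      exact (map_add_le_add _ _ _).trans (add_le_add h2 (hPQ n x))
    refine ⟨(1 + (K + c * K ^ 2)) * (1 + K), by positivity, fun n x => (hP n x).trans ?_,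
      fun m l x hx => ?_, fun m l x hx => ?_⟩
    · refine mul_le_mul_of_nonneg_right ?_ (apply_nonneg _ _)
      nlinarith [mul_pos hc (pow_pos hK 2), mul_pos (mul_pos hc (pow_pos hK 2)) hK, mul_pos hK hK]
    · have h1 := hD m l x
      rw [hWD x (hx ▸ (W j).starProjection_apply_mem x)] at h1
      refine h1.trans (mul_le_mul_of_nonneg_right ?_ (apply_nonneg _ _))
      rw [mul_pow]
      have h2 : K ≤ (1 + (K + c * K ^ 2)) * (1 + K) := by
        nlinarith [mul_pos hc (pow_pos hK 2), mul_pos (mul_pos hc (pow_pos hK 2)) hK,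
          mul_pos hK hK]
      calc K * (ρ ^ l * θ ^ l) ≤ K * (ρ ^ l * 1) := by gcongr; exact hθl l
        _ = K * ρ ^ l := by ring
        _ ≤ _ := by gcongr
    · have h1 : x = (x - D x) - P j (x - D x) := by
        rw [map_sub, hmem j _ (hDW x), hx]; abel
      have h2 := (map_sub_le_add (p m) (x - D x) (P j (x - D x))).trans
        (add_le_add_right (hP m (x - D x)) _)
      rw [← h1] at h2
      have h3 := hQ m l x
      have h4 := hθl l
      have h5 := apply_nonneg (p (m + l)) x
      calc ρ ^ l * p m x ≤ ρ ^ l * ((1 + (K + c * K ^ 2)) * p m (x - D x)) := by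
            gcongr; linarith
        _ = (1 + (K + c * K ^ 2)) * (ρ ^ l * p m (x - D x)) := by ring
        _ ≤ (1 + (K + c * K ^ 2)) * (K * 1 * p (m + l) x) := by
            refine mul_le_mul_of_nonneg_left (h3.trans ?_) (by positivity)
            gcongr
        _ ≤ _ := by
            rw [mul_one, ← mul_assoc]
            gcongr
            linarith
  have hsel : ∀ i, ∃ ρ ρ', i < r → ρ ∈ specGap r a b i ∧ α i < ρ ∧
      ρ' ∈ specGap r a b (i + 1) ∧ ρ' < β i := by
    intro i
    by_cases hi : i < r
    · obtain ⟨ρ, h1, h2⟩ := exists_specGap_lt hab hord hi (hαβ i hi).2.1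
      obtain ⟨ρ', h3, h4⟩ := exists_lt_specGap hab hord hi (hαβ i hi).2.2
      exact ⟨ρ, ρ', fun _ => ⟨h1, h2, h3, h4⟩⟩
    · exact ⟨0, 0, fun h => absurd h hi⟩
  have huni : ∀ i, ∃ C, 0 < C ∧ (i < r →
      (∀ n x, p n (P i x) ≤ C * p n x) ∧
      (∀ m j x, P (i + 1) x = x → p (m + j) x ≤ C * β i ^ j * p m x) ∧
      ∀ m j x, P i x = 0 → α i ^ j * p m x ≤ C * p (m + j) x) := by
    intro i
    by_cases hi : i < r
    · obtain ⟨ρ, ρ', hρ⟩ := hsel i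
      obtain ⟨h1, h2, h3, h4⟩ := hρ hi
      obtain ⟨C, hC, k1, k2, k3⟩ := key i hi.le ρ h1
      obtain ⟨C', hC', k1', k2', k3'⟩ := key (i + 1) hi ρ' h3
      have hα := (hαβ i hi).1
      have hρ' := h3.1
      refine ⟨max C C', lt_max_of_lt_left hC, fun _ => ⟨fun n x => (k1 n x).trans ?_,
        fun m j x hx => (k2' m j x hx).trans ?_, fun m j x hx => ?_⟩⟩
      · gcongr; exact le_max_left _ _
      · gcongr
        exact le_max_right _ _
      · calc α i ^ j * p m x ≤ ρ ^ j * p m x := by gcongr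
          _ ≤ C * p (m + j) x := k3 m j x hx
          _ ≤ _ := by gcongr; exact le_max_left _ _
    · exact ⟨1, one_pos, fun h => absurd h hi⟩
  choose C hC hCb using huni
  have hle : ∀ i, i < r → C i ≤ 1 + ∑ l ∈ Finset.range r, C l := fun i hi =>
    (Finset.single_le_sum (fun l _ => (hC l).le) (Finset.mem_range.2 hi)).trans (by linarith)
  have hpos : 0 ≤ ∑ l ∈ Finset.range r, C l := Finset.sum_nonneg fun l _ => (hC l).le
  have htop : ∀ x, P r x = x := fun x => hmem r x (hWr ▸ Submodule.mem_top)
  refine ⟨P, 1 + ∑ l ∈ Finset.range r, C l, ⟨by positivity, fun x => ?_, htop,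
    hcomp, fun i n x hi => ?_, fun i m j x hi hx => ?_, fun i m j x hi hx => ?_⟩⟩
  · exact (Submodule.mem_bot ℝ).1 (hW0 ▸ (W 0).starProjection_apply_mem x)
  · rcases hi.eq_or_lt with rfl | hi
    · rw [htop]
      have := apply_nonneg (p n) x
      nlinarith
    · exact ((hCb i hi).1 n x).trans
        (mul_le_mul_of_nonneg_right (hle i hi) (apply_nonneg _ _))
  · have hβ : 0 < β i := ((hab i hi).1.trans_le (hab i hi).2).trans (hαβ i hi).2.2
    exact ((hCb i hi).2.1 m j x hx).trans (mul_le_mul_of_nonneg_right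
      (mul_le_mul_of_nonneg_right (hle i hi) (by positivity)) (apply_nonneg _ _))
  · exact ((hCb i hi).2.2 m j x hx).trans
      (mul_le_mul_of_nonneg_right (hle i hi) (apply_nonneg _ _))

end Flag

/-- The weight comparing time `m` with the reference time `n`. -/
def bandWeight (α β : ℝ) (n m : ℕ) : ℝ := if n ≤ m then β⁻¹ ^ (m - n) else α ^ (n - m)

theorem bandWeight_pos {α β : ℝ} (hα : 0 < α) (hβ : 0 < β) (n m : ℕ) : 0 < bandWeight α β n m := by
  unfold bandWeight
  split_ifs <;> positivity

theorem bandWeight_self (α β : ℝ) (n : ℕ) : bandWeight α β n n = 1 := by simp [bandWeight]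

theorem bandWeight_low {α β : ℝ} (hβ : 0 < β) (hαβ : α ≤ β) (n m : ℕ) :
    α * bandWeight α β n m ≤ bandWeight α β (n + 1) m := by
  unfold bandWeight
  rcases lt_trichotomy n m with h | rfl | h
  · rw [if_pos h.le, if_pos (show n + 1 ≤ m from h), show m - n = (m - (n + 1)) + 1 by omega,
      pow_succ]
    have : α * β⁻¹ ≤ 1 := by rw [← div_eq_mul_inv]; exact (div_le_one hβ).2 hαβ
    calc α * (β⁻¹ ^ (m - (n + 1)) * β⁻¹) = (α * β⁻¹) * β⁻¹ ^ (m - (n + 1)) := by ring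
      _ ≤ 1 * β⁻¹ ^ (m - (n + 1)) := by gcongr
      _ = _ := one_mul _
  · simp
  · rw [if_neg (not_le.2 h), if_neg (by omega), show n + 1 - m = (n - m) + 1 by omega, pow_succ,
      mul_comm]

theorem bandWeight_up {α β : ℝ} (hα : 0 < α) (hβ : 0 < β) (hαβ : α ≤ β) (n m : ℕ) :
    bandWeight α β (n + 1) m ≤ β * bandWeight α β n m := by
  unfold bandWeight
  rcases lt_trichotomy n m with h | rfl | h
  · rw [if_pos h.le, if_pos (show n + 1 ≤ m from h), show m - n = (m - (n + 1)) + 1 by omega,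
      pow_succ]
    refine le_of_eq ?_
    field_simp
  · simpa using hαβ
  · rw [if_neg (not_le.2 h), if_neg (by omega), show n + 1 - m = (n - m) + 1 by omega, pow_succ,
      mul_comm]
    gcongr

section Adapted

variable {r : ℕ} {P : ℕ → E →L[ℝ] E} {p : ℕ → Seminorm ℝ E} {α β : ℕ → ℝ} {C : ℝ}

/-- The projection onto the `i`-th band. -/
def bandProj (P : ℕ → E →L[ℝ] E) (i : ℕ) : E →L[ℝ] E := P (i + 1) - P i

/-- The adapted seminorm of the `i`-th band at time `n`. -/
def adaptedSeminorm (P : ℕ → E →L[ℝ] E) (p : ℕ → Seminorm ℝ E) (α β : ℕ → ℝ) (i n : ℕ) :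
    Seminorm ℝ E :=
  ⨆ m, (bandWeight (α i) (β i) n m).toNNReal • (p m).comp (bandProj P i : E →ₗ[ℝ] E)

variable (h : FlagBounds r P p α β C) (hαβ : ∀ i, i < r → 0 < α i ∧ α i ≤ β i)

namespace FlagBounds

include h hαβ in
theorem weight_le {i : ℕ} (hi : i < r) (n m : ℕ) (x : E) :
    bandWeight (α i) (β i) n m * p m (bandProj P i x) ≤ C * p n (bandProj P i x) := by
  obtain ⟨hα, hle⟩ := hαβ i hi
  have hβ := hα.trans_le hle
  have h1 : P (i + 1) (bandProj P i x) = bandProj P i x := by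
    simp only [bandProj, sub_apply, map_sub]
    rw [h.P_comp _ _ _ hi hi, h.P_comp _ _ _ hi hi.le, min_self, min_eq_right (by omega)]
  have h2 : P i (bandProj P i x) = 0 := by
    simp only [bandProj, sub_apply, map_sub]
    rw [h.P_comp _ _ _ hi.le hi, h.P_comp _ _ _ hi.le hi.le, min_self, min_eq_left (by omega),
      sub_self]
  unfold bandWeight
  split_ifs with hnm
  · obtain ⟨j, rfl⟩ := Nat.exists_eq_add_of_le hnm
    have h3 := h.up i n j _ hi h1
    rw [Nat.add_sub_cancel_left, inv_pow, inv_mul_le_iff₀ (by positivity)]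
    linarith
  · obtain ⟨j, rfl⟩ := Nat.exists_eq_add_of_le (not_le.1 hnm).le
    rw [Nat.add_sub_cancel_left]
    exact h.low i m j _ hi h2

include h hαβ in
theorem bddAbove_adapted {i : ℕ} (hi : i < r) (n : ℕ) : BddAbove (Set.range fun m =>
    (bandWeight (α i) (β i) n m).toNNReal • (p m).comp (bandProj P i : E →ₗ[ℝ] E)) := by
  obtain ⟨hα, hle⟩ := hαβ i hi
  refine Seminorm.bddAbove_range_iff.2 fun x => ⟨C * p n (bandProj P i x), ?_⟩
  rintro _ ⟨m, rfl⟩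
  have := h.weight_le hαβ hi n m x
  simpa [NNReal.smul_def, Real.coe_toNNReal _ (bandWeight_pos hα (hα.trans_le hle) n m).le] using
    this

include h hαβ in
theorem le_adapted {i : ℕ} (hi : i < r) (n m : ℕ) (x : E) :
    bandWeight (α i) (β i) n m * p m (bandProj P i x) ≤ adaptedSeminorm P p α β i n x := by
  obtain ⟨hα, hle⟩ := hαβ i hi
  have h1 := le_ciSup (h.bddAbove_adapted hαβ hi n) m x
  change _ ≤ adaptedSeminorm P p α β i n x at h1
  simpa [NNReal.smul_def, Real.coe_toNNReal _ (bandWeight_pos hα (hα.trans_le hle) n m).le] using h1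

include h hαβ in
theorem adapted_le {i : ℕ} (hi : i < r) (n : ℕ) {x : E} {B : ℝ}
    (hB : ∀ m, bandWeight (α i) (β i) n m * p m (bandProj P i x) ≤ B) :
    adaptedSeminorm P p α β i n x ≤ B := by
  obtain ⟨hα, hle⟩ := hαβ i hi
  unfold adaptedSeminorm
  rw [Seminorm.iSup_apply (h.bddAbove_adapted hαβ hi n)]
  refine ciSup_le fun m => ?_
  simpa [NNReal.smul_def, Real.coe_toNNReal _ (bandWeight_pos hα (hα.trans_le hle) n m).le] using
    hB m

include h hαβ in
theorem proj_le_adapted {i : ℕ} (hi : i < r) (n : ℕ) (x : E) :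
    p n (bandProj P i x) ≤ adaptedSeminorm P p α β i n x := by
  simpa [bandWeight_self] using h.le_adapted hαβ hi n n x

include h hαβ in
theorem le_bandSup_adapted (n : ℕ) (x : E) :
    p n x ≤ r * bandSup (adaptedSeminorm P p α β) (Finset.range r) n x := by
  have hx : ∑ i ∈ Finset.range r, bandProj P i x = x := by
    simp only [bandProj, sub_apply]
    rw [Finset.sum_range_sub (fun i => P i x), h.P_top, h.P_zero, sub_zero]
  calc p n x = p n (∑ i ∈ Finset.range r, bandProj P i x) := by rw [hx]
    _ ≤ ∑ i ∈ Finset.range r, p n (bandProj P i x) :=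
        Finset.le_sum_of_subadditive (p n) (map_zero (p n)).le (map_add_le_add _) _ _
    _ ≤ ∑ i ∈ Finset.range r, bandSup (adaptedSeminorm P p α β) (Finset.range r) n x :=
        Finset.sum_le_sum fun i hi => (h.proj_le_adapted hαβ (Finset.mem_range.1 hi) n x).trans
          (le_bandSup _ hi n x)
    _ = _ := by simp

include h hαβ in
theorem bandSup_adapted_le (n : ℕ) (x : E) :
    bandSup (adaptedSeminorm P p α β) (Finset.range r) n x ≤ C * (2 * C) * p n x := by
  have hC := h.C_pos
  refine bandSup_le (by positivity) fun i hi => ?_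
  have hi := Finset.mem_range.1 hi
  refine h.adapted_le hαβ hi n fun m => (h.weight_le hαβ hi n m x).trans ?_
  rw [mul_assoc]
  refine mul_le_mul_of_nonneg_left ((map_sub_le_add (p n) _ _).trans ?_) hC.le
  exact (add_le_add (h.P_le (i + 1) n x hi) (h.P_le i n x hi.le)).trans_eq (by ring)

include h hαβ in
theorem bands (hp : ∀ n x, p n x = 0 → x = 0) : Bands r P (adaptedSeminorm P p α β) α β where
  P_zero := h.P_zero
  P_top := h.P_top
  P_comp i j x hi hj := h.P_comp i j x hi hj
  q_proj i n x hi := by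
    have h1 : bandProj P i (P (i + 1) x - P i x) = bandProj P i x := by
      simp only [bandProj, sub_apply, map_sub]
      rw [h.P_comp (i + 1) (i + 1) _ hi hi, h.P_comp (i + 1) i _ hi hi.le,
        h.P_comp i (i + 1) _ hi.le hi, h.P_comp i i _ hi.le hi.le, min_self, min_self,
        min_eq_right (Nat.le_succ i), min_eq_left (Nat.le_succ i), sub_self, sub_zero]
    refine le_antisymm (h.adapted_le hαβ hi n fun m => ?_) (h.adapted_le hαβ hi n fun m => ?_)
    · rw [h1]; exact h.le_adapted hαβ hi n m x
    · rw [← h1]; exact h.le_adapted hαβ hi n m _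
  low i n x hi := by
    obtain ⟨hα, hle⟩ := hαβ i hi
    rw [← le_div_iff₀' hα]
    refine h.adapted_le hαβ hi n fun m => ?_
    rw [le_div_iff₀' hα, ← mul_assoc]
    exact (mul_le_mul_of_nonneg_right (bandWeight_low (hα.trans_le hle) hle n m)
      (apply_nonneg _ _)).trans (h.le_adapted hαβ hi (n + 1) m x)
  up i n x hi := by
    obtain ⟨hα, hle⟩ := hαβ i hi
    refine h.adapted_le hαβ hi (n + 1) fun m =>
      (mul_le_mul_of_nonneg_right (bandWeight_up hα (hα.trans_le hle) hle n m)
      (apply_nonneg _ _)).trans ?_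
    rw [mul_assoc]
    exact mul_le_mul_of_nonneg_left (h.le_adapted hαβ hi n m x) (hα.trans_le hle).le
  definite n x hx := by
    refine hp n x (le_antisymm ((h.le_bandSup_adapted hαβ n x).trans ?_) (apply_nonneg _ _))
    refine mul_nonpos_of_nonneg_of_nonpos (Nat.cast_nonneg r)
      (bandSup_le le_rfl fun i hi => (hx i (Finset.mem_range.1 hi)).le)

end FlagBounds

end Adapted

theorem scale_apply {c : ℝ} (hc : c ≠ 0) (A : E ≃L[ℝ] E) (x : E) : scale c A x = c • A x := by
  simp only [scale, smulCLE, dif_neg hc, ContinuousLinearEquiv.trans_apply]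
  rfl

/-- The seminorm underlying a norm function. -/
def IsNormOn.seminorm {N : E → ℝ} (h : IsNormOn N) : Seminorm ℝ E :=
  Seminorm.of N h.2.2.2 fun c x => h.2.2.1 c x

theorem exists_frameSeminorm (T : ℝ → ℝ → (E ≃L[ℝ] E)) {N : ℝ → E → ℝ}
    (hN : ∀ t, 1 ≤ t → IsNormOn (N t)) :
    ∃ p : ℝ → Seminorm ℝ E, ∀ t, 1 ≤ t → ∀ z, p t z = N t (T t 1 z) :=
  ⟨fun t => (hN (max t 1) (le_max_right _ _)).seminorm.comp
    (T (max t 1) 1 : E →L[ℝ] E).toLinearMap, fun t ht z => by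
      simp [IsNormOn.seminorm, Seminorm.of, max_eq_left ht]
      rfl⟩

section Frame

variable {T : ℝ → ℝ → (E ≃L[ℝ] E)} {N : ℝ → E → ℝ} {p : ℝ → Seminorm ℝ E}
  (hp : ∀ t, 1 ≤ t → ∀ z, p t z = N t (T t 1 z))
  (hT : ∀ t r s : ℝ, 1 ≤ s → 1 ≤ r → 1 ≤ t → ∀ x : E, T t r (T r s x) = T t s x)

include hp hT in
theorem frame_growth (hd : CStrongPolyDichotomyWRT T N) : ∃ K a : ℝ, 0 < K ∧ 0 ≤ a ∧
    ∀ t s, 1 ≤ s → s ≤ t → ∀ z, p t z ≤ K * (t / s) ^ a * p s z ∧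
      p s z ≤ K * (t / s) ^ a * p t z := by
  obtain ⟨K, lam, a, hK, hl, hla, P, -, -, h⟩ := hd
  refine ⟨K, a, hK, hl.le.trans hla, fun t s hs hst z => ?_⟩
  have ht := hs.trans hst
  have h1 := (h t s hs hst (T s 1 z)).2.2.1
  have h2 := (h t s hs hst (T t 1 z)).2.2.2
  rw [hT t s 1 le_rfl hs ht] at h1
  rw [hT s t 1 le_rfl ht hs] at h2
  rw [hp t ht, hp s hs]
  exact ⟨h1, h2⟩

include hp hT in
theorem frame_dichotomyAt {τ : ℝ} (hd : τ ∉ SigmaPDc T N) (hN : ∀ t, 1 ≤ t → IsNormOn (N t)) :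
    DichotomyAt (fun n => p (2 ^ n)) (2 ^ τ) := by
  have hd := not_not.1 hd
  obtain ⟨K, lam, a, hK, hl, -, P, hPP, hPT, h⟩ := hd
  beta_reduce at hPT h
  have hpow : ∀ n : ℕ, (1 : ℝ) ≤ 2 ^ n := fun n => one_le_pow₀ one_le_two
  have h2 : (0 : ℝ) < 2 := two_pos
  have hcomm : ∀ t, 1 ≤ t → ∀ z, P t (T t 1 z) = T t 1 (P 1 z) := by
    intro t ht z
    have h1 := DFunLike.congr_fun (hPT t 1 le_rfl ht) z
    have hc : (t / 1) ^ (-τ) ≠ 0 := (Real.rpow_pos_of_pos (by positivity) _).ne'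
    simp only [ContinuousLinearMap.comp_apply, ContinuousLinearEquiv.coe_coe, scale_apply hc,
      map_smul] at h1
    exact smul_right_injective E hc h1
  have hrat : ∀ (m j : ℕ), ((2 : ℝ) ^ (m + j) / 2 ^ m) = 2 ^ j := fun m j => by
    rw [pow_add, mul_div_cancel_left₀ _ (by positivity)]
  have hrp : ∀ (j : ℕ) (x : ℝ), ((2 : ℝ) ^ j) ^ x = (2 ^ x) ^ j := fun j x => by
    rw [← Real.rpow_natCast_mul h2.le, mul_comm, Real.rpow_mul_natCast h2.le]
  refine ⟨K, 2 ^ (-lam), P 1, hK, by positivity,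
    Real.rpow_lt_one_of_one_lt_of_neg one_lt_two (by linarith),
    fun z => DFunLike.congr_fun (hPP 1 le_rfl) z, fun m j z => ?_, fun m j z => ?_⟩
  · have h1 := (h (2 ^ (m + j)) (2 ^ m) (hpow m) (pow_le_pow_right₀ one_le_two (by omega))
      (T (2 ^ m) 1 z)).1
    rw [hrat, hrp, hrp, scale_apply (by positivity), hcomm _ (hpow m),
      hT _ _ _ le_rfl (hpow m) (hpow _), (hN _ (hpow _)).2.2.1, ← hp _ (hpow _), ← hp _ (hpow _),
      abs_of_pos (by positivity), Real.rpow_neg h2.le τ, inv_pow,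
      inv_mul_le_iff₀ (by positivity)] at h1
    refine h1.trans_eq ?_
    rw [mul_pow]; ring
  · have h1 := (h (2 ^ (m + j)) (2 ^ m) (hpow m) (pow_le_pow_right₀ one_le_two (by omega))
      (T (2 ^ (m + j)) 1 z)).2.1
    have hinv : ((2 : ℝ) ^ m / 2 ^ (m + j)) ^ (-τ) = (2 ^ τ) ^ j := by
      rw [← hrp, ← hrat m j, Real.rpow_neg (by positivity), ← Real.inv_rpow (by positivity), inv_div]
    rw [hrat, hrp, hinv, scale_apply (by positivity), hcomm _ (hpow _), ← map_sub,
      hT _ _ _ le_rfl (hpow _) (hpow m), (hN _ (hpow _)).2.2.1, ← hp _ (hpow _), ← hp _ (hpow _),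
      abs_of_pos (by positivity)] at h1
    exact h1

include hp hT in
theorem frame_seq_growth (hd : CStrongPolyDichotomyWRT T N) : ∃ K A : ℝ, 0 < K ∧ 1 ≤ A ∧
    ∀ (m j : ℕ) z, p (2 ^ (m + j)) z ≤ K * A ^ j * p (2 ^ m) z ∧
      p (2 ^ m) z ≤ K * A ^ j * p (2 ^ (m + j)) z := by
  obtain ⟨K, a, hK, ha, h⟩ := frame_growth hp hT hd
  refine ⟨K, 2 ^ a, hK, Real.one_le_rpow one_le_two ha, fun m j z => ?_⟩
  have h1 := h (2 ^ (m + j)) (2 ^ m) (one_le_pow₀ one_le_two)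
    (pow_le_pow_right₀ one_le_two (by omega)) z
  rwa [pow_add, mul_div_cancel_left₀ _ (by positivity), ← Real.rpow_natCast_mul two_pos.le,
    mul_comm (j : ℝ), Real.rpow_mul_natCast two_pos.le, ← pow_add] at h1

end Frame

/-- Spectral bands of the evolution family in the moving frame. -/
theorem exists_bands {F : Type*} [NormedAddCommGroup F] [InnerProductSpace ℝ F]
    [FiniteDimensional ℝ F] {T : ℝ → ℝ → (F ≃L[ℝ] F)} {N : ℝ → F → ℝ} {p : ℝ → Seminorm ℝ F}
    (hp : ∀ t, 1 ≤ t → ∀ z, p t z = N t (T t 1 z))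
    (hT : ∀ t r s : ℝ, 1 ≤ s → 1 ≤ r → 1 ≤ t → ∀ x : F, T t r (T r s x) = T t s x)
    (hN : ∀ t, 1 ≤ t → IsNormOn (N t)) (hd : CStrongPolyDichotomyWRT T N)
    {r : ℕ} {a b : ℕ → ℝ} (hr : 0 < r) (hab : ∀ i, i < r → 0 < a i ∧ a i ≤ b i)
    (hord : ∀ i, i + 1 < r → b i < a (i + 1))
    (hspec : ∀ τ ∈ SigmaPDc T N, ∃ i, i < r ∧ Real.log (a i) / Real.log 2 ≤ τ ∧
      τ ≤ Real.log (b i) / Real.log 2) {α β : ℕ → ℝ}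
    (hαβ : ∀ i, i < r → 0 < α i ∧ α i < a i ∧ b i < β i) :
    ∃ (P : ℕ → F →L[ℝ] F) (q : ℕ → ℕ → Seminorm ℝ F) (C : ℝ), Bands r P q α β ∧ 0 < C ∧
      ∀ n x, p (2 ^ n) x ≤ C * bandSup q (Finset.range r) n x ∧
        bandSup q (Finset.range r) n x ≤ C * p (2 ^ n) x := by
  have hdef : ∀ (n : ℕ) x, p (2 ^ n) x = 0 → x = 0 := fun n x hx => by
    have h1 : (1 : ℝ) ≤ 2 ^ n := one_le_pow₀ one_le_two
    rw [hp _ h1, (hN _ h1).2.1] at hx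
    exact (T (2 ^ n) 1).map_eq_zero_iff.1 hx
  obtain ⟨P, C, h⟩ := exists_flagBounds (p := fun n => p (2 ^ n)) (hdef 0)
    (frame_seq_growth hp hT hd) hr hab hord (fun ρ hρ hgap => by
      have hlog2 : 0 < Real.log 2 := Real.log_pos one_lt_two
      have h1 : (2 : ℝ) ^ (Real.log ρ / Real.log 2) = ρ := by
        rw [Real.rpow_def_of_pos two_pos, mul_div_cancel₀ _ hlog2.ne', Real.exp_log hρ]
      rw [← h1]
      refine frame_dichotomyAt hp hT (fun hmem => ?_) hN
      obtain ⟨i, hi, h2, h3⟩ := hspec _ hmem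
      obtain ⟨h4, h5⟩ := hab i hi
      rw [div_le_div_iff_of_pos_right hlog2] at h2 h3
      have h6 := (Real.log_le_log_iff h4 hρ).1 h2
      have h7 := (Real.log_le_log_iff hρ (h4.trans_le h5)).1 h3
      rcases hgap i hi with h | h <;> linarith) hαβ
  have hαβ' : ∀ i, i < r → 0 < α i ∧ α i ≤ β i := fun i hi =>
    ⟨(hαβ i hi).1, (hαβ i hi).2.1.le.trans ((hab i hi).2.trans (hαβ i hi).2.2.le)⟩
  have hC := h.C_pos
  refine ⟨P, _, max r (C * (2 * C)), h.bands hαβ' hdef, lt_max_of_lt_right (by positivity),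
    fun n x => ⟨(h.le_bandSup_adapted hαβ' n x).trans ?_,
      (h.bandSup_adapted_le hαβ' n x).trans ?_⟩⟩
  · exact mul_le_mul_of_nonneg_right (le_max_left _ _) (apply_nonneg _ _)
  · exact mul_le_mul_of_nonneg_right (le_max_right _ _) (apply_nonneg _ _)

section Gronwall

open Set

private lemma gronwallBound_const_mul (m K x : ℝ) :
    gronwallBound m K m x = gronwallBound 1 K 1 x * m := by
  by_cases hK : K = 0
  · subst hK; simp only [gronwallBound_K0]; ring
  · simp only [gronwallBound_of_K_ne_0 hK]; field_simp

theorem gronwallBound_one_nonneg {K T : ℝ} (hK : 0 ≤ K) (hT : 0 ≤ T) :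
    0 ≤ gronwallBound 1 K 1 T := by
  have := gronwallBound_mono zero_le_one zero_le_one hK hT
  rw [gronwallBound_x0] at this
  linarith

/-- Grönwall's inequality to the right of the initial time, with a bound uniform in time. -/
theorem norm_le_of_norm_deriv_le_right {u u' : ℝ → E} {K T t₀ e : ℝ} (hK : 0 ≤ K)
    (he : 0 ≤ e)
    (hu : ∀ t ∈ Icc t₀ (t₀ + T), HasDerivWithinAt u (u' t) (Icc t₀ (t₀ + T)) t)
    (hb : ∀ t ∈ Icc t₀ (t₀ + T), ‖u' t‖ ≤ K * ‖u t‖ + e) :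
    ∀ t ∈ Icc t₀ (t₀ + T), ‖u t‖ ≤ gronwallBound 1 K 1 T * (‖u t₀‖ + e) := by
  intro t ht
  have h := norm_le_gronwallBound_of_norm_deriv_right_le (f := u) (f' := u') (δ := ‖u t₀‖ + e)
    (K := K) (ε := ‖u t₀‖ + e) (fun s hs => (hu s hs).continuousWithinAt)
    (fun s hs => (hu s ⟨hs.1, hs.2.le⟩).mono_of_mem_nhdsWithin (Icc_mem_nhdsGE_of_mem hs))
    (by linarith) (fun s hs => (hb s ⟨hs.1, hs.2.le⟩).trans (by linarith [norm_nonneg (u t₀)]))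
    t ht
  refine h.trans ?_
  rw [← gronwallBound_const_mul]
  exact gronwallBound_mono (by positivity) (by positivity) hK (by linarith [ht.2])

/-- Grönwall's inequality on both sides of the initial time, with a bound uniform in time. -/
theorem norm_le_of_norm_deriv_le {u u' : ℝ → E} {K T t₀ e : ℝ} (hK : 0 ≤ K) (hT : 0 ≤ T)
    (he : 0 ≤ e)
    (hu : ∀ t ∈ Icc (t₀ - T) (t₀ + T), HasDerivWithinAt u (u' t) (Icc (t₀ - T) (t₀ + T)) t)
    (hb : ∀ t ∈ Icc (t₀ - T) (t₀ + T), ‖u' t‖ ≤ K * ‖u t‖ + e) :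
    ∀ t ∈ Icc (t₀ - T) (t₀ + T), ‖u t‖ ≤ gronwallBound 1 K 1 T * (‖u t₀‖ + e) := by
  intro t ht
  rcases le_total t₀ t with h | h
  · have hsub : Icc t₀ (t₀ + T) ⊆ Icc (t₀ - T) (t₀ + T) := Icc_subset_Icc_left (by linarith)
    exact norm_le_of_norm_deriv_le_right hK he (fun s hs => (hu s (hsub hs)).mono hsub)
      (fun s hs => hb s (hsub hs)) t ⟨h, ht.2⟩
  · have hmem : ∀ s ∈ Icc t₀ (t₀ + T), 2 * t₀ - s ∈ Icc (t₀ - T) (t₀ + T) := by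
      rintro s ⟨h1, h2⟩; constructor <;> linarith
    have := norm_le_of_norm_deriv_le_right (u := fun s => u (2 * t₀ - s))
      (u' := fun s => - u' (2 * t₀ - s)) (t₀ := t₀) (T := T) hK he (fun s hs => by
        have h1 : HasDerivWithinAt (fun s : ℝ => 2 * t₀ - s) (-1) (Icc t₀ (t₀ + T)) s := by
          simpa using ((hasDerivAt_id s).const_sub (2 * t₀)).hasDerivWithinAt
        simpa [Function.comp_def] using (hu _ (hmem s hs)).scomp s h1 hmem)
      (fun s hs => by rw [norm_neg]; exact hb _ (hmem s hs)) (2 * t₀ - t)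
      ⟨by linarith, by linarith [ht.1]⟩
    simpa [two_mul] using this

end Gronwall

section GlobalSolution

open Set Metric

/-- Radial retraction onto the closed ball of radius `R`. -/
def radialRetract (R : ℝ) (x : E) : E := (R / max R ‖x‖) • x

theorem radialRetract_of_norm_le {R : ℝ} (hR : 0 < R) {x : E} (hx : ‖x‖ ≤ R) :
    radialRetract R x = x := by
  rw [radialRetract, max_eq_left hx, div_self hR.ne', one_smul]

theorem norm_radialRetract_le {R : ℝ} (hR : 0 < R) (x : E) :
    ‖radialRetract R x‖ ≤ R ∧ ‖radialRetract R x‖ ≤ ‖x‖ := by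
  have hm : 0 < max R ‖x‖ := lt_max_of_lt_left hR
  rw [radialRetract, norm_smul, Real.norm_of_nonneg (by positivity), div_mul_eq_mul_div]
  constructor
  · rw [div_le_iff₀ hm]; gcongr; exact le_max_right _ _
  · rw [div_le_iff₀ hm, mul_comm]; gcongr; exact le_max_left _ _

theorem lipschitzWith_radialRetract {R : ℝ} (hR : 0 < R) :
    LipschitzWith 2 (radialRetract R : E → E) := by
  refine LipschitzWith.of_dist_le_mul fun x y => ?_
  have hx : 0 < max R ‖x‖ := lt_max_of_lt_left hR
  have hy : 0 < max R ‖y‖ := lt_max_of_lt_left hR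
  have hdiff : |max R ‖y‖ - max R ‖x‖| ≤ ‖x - y‖ := by
    have := abs_max_sub_max_le_max R ‖y‖ R ‖x‖
    rw [sub_self, abs_zero, max_eq_right (abs_nonneg (‖y‖ - ‖x‖))] at this
    exact this.trans ((abs_norm_sub_norm_le y x).trans_eq (norm_sub_rev _ _))
  have key : radialRetract R x - radialRetract R y
      = (R / max R ‖x‖) • (x - y)
        + (R / max R ‖x‖ * ((max R ‖y‖ - max R ‖x‖) / max R ‖y‖)) • y := by
    simp only [radialRetract]
    rw [smul_sub, sub_add, ← sub_smul]
    congr 2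
    field_simp
    ring
  have h1 : R / max R ‖x‖ ≤ 1 := (div_le_one hx).2 (le_max_left _ _)
  have h0 : 0 ≤ R / max R ‖x‖ := by positivity
  have h2 : ‖y‖ / max R ‖y‖ ≤ 1 := (div_le_one hy).2 (le_max_right _ _)
  rw [dist_eq_norm, dist_eq_norm, key]
  refine (norm_add_le _ _).trans ?_
  rw [norm_smul, norm_smul, norm_mul, Real.norm_of_nonneg h0, norm_div, Real.norm_eq_abs (_ - _),
    Real.norm_of_nonneg hy.le]
  have e : R / max R ‖x‖ * (|max R ‖y‖ - max R ‖x‖| / max R ‖y‖) * ‖y‖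
      = R / max R ‖x‖ * |max R ‖y‖ - max R ‖x‖| * (‖y‖ / max R ‖y‖) := by ring
  rw [e]
  have b1 : R / max R ‖x‖ * ‖x - y‖ ≤ 1 * ‖x - y‖ := by gcongr
  have b2 : R / max R ‖x‖ * |max R ‖y‖ - max R ‖x‖| * (‖y‖ / max R ‖y‖)
      ≤ 1 * ‖x - y‖ * 1 := by gcongr
  push_cast
  linarith

/-- A time dependent vector field that is jointly continuous and Lipschitz in space, locally
uniformly in time. -/
structure LipschitzField (v : ℝ → E → E) : Prop where
  continuous : Continuous fun p : ℝ × E => v p.1 p.2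
  lipschitz : ∀ t₀ T : ℝ, ∃ K : NNReal, ∀ t ∈ Icc (t₀ - T) (t₀ + T), LipschitzWith K (v t)

/-- `u` solves the equation `x' = v(t, x)` on the whole line. -/
def Solves (v : ℝ → E → E) (u : ℝ → E) : Prop := ∀ t, HasDerivAt u (v t (u t)) t

theorem LipschitzField.exists_solution_Icc [CompleteSpace E] {v : ℝ → E → E}
    (hv : LipschitzField v) (t₀ : ℝ) (x : E) {T : ℝ} (hT : 0 ≤ T) :
    ∃ u : ℝ → E, u t₀ = x ∧ ∀ t ∈ Icc (t₀ - T) (t₀ + T),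
      HasDerivWithinAt u (v t (u t)) (Icc (t₀ - T) (t₀ + T)) t := by
  obtain ⟨K, hK⟩ := hv.lipschitz t₀ T
  obtain ⟨M, hM⟩ := (isCompact_Icc (a := t₀ - T) (b := t₀ + T)).exists_bound_of_continuousOn
    (f := fun t => v t 0)
    (hv.continuous.comp (continuous_id.prodMk continuous_const)).continuousOn
  have ht₀ : t₀ ∈ Icc (t₀ - T) (t₀ + T) := ⟨by linarith, by linarith⟩
  have hM0 : 0 ≤ M := (norm_nonneg _).trans (hM t₀ ht₀)
  set c := gronwallBound 1 K 1 T with hc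
  have hc0 : 0 ≤ c := gronwallBound_one_nonneg K.coe_nonneg hT
  set R := c * (‖x‖ + M) + 1 with hR
  have hRpos : 0 < R := by positivity
  have hgrow : ∀ t ∈ Icc (t₀ - T) (t₀ + T), ∀ z, ‖v t z‖ ≤ K * ‖z‖ + M := fun t ht z => by
    have h1 := (hK t ht).dist_le_mul z 0
    rw [dist_eq_norm, dist_zero_right] at h1
    calc ‖v t z‖ = ‖(v t z - v t 0) + v t 0‖ := by rw [sub_add_cancel]
      _ ≤ K * ‖z‖ + M := (norm_add_le _ _).trans (add_le_add h1 (hM t ht))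
  have hw : ∀ t ∈ Icc (t₀ - T) (t₀ + T), ∀ z, ‖v t (radialRetract R z)‖ ≤ K * R + M :=
    fun t ht z => (hgrow t ht _).trans (by gcongr; exact (norm_radialRetract_le hRpos z).1)
  let B : NNReal := ⟨K * R + M, by positivity⟩
  have hPL : IsPicardLindelof (fun t z => v t (radialRetract R z))
      (⟨t₀, ht₀⟩ : Icc (t₀ - T) (t₀ + T)) x (B * ⟨T, hT⟩) 0 B (K * 2) :=
    { lipschitzOnWith := fun t ht =>
        ((hK t ht).comp (lipschitzWith_radialRetract hRpos)).lipschitzOnWith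
      continuousOn := fun z _ =>
        (hv.continuous.comp (continuous_id.prodMk continuous_const)).continuousOn
      norm_le := fun t ht z _ => hw t ht z
      mul_max_le := by simp [B]; rfl }
  obtain ⟨u, hu0, hu⟩ := hPL.exists_eq_forall_mem_Icc_hasDerivWithinAt (x := x) (by simp)
  have hu0' : u t₀ = x := hu0
  have hbound := norm_le_of_norm_deriv_le (u := u) K.coe_nonneg hT hM0 hu (fun t ht =>
    (hgrow t ht _).trans
      (add_le_add_left (mul_le_mul_of_nonneg_left (norm_radialRetract_le hRpos (u t)).2 K.coe_nonneg) M))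
  refine ⟨u, hu0', fun t ht => ?_⟩
  have h1 := hbound t ht
  rw [hu0'] at h1
  have h2 := hu t ht
  rwa [radialRetract_of_norm_le hRpos (h1.trans (by linarith))] at h2

theorem LipschitzField.eqOn {v : ℝ → E → E} (hv : LipschitzField v) {t₀ T : ℝ} (hT : 0 ≤ T)
    {u w : ℝ → E}
    (hu : ∀ t ∈ Icc (t₀ - T) (t₀ + T), HasDerivWithinAt u (v t (u t)) (Icc (t₀ - T) (t₀ + T)) t)
    (hw : ∀ t ∈ Icc (t₀ - T) (t₀ + T), HasDerivWithinAt w (v t (w t)) (Icc (t₀ - T) (t₀ + T)) t)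
    (h : u t₀ = w t₀) : EqOn u w (Icc (t₀ - T) (t₀ + T)) := by
  obtain ⟨K, hK⟩ := hv.lipschitz t₀ T
  intro t ht
  have := norm_le_of_norm_deriv_le (u := fun t => u t - w t) K.coe_nonneg hT le_rfl
    (fun s hs => (hu s hs).sub (hw s hs)) (fun s hs => by
      have := (hK s hs).dist_le_mul (u s) (w s)
      rw [dist_eq_norm, dist_eq_norm] at this
      rw [add_zero]; exact this) t ht
  rw [h, sub_self, norm_zero, add_zero, mul_zero, norm_le_zero_iff] at this
  exact sub_eq_zero.1 this

theorem LipschitzField.solution_ext {v : ℝ → E → E} (hv : LipschitzField v) {t₀ : ℝ}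
    {u w : ℝ → E} (hu : Solves v u) (hw : Solves v w) (h : u t₀ = w t₀) (t : ℝ) : u t = w t :=
  hv.eqOn (T := |t - t₀|) (abs_nonneg _) (fun s _ => (hu s).hasDerivWithinAt)
    (fun s _ => (hw s).hasDerivWithinAt) h
    ⟨by linarith [neg_abs_le (t - t₀)], by linarith [le_abs_self (t - t₀)]⟩

theorem LipschitzField.exists_solution [CompleteSpace E] {v : ℝ → E → E}
    (hv : LipschitzField v) (t₀ : ℝ) (x : E) : ∃ u : ℝ → E, u t₀ = x ∧ Solves v u := by
  choose! u hu0 hu using fun (T : ℝ) (hT : 0 ≤ T) => hv.exists_solution_Icc t₀ x hT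
  have hagree : ∀ S T, 0 ≤ S → S ≤ T → EqOn (u S) (u T) (Icc (t₀ - S) (t₀ + S)) :=
    fun S T hS hST => hv.eqOn hS (hu S hS) (fun t ht => by
      have hsub : Icc (t₀ - S) (t₀ + S) ⊆ Icc (t₀ - T) (t₀ + T) :=
        Icc_subset_Icc (by linarith) (by linarith)
      exact (hu T (hS.trans hST) t (hsub ht)).mono hsub) (by
        rw [hu0 S hS, hu0 T (hS.trans hST)])
  have hin : ∀ t, t ∈ Icc (t₀ - |t - t₀|) (t₀ + |t - t₀|) := fun t =>
    ⟨by linarith [neg_abs_le (t - t₀)], by linarith [le_abs_self (t - t₀)]⟩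
  refine ⟨fun t => u |t - t₀| t, by simp [hu0 0 le_rfl], fun t => ?_⟩
  set S := |t - t₀| + 1 with hS
  have hS0 : 0 ≤ S := by positivity
  have hnhds : Icc (t₀ - S) (t₀ + S) ∈ nhds t :=
    Icc_mem_nhds (by linarith [neg_abs_le (t - t₀)]) (by linarith [le_abs_self (t - t₀)])
  have heq : ∀ s ∈ Icc (t₀ - S) (t₀ + S), u |s - t₀| s = u S s := fun s hs =>
    hagree _ _ (abs_nonneg _) (abs_le.2 ⟨by linarith [hs.1], by linarith [hs.2]⟩) (hin s)
  have h1 := (hu S hS0 t (mem_of_mem_nhds hnhds)).hasDerivAt hnhds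
  rw [← heq t (mem_of_mem_nhds hnhds)] at h1
  exact h1.congr_of_eventuallyEq (Filter.eventually_of_mem hnhds heq)

end GlobalSolution

section Flow

open Set Metric

variable [CompleteSpace E]

/-- The solution of `x' = v(t, x)` with initial value `x` at time `t₀`. -/
def LipschitzField.flow {v : ℝ → E → E} (hv : LipschitzField v) (t₀ : ℝ) (x : E) : ℝ → E :=
  Classical.choose (hv.exists_solution t₀ x)

variable {v : ℝ → E → E}

theorem LipschitzField.flow_init (hv : LipschitzField v) (t₀ : ℝ) (x : E) :
    hv.flow t₀ x t₀ = x := (Classical.choose_spec (hv.exists_solution t₀ x)).1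

theorem LipschitzField.flow_solves (hv : LipschitzField v) (t₀ : ℝ) (x : E) :
    Solves v (hv.flow t₀ x) := (Classical.choose_spec (hv.exists_solution t₀ x)).2

theorem LipschitzField.flow_eq (hv : LipschitzField v) {u : ℝ → E} (hu : Solves v u)
    (s t : ℝ) : hv.flow s (u s) t = u t :=
  hv.solution_ext (hv.flow_solves s (u s)) hu (hv.flow_init s (u s)) t

theorem LipschitzField.flow_lipschitz (hv : LipschitzField v) (t₀ T : ℝ) (hT : 0 ≤ T) :
    ∃ c : ℝ, 0 ≤ c ∧ ∀ t ∈ Icc (t₀ - T) (t₀ + T), ∀ x y,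
      ‖hv.flow t₀ x t - hv.flow t₀ y t‖ ≤ c * ‖x - y‖ := by
  obtain ⟨K, hK⟩ := hv.lipschitz t₀ T
  refine ⟨gronwallBound 1 K 1 T, gronwallBound_one_nonneg K.coe_nonneg hT, fun t ht x y => ?_⟩
  have := norm_le_of_norm_deriv_le (u := fun t => hv.flow t₀ x t - hv.flow t₀ y t)
    K.coe_nonneg hT le_rfl
    (fun s hs => ((hv.flow_solves t₀ x s).sub (hv.flow_solves t₀ y s)).hasDerivWithinAt)
    (fun s hs => by
      have := (hK s hs).dist_le_mul (hv.flow t₀ x s) (hv.flow t₀ y s)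
      rw [dist_eq_norm, dist_eq_norm] at this
      rw [add_zero]; exact this) t ht
  simpa only [hv.flow_init, add_zero] using this

/-- A map on `ℝ × F` continuous in time, and continuous in space locally uniformly in time, is
jointly continuous. -/
theorem continuous_uncurry_of_locally_uniform {F G : Type*} [TopologicalSpace F]
    [SeminormedAddCommGroup G] {u : ℝ → F → G} (ht : ∀ x, Continuous fun t => u t x)
    (hx : ∀ t₀ : ℝ, ∀ x : F, ∀ e > 0, ∀ᶠ y in nhds x, ∀ t ∈ Icc (t₀ - 1) (t₀ + 1),
      ‖u t y - u t x‖ ≤ e) : Continuous fun p : ℝ × F => u p.1 p.2 := by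
  refine continuous_iff_continuousAt.2 fun ⟨t₀, x⟩ => ?_
  refine Metric.tendsto_nhds.2 fun e he => ?_
  have h1 := hx t₀ x (e / 2) (by positivity)
  have h2 := Metric.tendsto_nhds.1 ((ht x).continuousAt (x := t₀)) (e / 2) (by positivity)
  have h3 : ∀ᶠ t in nhds t₀, t ∈ Icc (t₀ - 1) (t₀ + 1) :=
    Icc_mem_nhds (by linarith) (by linarith)
  rw [nhds_prod_eq]
  filter_upwards [(h2.and h3).prod_mk h1] with ⟨t, y⟩ ⟨⟨ha, hb⟩, hc⟩
  have := hc t hb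
  rw [← dist_eq_norm] at this
  calc dist (u t y) (u t₀ x) ≤ dist (u t y) (u t x) + dist (u t x) (u t₀ x) :=
        dist_triangle _ _ _
    _ < e := by linarith

theorem Icc_one_subset (s t₀ : ℝ) :
    Icc (s - 1) (s + 1) ⊆ Icc (t₀ - (|s - t₀| + 1)) (t₀ + (|s - t₀| + 1)) :=
  Icc_subset_Icc (by linarith [neg_abs_le (s - t₀)]) (by linarith [le_abs_self (s - t₀)])

theorem LipschitzField.continuous_flow (hv : LipschitzField v) (t₀ : ℝ) :
    Continuous fun p : ℝ × E => hv.flow t₀ p.2 p.1 := by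
  refine continuous_uncurry_of_locally_uniform (u := fun t x => hv.flow t₀ x t)
    (fun x => continuous_iff_continuousAt.2 fun t => (hv.flow_solves t₀ x t).continuousAt)
    fun s x e he => ?_
  obtain ⟨c, hc, h⟩ := hv.flow_lipschitz t₀ (|s - t₀| + 1) (by positivity)
  filter_upwards [ball_mem_nhds x (show 0 < e / (c + 1) by positivity)] with y hy t ht
  rw [mem_ball, dist_eq_norm, lt_div_iff₀ (by positivity)] at hy
  exact (h t (Icc_one_subset s t₀ ht) y x).trans (by nlinarith [norm_nonneg (y - x)])

/-- A time dependent vector field with jointly continuous space derivative that is bounded,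
locally uniformly in time. -/
structure SmoothField (v : ℝ → E → E) : Prop where
  continuous : Continuous fun p : ℝ × E => v p.1 p.2
  differentiable : ∀ t, Differentiable ℝ (v t)
  continuous_fderiv : Continuous fun p : ℝ × E => fderiv ℝ (v p.1) p.2
  bounded : ∀ t₀ T : ℝ, ∃ K : NNReal, ∀ t ∈ Icc (t₀ - T) (t₀ + T), ∀ z, ‖fderiv ℝ (v t) z‖ ≤ K

namespace SmoothField

omit [CompleteSpace E] in
theorem lipschitzField (hv : SmoothField v) : LipschitzField v where
  continuous := hv.continuous
  lipschitz t₀ T := by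
    obtain ⟨K, hK⟩ := hv.bounded t₀ T
    exact ⟨K, fun t ht => lipschitzWith_of_nnnorm_fderiv_le (hv.differentiable t) (hK t ht)⟩

/-- The linear vector field of the variational equation along a solution. -/
theorem variational (hv : SmoothField v) (t₀ : ℝ) (x : E) :
    LipschitzField (fun t (X : E →L[ℝ] E) =>
      (fderiv ℝ (v t) (hv.lipschitzField.flow t₀ x t)).comp X) where
  continuous := by
    have h1 : Continuous fun t => fderiv ℝ (v t) (hv.lipschitzField.flow t₀ x t) :=
      hv.continuous_fderiv.comp (continuous_id.prodMk
        (continuous_iff_continuousAt.2 fun t =>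
          (hv.lipschitzField.flow_solves t₀ x t).continuousAt))
    exact (h1.comp continuous_fst).clm_comp continuous_snd
  lipschitz s T := by
    obtain ⟨K, hK⟩ := hv.bounded s T
    refine ⟨K, fun t ht => LipschitzWith.of_dist_le_mul fun X Y => ?_⟩
    rw [dist_eq_norm, dist_eq_norm, ← ContinuousLinearMap.comp_sub]
    exact (ContinuousLinearMap.opNorm_comp_le _ _).trans (by gcongr; exact hK t ht _)

/-- The solution of the variational equation along a solution, starting at the identity. -/
def varFlow (hv : SmoothField v) (t₀ : ℝ) (x : E) : ℝ → E →L[ℝ] E :=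
  (hv.variational t₀ x).flow t₀ (ContinuousLinearMap.id ℝ E)

variable (hv : SmoothField v) (t₀ : ℝ)

theorem continuous_varFlow_time (x : E) : Continuous (hv.varFlow t₀ x) :=
  continuous_iff_continuousAt.2 fun t => ((hv.variational t₀ x).flow_solves t₀ _ t).continuousAt

theorem hasDerivAt_varFlow (x : E) (t : ℝ) : HasDerivAt (hv.varFlow t₀ x)
    ((fderiv ℝ (v t) (hv.lipschitzField.flow t₀ x t)).comp (hv.varFlow t₀ x t)) t :=
  (hv.variational t₀ x).flow_solves t₀ _ t

/-- The derivative of the field along nearby points is uniformly close to the derivative along a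
solution. -/
theorem eventually_fderiv_close (x : E) (T : ℝ) {e : ℝ} (he : 0 < e) :
    ∀ᶠ h in nhds (0 : E), ∀ t ∈ Icc (t₀ - T) (t₀ + T),
      ‖fderiv ℝ (v t) (hv.lipschitzField.flow t₀ x t + h)
        - fderiv ℝ (v t) (hv.lipschitzField.flow t₀ x t)‖ < e := by
  refine isCompact_Icc.eventually_forall_of_forall_eventually fun t _ => ?_
  have hφ : Continuous (hv.lipschitzField.flow t₀ x) :=
    continuous_iff_continuousAt.2 fun t => (hv.lipschitzField.flow_solves t₀ x t).continuousAt
  have hc : Continuous fun z : E × ℝ =>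
      ‖fderiv ℝ (v z.2) (hv.lipschitzField.flow t₀ x z.2 + z.1)
        - fderiv ℝ (v z.2) (hv.lipschitzField.flow t₀ x z.2)‖ :=
    ((hv.continuous_fderiv.comp (continuous_snd.prodMk
      ((hφ.comp continuous_snd).add continuous_fst))).sub
      (hv.continuous_fderiv.comp (continuous_snd.prodMk (hφ.comp continuous_snd)))).norm
  exact hc.continuousAt.eventually_lt continuousAt_const (by simpa using he)

theorem continuous_varFlow : Continuous fun p : ℝ × E => hv.varFlow t₀ p.2 p.1 := by
  refine continuous_uncurry_of_locally_uniform (u := fun t x => hv.varFlow t₀ x t)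
    (hv.continuous_varFlow_time t₀) fun s x e he => ?_
  set T := |s - t₀| + 1 with hT
  have hT0 : 0 ≤ T := by positivity
  obtain ⟨c, hc, hlip⟩ := hv.lipschitzField.flow_lipschitz t₀ T hT0
  obtain ⟨K, hK⟩ := hv.bounded t₀ T
  obtain ⟨B, hB⟩ := (isCompact_Icc (a := t₀ - T) (b := t₀ + T)).exists_bound_of_continuousOn
    (hv.continuous_varFlow_time t₀ x).continuousOn
  have hB0 : 0 ≤ B :=
    (norm_nonneg _).trans (hB t₀ ⟨by linarith, by linarith⟩)
  have hg := gronwallBound_one_nonneg K.coe_nonneg hT0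
  set g := gronwallBound 1 K 1 T
  set e' := e / ((g + 1) * (B + 1)) with he'
  have he0 : 0 < e' := by positivity
  obtain ⟨δ, hδ, hclose⟩ := Metric.eventually_nhds_iff.1
    (hv.eventually_fderiv_close t₀ x T he0)
  filter_upwards [ball_mem_nhds x (show 0 < δ / (c + 1) by positivity)] with y hy t ht
  rw [mem_ball, dist_eq_norm, lt_div_iff₀ (by positivity)] at hy
  have hA : ∀ r ∈ Icc (t₀ - T) (t₀ + T), ‖fderiv ℝ (v r) (hv.lipschitzField.flow t₀ y r)
      - fderiv ℝ (v r) (hv.lipschitzField.flow t₀ x r)‖ ≤ e' := fun r hr => by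
    have h1 := hlip r hr y x
    have := hclose (y := hv.lipschitzField.flow t₀ y r - hv.lipschitzField.flow t₀ x r)
      (by rw [dist_zero_right]; nlinarith [norm_nonneg (y - x)]) r hr
    rw [add_sub_cancel] at this
    exact this.le
  have := norm_le_of_norm_deriv_le (u := fun t => hv.varFlow t₀ y t - hv.varFlow t₀ x t)
    (e := e' * B) K.coe_nonneg hT0 (by positivity)
    (fun r _ => ((hv.hasDerivAt_varFlow t₀ y r).sub (hv.hasDerivAt_varFlow t₀ x r)).hasDerivWithinAt)
    (fun r hr => by
      have : (fderiv ℝ (v r) (hv.lipschitzField.flow t₀ y r)).comp (hv.varFlow t₀ y r)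
          - (fderiv ℝ (v r) (hv.lipschitzField.flow t₀ x r)).comp (hv.varFlow t₀ x r)
        = (fderiv ℝ (v r) (hv.lipschitzField.flow t₀ y r)).comp
            (hv.varFlow t₀ y r - hv.varFlow t₀ x r)
          + (fderiv ℝ (v r) (hv.lipschitzField.flow t₀ y r)
            - fderiv ℝ (v r) (hv.lipschitzField.flow t₀ x r)).comp (hv.varFlow t₀ x r) := by
        rw [ContinuousLinearMap.comp_sub, ContinuousLinearMap.sub_comp]; abel
      rw [this]
      refine (norm_add_le _ _).trans (add_le_add ?_ ?_)
      · exact (ContinuousLinearMap.opNorm_comp_le _ _).trans (by gcongr; exact hK r hr _)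
      · exact (ContinuousLinearMap.opNorm_comp_le _ _).trans
          (mul_le_mul (hA r hr) (hB r hr) (norm_nonneg _) he0.le))
    t (Icc_one_subset s t₀ ht)
  have hinit : hv.varFlow t₀ y t₀ - hv.varFlow t₀ x t₀ = 0 := by
    simp [varFlow, LipschitzField.flow_init]
  rw [hinit, norm_zero, zero_add] at this
  refine this.trans ?_
  change g * (e' * B) ≤ e
  have : (g + 1) * (e' * (B + 1)) = e := by rw [he']; field_simp
  rw [← this]
  gcongr <;> linarith

theorem hasFDerivAt_flow (x : E) (t : ℝ) :
    HasFDerivAt (fun y => hv.lipschitzField.flow t₀ y t) (hv.varFlow t₀ x t) x := by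
  set φ := hv.lipschitzField.flow t₀ with hφ
  set T := |t - t₀| + 1 with hT
  have hT0 : 0 ≤ T := by positivity
  have htT : t ∈ Icc (t₀ - T) (t₀ + T) :=
    Icc_one_subset t t₀ ⟨by linarith, by linarith⟩
  obtain ⟨c, hc, hlip⟩ := hv.lipschitzField.flow_lipschitz t₀ T hT0
  obtain ⟨K, hK⟩ := hv.bounded t₀ T
  have hg := gronwallBound_one_nonneg K.coe_nonneg hT0
  set g := gronwallBound 1 K 1 T with hgdef
  rw [hasFDerivAt_iff_isLittleO, Asymptotics.isLittleO_iff]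
  intro e he
  set e' := e / ((g + 1) * (c + 1)) with he'
  have he0 : 0 < e' := by positivity
  obtain ⟨δ, hδ, hclose⟩ := Metric.eventually_nhds_iff.1
    (hv.eventually_fderiv_close t₀ x T he0)
  filter_upwards [ball_mem_nhds x (show 0 < δ / (c + 1) by positivity)] with y hy
  rw [mem_ball, dist_eq_norm, lt_div_iff₀ (by positivity)] at hy
  have hrem : ∀ r ∈ Icc (t₀ - T) (t₀ + T), ‖v r (φ y r) - v r (φ x r)
      - fderiv ℝ (v r) (φ x r) (φ y r - φ x r)‖ ≤ e' * (c * ‖y - x‖) := fun r hr => by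
    have h1 := hlip r hr y x
    have hball : φ y r ∈ ball (φ x r) δ := by
      rw [mem_ball, dist_eq_norm]; nlinarith [norm_nonneg (y - x)]
    have := (convex_ball (φ x r) δ).norm_image_sub_le_of_norm_hasFDerivWithin_le'
      (f := v r) (f' := fun z => fderiv ℝ (v r) z) (φ := fderiv ℝ (v r) (φ x r)) (C := e')
      (fun z _ => (hv.differentiable r z).hasFDerivAt.hasFDerivWithinAt)
      (fun z hz => by
        have := hclose (y := z - φ x r)
          (by rw [dist_zero_right, ← dist_eq_norm]; exact hz) r hr
        rw [add_sub_cancel] at this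
        exact this.le)
      (mem_ball_self hδ) hball
    exact this.trans (by gcongr)
  have := norm_le_of_norm_deriv_le
    (u := fun r => φ y r - φ x r - hv.varFlow t₀ x r (y - x)) (t₀ := t₀)
    (e := e' * (c * ‖y - x‖)) K.coe_nonneg hT0 (by positivity)
    (fun r _ => (((hv.lipschitzField.flow_solves t₀ y r).sub
      (hv.lipschitzField.flow_solves t₀ x r)).sub
      ((hv.hasDerivAt_varFlow t₀ x r).clm_apply (hasDerivAt_const r (y - x)))).hasDerivWithinAt)
    (fun r hr => by
      rw [map_zero, add_zero]
      have : v r (φ y r) - v r (φ x r)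
          - ((fderiv ℝ (v r) (φ x r)).comp (hv.varFlow t₀ x r)) (y - x)
          = fderiv ℝ (v r) (φ x r) (φ y r - φ x r - hv.varFlow t₀ x r (y - x))
            + (v r (φ y r) - v r (φ x r) - fderiv ℝ (v r) (φ x r) (φ y r - φ x r)) := by
        rw [map_sub (fderiv ℝ (v r) (φ x r)) (φ y r - φ x r), ContinuousLinearMap.comp_apply]
        abel
      refine (le_of_eq (congrArg _ this)).trans ?_
      refine (norm_add_le _ _).trans (add_le_add ?_ (hrem r hr))
      exact (ContinuousLinearMap.le_opNorm _ _).trans (by gcongr; exact hK r hr _))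
    t htT
  have hinit : φ y t₀ - φ x t₀ - hv.varFlow t₀ x t₀ (y - x) = 0 := by
    simp [hφ, varFlow, LipschitzField.flow_init]
  rw [hinit, norm_zero, zero_add, ← hgdef] at this
  refine this.trans ?_
  have h2 : (g + 1) * (e' * ((c + 1) * ‖y - x‖)) = e * ‖y - x‖ := by rw [he']; field_simp
  rw [← h2]
  gcongr <;> linarith

theorem contDiff_flow : ContDiff ℝ 1 fun p : ℝ × E => hv.lipschitzField.flow t₀ p.2 p.1 := by
  have h1 : Continuous fun u : ℝ × E => ContinuousLinearMap.toSpanSingleton ℝ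
      (v u.1 (hv.lipschitzField.flow t₀ u.2 u.1)) :=
    (ContinuousLinearMap.toSpanSingletonLIE ℝ E).continuous.comp
      (hv.continuous.comp (continuous_fst.prodMk (hv.lipschitzField.continuous_flow t₀)))
  have h2 := hv.continuous_varFlow t₀
  refine contDiff_one_iff_hasFDerivAt.2 ⟨fun u => (ContinuousLinearMap.toSpanSingleton ℝ
    (v u.1 (hv.lipschitzField.flow t₀ u.2 u.1))).coprod (hv.varFlow t₀ u.2 u.1), ?_, fun u =>
    (hasStrictFDerivAt_uncurry_coprod
      (f := fun t x => hv.lipschitzField.flow t₀ x t)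
      (f₁ := fun t x => ContinuousLinearMap.toSpanSingleton ℝ
        (v t (hv.lipschitzField.flow t₀ x t)))
      (f₂ := fun t x => hv.varFlow t₀ x t) (u := u)
      (Filter.Eventually.of_forall fun p =>
        (hv.lipschitzField.flow_solves t₀ p.2 p.1).hasFDerivAt)
      (Filter.Eventually.of_forall fun p => hv.hasFDerivAt_flow t₀ p.2 p.1)
      h1.continuousAt h2.continuousAt).hasFDerivAt⟩
  exact (ContinuousLinearMap.coprodEquivL (𝕜 := ℝ) (E := ℝ) (F := E) (G := E) ℝ).continuous.comp (h1.prodMk h2)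

theorem varFlow_injective (x : E) (t : ℝ) {h : E} (h0 : hv.varFlow t₀ x t h = 0) : h = 0 := by
  have hlin : LipschitzField fun t (z : E) => fderiv ℝ (v t) (hv.lipschitzField.flow t₀ x t) z :=
    { continuous :=
        ((hv.continuous_fderiv.comp (continuous_id.prodMk (continuous_iff_continuousAt.2 fun t =>
          (hv.lipschitzField.flow_solves t₀ x t).continuousAt))).comp continuous_fst).clm_apply
          continuous_snd
      lipschitz := fun s T => by
        obtain ⟨K, hK⟩ := hv.bounded s T
        exact ⟨K, fun t ht => (ContinuousLinearMap.lipschitz _).weaken (hK t ht _)⟩ }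
  have := hlin.solution_ext (t₀ := t) (u := fun s => hv.varFlow t₀ x s h) (w := fun _ => 0)
    (fun s => by
      simpa using (hv.hasDerivAt_varFlow t₀ x s).clm_apply (hasDerivAt_const s h))
    (fun s => by simpa using hasDerivAt_const s (0 : E)) h0 t₀
  simpa [varFlow, LipschitzField.flow_init] using this

theorem contDiff_flow_inverse [FiniteDimensional ℝ E] :
    ContDiff ℝ 1 fun p : ℝ × E => hv.lipschitzField.flow p.1 p.2 t₀ := by
  have hF : ContDiff ℝ 1 fun p : ℝ × E => (p.1, hv.lipschitzField.flow t₀ p.2 p.1) :=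
    contDiff_fst.prodMk (hv.contDiff_flow t₀)
  have hG : ContDiff ℝ 1 fun p : ℝ × E => (p.1, hv.lipschitzField.flow p.1 p.2 t₀) := by
    refine contDiff_inverse_of_bijective hF (fun p => ?_) (fun p => ?_) fun p h hp => ?_
    · simp only [hv.lipschitzField.flow_eq (hv.lipschitzField.flow_solves t₀ p.2) p.1 t₀,
        LipschitzField.flow_init]
    · simp only [hv.lipschitzField.flow_eq (hv.lipschitzField.flow_solves p.1 p.2) t₀ p.1,
        LipschitzField.flow_init]
    · have hd := (hF.differentiable one_ne_zero p).hasFDerivAt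
      have h1 : h.1 = 0 := by
        have := hd.fst.unique hasFDerivAt_fst
        have h2 := congrArg (fun l : ℝ × E →L[ℝ] ℝ => l h) this
        simpa [hp] using h2.symm
      have h2 := hd.snd.comp p.2 (hasFDerivAt_prodMk_right (𝕜 := ℝ) p.1 p.2)
      have h3 := h2.unique (hv.hasFDerivAt_flow t₀ p.2 p.1)
      have h4 : h = (0, h.2) := Prod.ext h1 rfl
      have h5 := congrArg (fun l : E →L[ℝ] E => l h.2) h3
      simp only [ContinuousLinearMap.comp_apply, ContinuousLinearMap.inr_apply, ← h4, hp] at h5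
      exact Prod.ext h1 (hv.varFlow_injective t₀ p.2 p.1 (by simpa using h5.symm))
  exact contDiff_snd.comp hG

end SmoothField

end Flow

section Frame

open Set

variable {A : ℝ → E →L[ℝ] E} {T : ℝ → ℝ → E ≃L[ℝ] E} {f : ℝ → E → E}

theorem IsEvolutionFamily.symm_apply (hT : IsEvolutionFamily A T) {t s : ℝ} (ht : 1 ≤ t)
    (hs : 1 ≤ s) (x : E) : T t s (T s t x) = x := by
  rw [hT.2.1 t s t ht hs ht, hT.1 t ht]; rfl

theorem IsEvolutionFamily.contDiffOn [FiniteDimensional ℝ E] (hA : ContinuousOn A (Ici 1))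
    (hT : IsEvolutionFamily A T) :
    ContDiffOn ℝ 1 (fun t => (T t 1 : E →L[ℝ] E)) (Ici 1) := by
  refine contDiffOn_clm_apply.2 fun x => ?_
  have hd : ∀ t ∈ Ici (1 : ℝ), HasDerivWithinAt (fun τ => T τ 1 x) (A t (T t 1 x)) (Ici 1) t :=
    fun t ht => hT.2.2 1 le_rfl x t ht
  refine (contDiffOn_one_iff_derivWithin (uniqueDiffOn_Ici 1)).2
    ⟨fun t ht => (hd t ht).differentiableWithinAt, ?_⟩
  have hc : ContinuousOn (fun t => A t (T t 1 x)) (Ici 1) :=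
    hA.clm_apply fun t ht => (hd t ht).continuousWithinAt
  exact hc.congr fun t ht => (hd t ht).derivWithin (uniqueDiffOn_Ici 1 t ht)

theorem IsEvolutionFamily.contDiffOn_symm [FiniteDimensional ℝ E] (hA : ContinuousOn A (Ici 1))
    (hT : IsEvolutionFamily A T) :
    ContDiffOn ℝ 1 (fun t => (T 1 t : E →L[ℝ] E)) (Ici 1) := by
  have : CompleteSpace E := FiniteDimensional.complete ℝ E
  have h : ∀ t ∈ Ici (1 : ℝ), (T 1 t : E →L[ℝ] E)
      = ContinuousLinearMap.inverse (T t 1 : E →L[ℝ] E) := fun t ht => by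
    rw [ContinuousLinearMap.inverse_equiv]
    ext x
    exact ((T t 1).symm_apply_eq.2 (hT.symm_apply ht le_rfl x).symm).symm
  refine ContDiffOn.congr (fun t ht => ?_) h
  exact (contDiffAt_map_inverse (T t 1)).comp_contDiffWithinAt t (hT.contDiffOn hA t ht)

/-- Solutions of the semilinear equation are determined by their value at time `1`. -/
theorem IsSemilinSolution.ext (hA : ContinuousOn A (Ici 1)) {B : NNReal}
    (hf : ∀ t, 1 ≤ t → LipschitzWith B (f t)) {u w : ℝ → E} (hu : IsSemilinSolution A f u)
    (hw : IsSemilinSolution A f w) (h : u 1 = w 1) {t : ℝ} (ht : 1 ≤ t) : u t = w t := by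
  have hsub : Icc 1 (1 + (t - 1)) ⊆ Ici 1 := Icc_subset_Ici_self
  obtain ⟨a, ha⟩ := isCompact_Icc.exists_bound_of_continuousOn (hA.mono hsub)
  have ht1 : (1 : ℝ) ∈ Icc 1 (1 + (t - 1)) := ⟨le_rfl, by linarith⟩
  have ha0 : 0 ≤ a := (norm_nonneg _).trans (ha 1 ht1)
  have := norm_le_of_norm_deriv_le_right (u := fun s => u s - w s) (K := a + B) (e := 0)
    (by positivity) le_rfl
    (fun s hs => ((hu s (hsub hs)).sub (hw s (hsub hs))).mono hsub) (fun s hs => by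
      have h1 := (hf s (hsub hs)).dist_le_mul (u s) (w s)
      rw [dist_eq_norm, dist_eq_norm] at h1
      have h2 : A s (u s) + f s (u s) - (A s (w s) + f s (w s))
          = A s (u s - w s) + (f s (u s) - f s (w s)) := by rw [map_sub]; abel
      rw [h2, add_zero, add_mul]
      refine (norm_add_le _ _).trans (add_le_add ?_ h1)
      exact (ContinuousLinearMap.le_opNorm _ _).trans (by gcongr; exact ha s hs))
    t ⟨ht, by linarith⟩
  rw [h, sub_self, norm_zero, add_zero, mul_zero, norm_le_zero_iff] at this
  exact sub_eq_zero.1 this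

theorem IsLinSolution.eq_evolution (hA : ContinuousOn A (Ici 1)) (hT : IsEvolutionFamily A T)
    {u : ℝ → E} (hu : IsLinSolution A u) {t : ℝ} (ht : 1 ≤ t) : u t = T t 1 (u 1) := by
  refine IsSemilinSolution.ext (f := fun _ _ => 0) (B := 0) hA
    (fun _ _ => LipschitzWith.const 0) (fun s hs => by simpa using hu s hs)
    (w := fun t => T t 1 (u 1)) (fun s hs => by simpa using hT.2.2 1 le_rfl (u 1) s hs) ?_ ht
  simp [hT.1 1 le_rfl]

/-- The vector field of the semilinear equation in the moving frame `z = T(1, t)x`, extended to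
times before `1` by its value at `1`. -/
def frameField (T : ℝ → ℝ → E ≃L[ℝ] E) (f : ℝ → E → E) (t : ℝ) (z : E) : E :=
  T 1 (max t 1) (f (max t 1) (T (max t 1) 1 z))

theorem differentiable_section
    (hf : ContDiffOn ℝ 1 (fun p : ℝ × E => f p.1 p.2) (Ici (1 : ℝ) ×ˢ (univ : Set E))) {t : ℝ}
    (ht : 1 ≤ t) (x : E) : HasFDerivAt (f t)
      ((fderivWithin ℝ (fun p : ℝ × E => f p.1 p.2) (Ici (1 : ℝ) ×ˢ (univ : Set E)) (t, x)).comp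
        (ContinuousLinearMap.inr ℝ ℝ E)) x := by
  have h1 := (hf.differentiableOn one_ne_zero (t, x) ⟨ht, mem_univ x⟩).hasFDerivWithinAt
  have := h1.comp x (s := univ) (hasFDerivAt_prodMk_right (𝕜 := ℝ) t x).hasFDerivWithinAt
    (fun y _ => ⟨ht, mem_univ y⟩)
  exact this.hasFDerivAt_of_univ

theorem continuousOn_fderiv_section
    (hf : ContDiffOn ℝ 1 (fun p : ℝ × E => f p.1 p.2) (Ici (1 : ℝ) ×ˢ (univ : Set E))) :
    ContinuousOn (fun p : ℝ × E => fderiv ℝ (f p.1) p.2) (Ici (1 : ℝ) ×ˢ (univ : Set E)) := by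
  have h1 := hf.continuousOn_fderivWithin ((uniqueDiffOn_Ici 1).prod uniqueDiffOn_univ) le_rfl
  refine (h1.clm_comp (continuousOn_const (c := ContinuousLinearMap.inr ℝ ℝ E))).congr ?_
  exact fun p hp => (differentiable_section hf hp.1 p.2).fderiv

theorem hasFDerivAt_frameField
    (hf : ContDiffOn ℝ 1 (fun p : ℝ × E => f p.1 p.2) (Ici (1 : ℝ) ×ˢ (univ : Set E)))
    (t : ℝ) (z : E) : HasFDerivAt (frameField T f t)
      ((T 1 (max t 1) : E →L[ℝ] E).comp ((fderiv ℝ (f (max t 1)) (T (max t 1) 1 z)).comp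
        (T (max t 1) 1 : E →L[ℝ] E))) z :=
  (T 1 (max t 1)).hasFDerivAt.comp z
    ((differentiable_section hf (le_max_right t 1) _).differentiableAt.hasFDerivAt.comp z
      (T (max t 1) 1).hasFDerivAt)

theorem smoothField_frameField [FiniteDimensional ℝ E] (hA : ContinuousOn A (Ici 1))
    (hT : IsEvolutionFamily A T)
    (hf : ContDiffOn ℝ 1 (fun p : ℝ × E => f p.1 p.2) (Ici (1 : ℝ) ×ˢ (univ : Set E)))
    {B : NNReal} (hB : ∀ t, 1 ≤ t → ∀ x, ‖fderiv ℝ (f t) x‖ ≤ B) :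
    SmoothField (frameField T f) := by
  have hmax : Continuous fun t : ℝ => max t 1 := continuous_id.max continuous_const
  have h1 : Continuous fun t : ℝ => (T (max t 1) 1 : E →L[ℝ] E) :=
    (hT.contDiffOn hA).continuousOn.comp_continuous hmax fun t => le_max_right t 1
  have h2 : Continuous fun t : ℝ => (T 1 (max t 1) : E →L[ℝ] E) :=
    (hT.contDiffOn_symm hA).continuousOn.comp_continuous hmax fun t => le_max_right t 1
  have h3 : Continuous fun p : ℝ × E => (max p.1 1, T (max p.1 1) 1 p.2) :=
    (hmax.comp continuous_fst).prodMk ((h1.comp continuous_fst).clm_apply continuous_snd)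
  have hmem : ∀ p : ℝ × E, (max p.1 1, T (max p.1 1) 1 p.2) ∈ Ici (1 : ℝ) ×ˢ (univ : Set E) :=
    fun p => ⟨le_max_right p.1 1, mem_univ _⟩
  refine ⟨?_, fun t z => (hasFDerivAt_frameField hf t z).differentiableAt, ?_, fun t₀ S => ?_⟩
  · exact (h2.comp continuous_fst).clm_apply (hf.continuousOn.comp_continuous h3 hmem)
  · simp only [(hasFDerivAt_frameField hf _ _).fderiv]
    exact (h2.comp continuous_fst).clm_comp
      (((continuousOn_fderiv_section hf).comp_continuous h3 hmem).clm_comp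
        (h1.comp continuous_fst))
  · obtain ⟨b, hb⟩ := (isCompact_Icc (a := t₀ - S) (b := t₀ + S)).exists_bound_of_continuousOn
      h1.continuousOn
    obtain ⟨c, hc⟩ := (isCompact_Icc (a := t₀ - S) (b := t₀ + S)).exists_bound_of_continuousOn
      h2.continuousOn
    refine ⟨(c * (B * b)).toNNReal, fun t ht z => ?_⟩
    rw [(hasFDerivAt_frameField hf t z).fderiv]
    refine le_trans ?_ (Real.le_coe_toNNReal _)
    have hb0 := (norm_nonneg _).trans (hb t ht)
    have hc0 := (norm_nonneg _).trans (hc t ht)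
    refine (ContinuousLinearMap.opNorm_comp_le _ _).trans
      (mul_le_mul (hc t ht) ?_ (norm_nonneg _) hc0)
    exact (ContinuousLinearMap.opNorm_comp_le _ _).trans
      (mul_le_mul (hB _ (le_max_right t 1) _) (hb t ht) (norm_nonneg _) B.coe_nonneg)

/-- Moving a solution in the frame back to the original coordinates. -/
theorem isSemilinSolution_of_frame (hT : IsEvolutionFamily A T)
    (hTd : ContDiffOn ℝ 1 (fun t => (T t 1 : E →L[ℝ] E)) (Ici 1))
    {z : ℝ → E} (hz : Solves (frameField T f) z) :
    IsSemilinSolution A f (fun t => T t 1 (z t)) := fun t ht => by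
  have h1 := (hTd.differentiableOn one_ne_zero t ht).hasDerivWithinAt
  have h2 := h1.clm_apply (hz t).hasDerivWithinAt
  have hu := uniqueDiffOn_Ici (1 : ℝ) t ht
  have h3 : derivWithin (fun t => (T t 1 : E →L[ℝ] E)) (Ici 1) t (z t) = A t (T t 1 (z t)) := by
    have h4 := h1.clm_apply (hasDerivWithinAt_const t (Ici 1) (z t))
    rw [map_zero, add_zero] at h4
    exact (UniqueDiffWithinAt.eq_deriv _ hu h4 (hT.2.2 1 le_rfl (z t) t ht))
  have h5 : T t 1 (frameField T f t (z t)) = f t (T t 1 (z t)) := by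
    rw [frameField, max_eq_left ht, hT.symm_apply ht le_rfl]
  have h6 : A t (T t 1 (z t)) + f t (T t 1 (z t))
      = derivWithin (fun t => (T t 1 : E →L[ℝ] E)) (Ici 1) t (z t)
        + (T t 1 : E →L[ℝ] E) (frameField T f t (z t)) := by
    rw [h3]; exact congrArg _ h5.symm
  show HasDerivWithinAt _ (A t (T t 1 (z t)) + f t (T t 1 (z t))) _ _
  rw [h6]
  exact h2

end Frame

section Conjugacy

open Set

variable [FiniteDimensional ℝ E]

variable {A : ℝ → E →L[ℝ] E} {T : ℝ → ℝ → E ≃L[ℝ] E} {f : ℝ → E → E}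

/-- The linearizing maps in the original coordinates obtained from a map `h` linearizing the flow
`φ` in the moving frame with inverse flow `ψ`. -/
def frameLinearization (T : ℝ → ℝ → E ≃L[ℝ] E) (ψ : ℝ → E → E) (h : E → E) (t : ℝ) (x : E) : E :=
  T t 1 (h (ψ t (T 1 t x)))

/-- The candidate for the inverse of `frameLinearization`. -/
def frameDelinearization (T : ℝ → ℝ → E ≃L[ℝ] E) (φ : ℝ → E → E) (g : E → E) (t : ℝ) (x : E) :
    E :=
  T t 1 (φ t (g (T 1 t x)))

omit [FiniteDimensional ℝ E] in
theorem contDiffOn_frameLinearization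
    (hTd : ContDiffOn ℝ 1 (fun t => (T t 1 : E →L[ℝ] E)) (Ici 1))
    (hTs : ContDiffOn ℝ 1 (fun t => (T 1 t : E →L[ℝ] E)) (Ici 1)) {ψ : ℝ → E → E}
    (hψ : ContDiff ℝ 1 fun p : ℝ × E => ψ p.1 p.2) {h : E → E} (hh : ContDiff ℝ 1 h) :
    ContDiffOn ℝ 1 (fun p : ℝ × E => frameLinearization T ψ h p.1 p.2)
      (Ici (1 : ℝ) ×ˢ (univ : Set E)) := by
  have hfst : MapsTo (Prod.fst : ℝ × E → ℝ) (Ici (1 : ℝ) ×ˢ (univ : Set E)) (Ici 1) :=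
    fun p hp => hp.1
  have h1 := hTd.comp contDiff_fst.contDiffOn hfst
  have h2 := hTs.comp contDiff_fst.contDiffOn hfst
  have h3 : ContDiffOn ℝ 1 (fun p : ℝ × E => (T 1 p.1 : E →L[ℝ] E) p.2)
    (Ici (1 : ℝ) ×ˢ (univ : Set E)) := h2.clm_apply contDiff_snd.contDiffOn
  exact h1.clm_apply (hh.comp_contDiffOn
    (hψ.comp_contDiffOn (contDiff_fst.contDiffOn.prodMk h3)))

omit [FiniteDimensional ℝ E] in
theorem contDiffOn_frameDelinearization
    (hTd : ContDiffOn ℝ 1 (fun t => (T t 1 : E →L[ℝ] E)) (Ici 1))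
    (hTs : ContDiffOn ℝ 1 (fun t => (T 1 t : E →L[ℝ] E)) (Ici 1)) {φ : ℝ → E → E}
    (hφ : ContDiff ℝ 1 fun p : ℝ × E => φ p.1 p.2) {g : E → E} (hg : ContDiff ℝ 1 g) :
    ContDiffOn ℝ 1 (fun p : ℝ × E => frameDelinearization T φ g p.1 p.2)
      (Ici (1 : ℝ) ×ˢ (univ : Set E)) := by
  have hφg : ContDiff ℝ 1 fun p : ℝ × E => φ p.1 (g p.2) :=
    hφ.comp (contDiff_fst.prodMk (hg.comp contDiff_snd))
  exact contDiffOn_frameLinearization hTd hTs (ψ := fun t x => φ t (g x)) hφg contDiff_id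

theorem frameLinearization_comp (hA : ContinuousOn A (Ici 1)) (hT : IsEvolutionFamily A T)
    {B : NNReal} (hB : ∀ t, 1 ≤ t → LipschitzWith B (f t))
    (hv : LipschitzField (frameField T f)) (h : E → E) {u : ℝ → E}
    (hu : IsSemilinSolution A f u) :
    IsLinSolution A (fun t => frameLinearization T (fun t x => hv.flow t x 1) h t (u t)) := by
  have key : ∀ t, 1 ≤ t →
      frameLinearization T (fun t x => hv.flow t x 1) h t (u t) = T t 1 (h (u 1)) := fun t ht => by
    have h1 : u t = T t 1 (hv.flow 1 (u 1) t) := by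
      refine IsSemilinSolution.ext hA hB hu
        (isSemilinSolution_of_frame hT (hT.contDiffOn hA) (hv.flow_solves 1 (u 1))) ?_ ht
      simp [hT.1 1 le_rfl, hv.flow_init]
    rw [frameLinearization, h1, hT.symm_apply le_rfl ht,
      hv.flow_eq (hv.flow_solves 1 (u 1)) t 1, hv.flow_init]
  intro t ht
  have := hT.2.2 1 le_rfl (h (u 1)) t ht
  rw [← key t ht] at this
  exact this.congr (fun s hs => key s hs) (key t ht)

theorem frameDelinearization_comp (hA : ContinuousOn A (Ici 1)) (hT : IsEvolutionFamily A T)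
    (hv : LipschitzField (frameField T f)) (g : E → E) {u : ℝ → E} (hu : IsLinSolution A u) :
    IsSemilinSolution A f
      (fun t => frameDelinearization T (fun t x => hv.flow 1 x t) g t (u t)) := by
  have key : ∀ t, 1 ≤ t →
      frameDelinearization T (fun t x => hv.flow 1 x t) g t (u t)
        = T t 1 (hv.flow 1 (g (u 1)) t) := fun t ht => by
    rw [frameDelinearization, hu.eq_evolution hA hT ht, hT.symm_apply le_rfl ht]
  intro t ht
  have := isSemilinSolution_of_frame hT (hT.contDiffOn hA) (hv.flow_solves 1 (g (u 1))) t ht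
  simp only at this
  rw [← key t ht] at this
  exact this.congr (fun s hs => key s hs) (key t ht)

omit [FiniteDimensional ℝ E] in
theorem frameLinearization_inverse (hT : IsEvolutionFamily A T) {φ ψ : ℝ → E → E}
    (hψφ : ∀ t x, ψ t (φ t x) = x) (hφψ : ∀ t x, φ t (ψ t x) = x) {h g : E → E}
    (hgh : ∀ x, g (h x) = x) (hhg : ∀ x, h (g x) = x) {t : ℝ} (ht : 1 ≤ t) (x : E) :
    frameLinearization T ψ h t (frameDelinearization T φ g t x) = x ∧
      frameDelinearization T φ g t (frameLinearization T ψ h t x) = x := by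
  simp only [frameLinearization, frameDelinearization, hT.symm_apply le_rfl ht, hψφ, hφψ, hgh,
    hhg, hT.symm_apply ht le_rfl, and_self]

end Conjugacy

section Octave

open Set

variable [FiniteDimensional ℝ E]

theorem seminorm_sub_le_of_growth (p : Seminorm ℝ E) {u u' : ℝ → E} {a b c e : ℝ} (hc : 0 ≤ c)
    (hcb : c * (b - a) ≤ 1 / 2) (hu : ∀ t, HasDerivAt u (u' t) t)
    (hB : ∀ t ∈ Icc a b, p (u' t) ≤ c * p (u t) + e) {t : ℝ} (ht : t ∈ Icc a b) :
    p (u t - u a) ≤ 2 * (b - a) * (c * p (u a) + e) := by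
  have hab : a ≤ b := ht.1.trans ht.2
  have huc : Continuous u := continuous_iff_continuousAt.2 fun t => (hu t).continuousAt
  obtain ⟨s, hs, hmax⟩ := isCompact_Icc.exists_isMaxOn ⟨t, ht⟩
    ((seminorm_continuous p).comp (huc.sub continuous_const : Continuous fun t => u t - u a)
      |>.continuousOn (s := Icc a b))
  have hmax' : ∀ τ ∈ Icc a b, p (u τ - u a) ≤ p (u s - u a) := fun τ hτ => hmax hτ
  have h0 : 0 ≤ p (u s - u a) := apply_nonneg _ _
  have hu' : ∀ τ ∈ Icc a b, p (u' τ) ≤ c * (p (u a) + p (u s - u a)) + e := fun τ hτ => by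
    refine (hB τ hτ).trans ?_
    have : p (u τ) ≤ p (u a) + p (u s - u a) := by
      calc p (u τ) = p (u a + (u τ - u a)) := by rw [add_sub_cancel]
        _ ≤ p (u a) + p (u τ - u a) := map_add_le_add _ _ _
        _ ≤ _ := by gcongr; exact hmax' τ hτ
    gcongr
  have hnn : 0 ≤ c * (p (u a) + p (u s - u a)) + e :=
    (apply_nonneg p _).trans (hu' a ⟨le_rfl, hab⟩)
  have h1 := seminorm_sub_le_of_deriv p hs.1 (fun τ _ => (hu τ).hasDerivWithinAt)
    (fun τ hτ => hu' τ ⟨hτ.1, hτ.2.trans hs.2⟩)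
  have h2 : (c * (p (u a) + p (u s - u a)) + e) * (s - a)
      ≤ (c * (p (u a) + p (u s - u a)) + e) * (b - a) := by
    have := hs.2
    gcongr
  have h3 := mul_le_mul_of_nonneg_right hcb h0
  have h4 := hmax' t ht
  linarith

/-- Bounds on the derivative of a vector field over a time interval, in a fixed seminorm. -/
structure FieldBounds (p : Seminorm ℝ E) (v : ℝ → E → E) (a b c l : ℝ) : Prop where
  le : a ≤ b
  c_nonneg : 0 ≤ c
  l_nonneg : 0 ≤ l
  small : c * (b - a) ≤ 1 / 4
  zero : ∀ t, v t 0 = 0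
  fderiv_zero : ∀ t, fderiv ℝ (v t) 0 = 0
  fderiv_le : ∀ t ∈ Icc a b, ∀ z w, p (fderiv ℝ (v t) z w) ≤ c * p w
  fderiv_sub_le : ∀ t ∈ Icc a b, ∀ z z' w,
    p (fderiv ℝ (v t) z w - fderiv ℝ (v t) z' w) ≤ l * p (z - z') * p w

namespace FieldBounds

variable {p : Seminorm ℝ E} {v : ℝ → E → E} {a b c l : ℝ}

theorem sub_le (h : FieldBounds p v a b c l) (hd : ∀ t, Differentiable ℝ (v t)) {t : ℝ}
    (ht : t ∈ Icc a b) (z z' : E) : p (v t z - v t z') ≤ c * p (z - z') := by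
  have := seminorm_sub_le_of_deriv p (γ := fun s : ℝ => v t (z' + s • (z - z')))
    (γ' := fun s => fderiv ℝ (v t) (z' + s • (z - z')) (z - z')) (zero_le_one' ℝ)
    (fun s _ => by
      have h1 : HasDerivAt (fun s : ℝ => z' + s • (z - z')) (z - z') s := by
        simpa using ((hasDerivAt_id s).smul_const (z - z')).const_add z'
      exact ((hd t _).hasFDerivAt.comp_hasDerivAt s h1).hasDerivWithinAt)
    (fun s _ => h.fderiv_le t ht _ _)
  simpa using this

omit [FiniteDimensional ℝ E] in
theorem small_half (h : FieldBounds p v a b c l) : c * (b - a) ≤ 1 / 2 :=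
  h.small.trans (by norm_num)

variable [CompleteSpace E]

omit [FiniteDimensional ℝ E] in
theorem flow_zero (h : FieldBounds p v a b c l) (hv : LipschitzField v) (t₀ t : ℝ) :
    hv.flow t₀ 0 t = 0 :=
  hv.flow_eq (u := fun _ => 0) (fun t => by simpa [h.zero t] using hasDerivAt_const t (0 : E)) t₀ t

theorem flow_sub_le (h : FieldBounds p v a b c l) (hv : SmoothField v) (t₀ : ℝ) (x y : E) {t : ℝ}
    (ht : t ∈ Icc a b) :
    p ((hv.lipschitzField.flow t₀ x t - hv.lipschitzField.flow t₀ y t)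
      - (hv.lipschitzField.flow t₀ x a - hv.lipschitzField.flow t₀ y a))
    ≤ 2 * (b - a) * (c * p (hv.lipschitzField.flow t₀ x a - hv.lipschitzField.flow t₀ y a)) := by
  have := seminorm_sub_le_of_growth p (e := 0)
    (u := fun t => hv.lipschitzField.flow t₀ x t - hv.lipschitzField.flow t₀ y t) h.c_nonneg h.small_half
    (fun t => (hv.lipschitzField.flow_solves t₀ x t).sub (hv.lipschitzField.flow_solves t₀ y t))
    (fun t ht => by simpa using h.sub_le (fun t => hv.differentiable t) ht _ _) ht
  simpa using this

omit [FiniteDimensional ℝ E] [CompleteSpace E] in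
theorem comparable_of_sub_le {x y : E} {s : ℝ} (h : p (x - y) ≤ 2 * s * (c * p y))
    (hs : c * s ≤ 1 / 4) : p x ≤ 2 * p y ∧ p y ≤ 2 * p x := by
  have h1 : p x ≤ p y + p (x - y) := by
    calc p x = p (y + (x - y)) := by rw [add_sub_cancel]
      _ ≤ _ := map_add_le_add _ _ _
  have h2 : p y ≤ p x + p (x - y) := by
    calc p y = p (x - (x - y)) := by rw [sub_sub_cancel]
      _ ≤ _ := map_sub_le_add _ _ _
  have := mul_le_mul_of_nonneg_right hs (apply_nonneg p y)
  have := apply_nonneg p y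
  constructor <;> linarith

theorem flow_sub_le_two_mul (h : FieldBounds p v a b c l) (hv : SmoothField v) (t₀ : ℝ) (x y : E)
    {t : ℝ} (ht : t ∈ Icc a b) :
    p (hv.lipschitzField.flow t₀ x t - hv.lipschitzField.flow t₀ y t)
    ≤ 2 * p (hv.lipschitzField.flow t₀ x a - hv.lipschitzField.flow t₀ y a) :=
  (comparable_of_sub_le (h.flow_sub_le hv t₀ x y ht) h.small).1

theorem flow_comparable (h : FieldBounds p v a b c l) (hv : SmoothField v) (t₀ : ℝ) (x : E)
    {t : ℝ} (ht : t ∈ Icc a b) :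
    p (hv.lipschitzField.flow t₀ x t) ≤ 2 * p (hv.lipschitzField.flow t₀ x a) ∧
      p (hv.lipschitzField.flow t₀ x a) ≤ 2 * p (hv.lipschitzField.flow t₀ x t) := by
  simpa [h.flow_zero] using comparable_of_sub_le (h.flow_sub_le hv t₀ x 0 ht) h.small

omit [FiniteDimensional ℝ E] in
theorem hasDerivAt_varFlow_apply (hv : SmoothField v) (t₀ : ℝ) (x k : E) (t : ℝ) :
    HasDerivAt (fun t => hv.varFlow t₀ x t k)
      (fderiv ℝ (v t) (hv.lipschitzField.flow t₀ x t) (hv.varFlow t₀ x t k)) t := by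
  simpa using (hv.hasDerivAt_varFlow t₀ x t).clm_apply (hasDerivAt_const t k)

theorem varFlow_comparable (h : FieldBounds p v a b c l) (hv : SmoothField v) (t₀ : ℝ) (x k : E)
    {t : ℝ} (ht : t ∈ Icc a b) :
    p (hv.varFlow t₀ x t k) ≤ 2 * p (hv.varFlow t₀ x a k) ∧
      p (hv.varFlow t₀ x a k) ≤ 2 * p (hv.varFlow t₀ x t k) := by
  refine comparable_of_sub_le (s := b - a) ?_ h.small
  have := seminorm_sub_le_of_growth p (e := 0) (u := fun t => hv.varFlow t₀ x t k)
    h.c_nonneg h.small_half (hasDerivAt_varFlow_apply hv t₀ x k)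
    (fun t ht => by simpa using h.fderiv_le t ht _ _) ht
  simpa using this

theorem varFlow_sub_le (h : FieldBounds p v a b c l) (hv : SmoothField v) (t₀ : ℝ) (x y k k' : E)
    {t : ℝ} (ht : t ∈ Icc a b) :
    p ((hv.varFlow t₀ x t k - hv.varFlow t₀ y t k')
      - (hv.varFlow t₀ x a k - hv.varFlow t₀ y a k'))
    ≤ 2 * (b - a) * (min c (2 * l * p (hv.lipschitzField.flow t₀ x a))
        * p (hv.varFlow t₀ x a k - hv.varFlow t₀ y a k')
      + min (2 * c) (2 * l * p (hv.lipschitzField.flow t₀ x a - hv.lipschitzField.flow t₀ y a))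
        * (2 * p (hv.varFlow t₀ y a k'))) := by
  have hl := h.l_nonneg
  have hc := h.c_nonneg
  have hba := sub_nonneg.2 h.le
  refine seminorm_sub_le_of_growth p
    (u := fun t => hv.varFlow t₀ x t k - hv.varFlow t₀ y t k') (by positivity)
    (le_trans (by gcongr; exact min_le_left _ _) h.small_half)
    (fun t => (hasDerivAt_varFlow_apply hv t₀ x k t).sub (hasDerivAt_varFlow_apply hv t₀ y k' t))
    (fun t ht => ?_) ht
  set X := hv.lipschitzField.flow t₀ x t
  set Y := hv.lipschitzField.flow t₀ y t
  set U := hv.varFlow t₀ x t k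
  set V := hv.varFlow t₀ y t k'
  have h0 : fderiv ℝ (v t) X U - fderiv ℝ (v t) Y V
      = fderiv ℝ (v t) X (U - V) + (fderiv ℝ (v t) X V - fderiv ℝ (v t) Y V) := by
    rw [map_sub]; abel
  have h1 : ∀ z w, p (fderiv ℝ (v t) z w) ≤ l * p z * p w := fun z w => by
    simpa [h.fderiv_zero t] using h.fderiv_sub_le t ht z 0 w
  have h2 : p (fderiv ℝ (v t) X V - fderiv ℝ (v t) Y V) ≤ 2 * c * p V :=
    (map_sub_le_add p _ _).trans (by
      linarith [h.fderiv_le t ht X V, h.fderiv_le t ht Y V])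
  rw [h0]
  refine (map_add_le_add p _ _).trans (add_le_add ?_ ?_)
  · rw [min_mul_of_nonneg _ _ (apply_nonneg _ _)]
    refine le_min (h.fderiv_le t ht _ _) ((h1 _ _).trans ?_)
    refine mul_le_mul_of_nonneg_right ?_ (apply_nonneg _ _)
    linarith [mul_le_mul_of_nonneg_left (h.flow_comparable hv t₀ x ht).1 hl]
  · refine le_trans ?_ (mul_le_mul_of_nonneg_left (h.varFlow_comparable hv t₀ y k' ht).1
      (by positivity))
    rw [min_mul_of_nonneg _ _ (apply_nonneg _ _)]
    refine le_min h2 ((h.fderiv_sub_le t ht X Y V).trans ?_)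
    refine mul_le_mul_of_nonneg_right ?_ (apply_nonneg _ _)
    linarith [mul_le_mul_of_nonneg_left (h.flow_sub_le_two_mul hv t₀ x y ht) hl]

end FieldBounds

end Octave

section FrameOrbit

open Set

variable [FiniteDimensional ℝ E]

variable {A : ℝ → E →L[ℝ] E} {T : ℝ → ℝ → E ≃L[ℝ] E} {N : ℝ → E → ℝ} {f : ℝ → E → E}
  {p : ℝ → Seminorm ℝ E} {ε C η L : ℝ}

/-- The seminorms `p t`, for `t` in the octave `[2 ^ n, 2 ^ (n + 1)]`, agree up to the factor
`M`. -/
def OctaveComparable (p : ℝ → Seminorm ℝ E) (M : ℝ) : Prop :=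
  ∀ (n : ℕ) (t : ℝ), t ∈ Icc ((2 : ℝ) ^ n) (2 ^ (n + 1)) → ∀ z,
    p t z ≤ M * p (2 ^ n) z ∧ p (2 ^ n) z ≤ M * p t z

/-- The norms `N t` lie between the ambient norm and its multiple by `C * t ^ (2 * ε)`. -/
def NormComparable (N : ℝ → E → ℝ) (C ε : ℝ) : Prop :=
  ∀ t : ℝ, 1 ≤ t → ∀ x, ‖x‖ ≤ N t x ∧ N t x ≤ C * t ^ (2 * ε) * ‖x‖

omit [FiniteDimensional ℝ E] in
theorem octaveComparable_of_growth {K a : ℝ} (hK : 0 < K) (ha : 0 ≤ a)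
    (h : ∀ t s, 1 ≤ s → s ≤ t → ∀ z, p t z ≤ K * (t / s) ^ a * p s z ∧
      p s z ≤ K * (t / s) ^ a * p t z) : OctaveComparable p (K * 2 ^ a) := fun n t ht z => by
  have h2 : (0 : ℝ) < 2 ^ n := by positivity
  have h1 := h t (2 ^ n) (one_le_pow₀ one_le_two) ht.1 z
  have h3 : (t / 2 ^ n) ^ a ≤ (2 : ℝ) ^ a :=
    Real.rpow_le_rpow (div_nonneg (h2.le.trans ht.1) h2.le)
      (by rw [div_le_iff₀ h2, ← pow_succ']; exact ht.2) ha
  exact ⟨h1.1.trans (by gcongr), h1.2.trans (by gcongr)⟩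

omit [FiniteDimensional ℝ E] in
theorem NormComparable.fderiv_le (hN : NormComparable N C ε) (hC : 0 < C)
    (hη : 0 ≤ η) {B : E →L[ℝ] E} {t : ℝ} (ht : 1 ≤ t) (hB : ‖B‖ ≤ η / t ^ (1 + 2 * ε)) (w : E) :
    N t (B w) ≤ C * η / t * N t w := by
  have ht0 : 0 < t := by linarith
  have h1 := (hN t ht (B w)).2
  have h2 : ‖B w‖ ≤ η / t ^ (1 + 2 * ε) * N t w :=
    (B.le_of_opNorm_le hB w).trans (by gcongr; exact (hN t ht w).1)
  calc N t (B w) ≤ C * t ^ (2 * ε) * (η / t ^ (1 + 2 * ε) * N t w) := h1.trans (by gcongr)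
    _ = C * η / t * N t w := by
      rw [Real.rpow_add ht0, Real.rpow_one]
      field_simp

omit [FiniteDimensional ℝ E] in
theorem fieldBounds_frameField (hT : IsEvolutionFamily A T)
    (hf : ContDiffOn ℝ 1 (fun p : ℝ × E => f p.1 p.2) (Ici (1 : ℝ) ×ˢ (univ : Set E)))
    (hf0 : ∀ t, 1 ≤ t → f t 0 = 0) (hf0' : ∀ t, 1 ≤ t → fderiv ℝ (f t) 0 = 0)
    (hη : ∀ t, 1 ≤ t → ∀ x, ‖fderiv ℝ (f t) x‖ ≤ η / t ^ (1 + 4 * ε))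
    (hL : ∀ t, 1 ≤ t → ∀ x y,
      ‖fderiv ℝ (f t) x - fderiv ℝ (f t) y‖ ≤ L / t ^ (1 + 5 * ε) * ‖x - y‖)
    (hε : 0 ≤ ε) (hC : 0 < C) (hη0 : 0 ≤ η) (hL0 : 0 ≤ L)
    (hp : ∀ t, 1 ≤ t → ∀ z, p t z = N t (T t 1 z)) (hN : NormComparable N C ε)
    {M : ℝ} (hM0 : 0 < M) (hM : OctaveComparable p M) (hsmall : C * M ^ 2 * η ≤ 1 / 4) (n : ℕ) :
    FieldBounds (p (2 ^ n)) (frameField T f) (2 ^ n) (2 ^ (n + 1)) (C * M ^ 2 * η / 2 ^ n)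
      (C * M ^ 3 * L / 2 ^ n) := by
  have h2 : (0 : ℝ) < 2 ^ n := by positivity
  have h1 : ∀ t ∈ Icc ((2 : ℝ) ^ n) (2 ^ (n + 1)), 1 ≤ t :=
    fun t ht => (one_le_pow₀ one_le_two).trans ht.1
  have hder : ∀ t, 1 ≤ t → ∀ z w, T t 1 (fderiv ℝ (frameField T f t) z w)
      = fderiv ℝ (f t) (T t 1 z) (T t 1 w) := fun t ht z w => by
    rw [(hasFDerivAt_frameField hf t z).fderiv, max_eq_left ht]
    exact hT.symm_apply ht le_rfl _
  have key : ∀ t ∈ Icc ((2 : ℝ) ^ n) (2 ^ (n + 1)), ∀ (B : E →L[ℝ] E) (κ : ℝ) (u w : E), 0 ≤ κ →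
      ‖B‖ ≤ κ / t ^ (1 + 2 * ε) → T t 1 u = B (T t 1 w) →
      p (2 ^ n) u ≤ C * M ^ 2 * κ / 2 ^ n * p (2 ^ n) w := by
    intro t ht B κ u w hκ hB hu
    have h3 := hN.fderiv_le hC hκ (h1 t ht) hB (T t 1 w)
    rw [← hu, ← hp t (h1 t ht), ← hp t (h1 t ht)] at h3
    have hw := (hM n t ht w).1
    calc p (2 ^ n) u ≤ M * p t u := (hM n t ht u).2
      _ ≤ M * (C * κ / 2 ^ n * (M * p (2 ^ n) w)) := by
        refine mul_le_mul_of_nonneg_left (h3.trans ?_) hM0.le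
        gcongr
        exact ht.1
      _ = _ := by ring
  refine ⟨pow_le_pow_right₀ one_le_two n.le_succ, by positivity, by positivity, ?_, fun t => ?_,
    fun t => ?_, fun t ht z w => ?_, fun t ht z z' w => ?_⟩
  · rwa [pow_succ (2 : ℝ) n, mul_two, add_sub_cancel_right, div_mul_cancel₀ _ h2.ne']
  · simp [frameField, hf0 (max t 1) (le_max_right t 1)]
  · rw [(hasFDerivAt_frameField hf t 0).fderiv, map_zero, hf0' _ (le_max_right t 1)]
    ext; simp
  · have ht1 := h1 t ht
    refine key t ht _ η _ w hη0 ((hη t ht1 _).trans ?_) (hder t ht1 z w)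
    gcongr
    · linarith
  · have ht1 := h1 t ht
    have hz : ‖T t 1 z - T t 1 z'‖ ≤ M * p (2 ^ n) (z - z') := by
      rw [← map_sub]
      refine ((hN t ht1 _).1.trans (hp t ht1 _).ge).trans (hM n t ht _).1
    have := key t ht (fderiv ℝ (f t) (T t 1 z) - fderiv ℝ (f t) (T t 1 z'))
      (L * (M * p (2 ^ n) (z - z'))) (fderiv ℝ (frameField T f t) z w
        - fderiv ℝ (frameField T f t) z' w) w (by positivity) ?_ ?_
    · refine this.trans (le_of_eq ?_)
      ring
    · refine (hL t ht1 _ _).trans ?_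
      rw [mul_div_right_comm]
      gcongr
      · linarith
    · rw [map_sub, hder t ht1, hder t ht1]; rfl

theorem orbitSys_of_fieldBounds [CompleteSpace E] {v : ℝ → E → E} (hv : SmoothField v)
    {q : ℕ → Seminorm ℝ E} {κ l M D : ℝ} (hκ : 0 ≤ κ) (hl : 0 ≤ l) (hM0 : 0 < M)
    (hM : OctaveComparable p M) (hD : 0 < D)
    (hq : ∀ n x, p (2 ^ n) x ≤ D * q n x ∧ q n x ≤ D * p (2 ^ n) x)
    (h : ∀ n : ℕ, FieldBounds (p (2 ^ n)) v (2 ^ n) (2 ^ (n + 1)) (κ / 2 ^ n) (l / 2 ^ n)) :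
    OrbitSys q (4 * M * D ^ 2 * κ) (8 * M * D ^ 3 * l)
      (fun n x => hv.lipschitzField.flow 1 x (2 ^ n)) := by
  have hder : ∀ t x k, fderiv ℝ (fun y => hv.lipschitzField.flow 1 y t) x k
      = hv.varFlow 1 x t k := fun t x k => by rw [(hv.hasFDerivAt_flow 1 x t).fderiv]
  have hend : ∀ n : ℕ, (2 : ℝ) ^ (n + 1) ∈ Icc ((2 : ℝ) ^ n) (2 ^ (n + 1)) := fun n =>
    ⟨(h n).le, le_rfl⟩
  have hlen : ∀ n : ℕ, (2 : ℝ) ^ (n + 1) - 2 ^ n = 2 ^ n := fun n => by ring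
  have hup : ∀ n x, q (n + 1) x ≤ D * M * p (2 ^ n) x := fun n x => by
    rw [mul_assoc]
    exact (hq (n + 1) x).2.trans (mul_le_mul_of_nonneg_left (hM n _ (hend n) x).1 hD.le)
  have hvar : ∀ n x y k k' (a b : ℝ), 0 ≤ a → 0 ≤ b →
      min κ (2 * l * p (2 ^ n) (hv.lipschitzField.flow 1 x (2 ^ n))) ≤ a →
      min (2 * κ) (2 * l * p (2 ^ n) (hv.lipschitzField.flow 1 x (2 ^ n)
        - hv.lipschitzField.flow 1 y (2 ^ n))) ≤ b →
      q (n + 1) ((hv.varFlow 1 x (2 ^ (n + 1)) k - hv.varFlow 1 y (2 ^ (n + 1)) k')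
        - (hv.varFlow 1 x (2 ^ n) k - hv.varFlow 1 y (2 ^ n) k')) ≤
      2 * M * D ^ 2 * a * q n (hv.varFlow 1 x (2 ^ n) k - hv.varFlow 1 y (2 ^ n) k')
        + 4 * M * D ^ 2 * b * q n (hv.varFlow 1 y (2 ^ n) k') := by
    intro n x y k k' a b ha hb hxa hyb
    have h2 : (0 : ℝ) < 2 ^ n := by positivity
    have h1 := (h n).varFlow_sub_le hv 1 x y k k' (hend n)
    have hmin : ∀ s t u : ℝ, min (s / 2 ^ n) (2 * (t / 2 ^ n) * u)
        = min s (2 * t * u) / 2 ^ n := fun s t u => by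
      rw [← min_div_div_right h2.le]; congr 1; ring
    have hmin' : ∀ s t u : ℝ, min (2 * (s / 2 ^ n)) (2 * (t / 2 ^ n) * u)
        = min (2 * s) (2 * t * u) / 2 ^ n := fun s t u => by
      rw [← min_div_div_right h2.le]; congr 1 <;> ring
    rw [hlen, hmin, hmin'] at h1
    set U := hv.varFlow 1 x (2 ^ n) k - hv.varFlow 1 y (2 ^ n) k'
    set V := hv.varFlow 1 y (2 ^ n) k'
    refine (hup n _).trans ((mul_le_mul_of_nonneg_left h1 (by positivity)).trans ?_)
    calc _ ≤ D * M * (2 * 2 ^ n * (a / 2 ^ n * (D * q n U) + b / 2 ^ n * (2 * (D * q n V)))) := by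
          gcongr
          · exact (hq n U).1
          · exact (hq n V).1
      _ = _ := by field_simp; ring
  refine ⟨fun m => ?_, fun x => ?_, fun m => (h 0).flow_zero _ _ _, fun m x y => ?_,
    fun m x y k k' => ?_, fun m x y k k' => ?_⟩
  · exact (hv.contDiff_flow 1).comp (contDiff_prodMk_right ((2 : ℝ) ^ m))
  · simp [LipschitzField.flow_init]
  · have h2 : (0 : ℝ) < 2 ^ m := by positivity
    have h1 := (h m).flow_sub_le hv 1 x y (hend m)
    rw [hlen] at h1
    set U := hv.lipschitzField.flow 1 x (2 ^ m) - hv.lipschitzField.flow 1 y (2 ^ m)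
    refine (hup m _).trans ((mul_le_mul_of_nonneg_left h1 (by positivity)).trans ?_)
    calc _ ≤ D * M * (2 * 2 ^ m * (κ / 2 ^ m * (D * q m U))) := by
          gcongr
          exact (hq m U).1
      _ = 2 * (M * D ^ 2 * κ * q m U) := by field_simp
      _ ≤ _ := by
        have : 0 ≤ M * D ^ 2 * κ * q m U := by positivity
        linarith
  · simp only [hder]
    have h1 := hvar m x y k k' κ (min (2 * κ) (2 * l * (D * q m
      (hv.lipschitzField.flow 1 x (2 ^ m) - hv.lipschitzField.flow 1 y (2 ^ m))))) hκ
      (by positivity) (min_le_left _ _)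
      (min_le_min_left _ (by gcongr; exact (hq m _).1))
    set U := hv.varFlow 1 x (2 ^ m) k - hv.varFlow 1 y (2 ^ m) k'
    refine h1.trans (add_le_add ?_ (mul_le_mul_of_nonneg_right ?_ (apply_nonneg _ _)))
    · have : 0 ≤ M * D ^ 2 * κ * q m U := by positivity
      linarith
    · rw [mul_min_of_nonneg _ _ (by positivity)]
      exact min_le_min (le_of_eq (by ring)) (le_of_eq (by ring))
  · simp only [hder]
    have h1 := hvar m x y k k' (2 * l * (D * q m (hv.lipschitzField.flow 1 x (2 ^ m))))
      (2 * l * (D * q m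
      (hv.lipschitzField.flow 1 x (2 ^ m) - hv.lipschitzField.flow 1 y (2 ^ m)))) (by positivity)
      (by positivity) ((min_le_right _ _).trans (by gcongr; exact (hq m _).1))
      ((min_le_right _ _).trans (by gcongr; exact (hq m _).1))
    refine h1.trans (add_le_add (mul_le_mul_of_nonneg_right ?_ (apply_nonneg _ _)) (le_of_eq ?_))
    · have : 0 ≤ M * D ^ 3 * l * q m (hv.lipschitzField.flow 1 x (2 ^ m)) := by positivity
      linarith
    · ring

end FrameOrbit

section Derivative

open Set

theorem NormComparable.norm_fderiv_le {A : ℝ → E →L[ℝ] E} {T : ℝ → ℝ → E ≃L[ℝ] E}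
    {N : ℝ → E → ℝ} {p : ℝ → Seminorm ℝ E} {C ε : ℝ} (hN : NormComparable N C ε)
    (hT : IsEvolutionFamily A T) (hε : 0 ≤ ε) (hC : 0 < C)
    (hp : ∀ t, 1 ≤ t → ∀ z, p t z = N t (T t 1 z)) {t : ℝ} (ht : 1 ≤ t) {B : E → E}
    (hB : Differentiable ℝ B) {c : ℝ} (hc : 0 ≤ c) (x : E)
    (hBc : ∀ u, p t (fderiv ℝ B (T 1 t x) u) ≤ c * p t u) :
    ‖fderiv ℝ (fun x => T t 1 (B (T 1 t x))) x‖ ≤ c * C * t ^ (4 * ε) := by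
  have hd : HasFDerivAt (fun x => T t 1 (B (T 1 t x)))
      ((T t 1 : E →L[ℝ] E).comp ((fderiv ℝ B (T 1 t x)).comp (T 1 t : E →L[ℝ] E))) x :=
    (T t 1).hasFDerivAt.comp x ((hB (T 1 t x)).hasFDerivAt.comp x (T 1 t).hasFDerivAt)
  have ht0 : 0 < t := by linarith
  rw [hd.fderiv]
  refine ContinuousLinearMap.opNorm_le_bound _ (by positivity) fun u => ?_
  calc ‖T t 1 (fderiv ℝ B (T 1 t x) (T 1 t u))‖
      ≤ N t (T t 1 (fderiv ℝ B (T 1 t x) (T 1 t u))) := (hN t ht _).1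
    _ ≤ c * N t u := by
      rw [← hp t ht]
      refine (hBc _).trans_eq ?_
      rw [hp t ht, hT.symm_apply ht le_rfl]
    _ ≤ c * (C * t ^ (2 * ε) * ‖u‖) := by gcongr; exact (hN t ht u).2
    _ ≤ c * (C * t ^ (4 * ε) * ‖u‖) := by
      gcongr
      norm_num
    _ = c * C * t ^ (4 * ε) * ‖u‖ := by ring

omit [NormedSpace ℝ E] in
theorem NormComparable.le_of_norm_le {N : ℝ → E → ℝ} {C ε : ℝ} (hN : NormComparable N C ε)
    (hε : 0 ≤ ε) (hC : 0 < C) {t ζ : ℝ} (ht : 1 ≤ t) (hζ : 0 ≤ ζ) {x : E}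
    (hx : ‖x‖ ≤ ζ / t ^ (3 * ε)) : N t x ≤ C * ζ := by
  have ht0 : 0 < t := by linarith
  calc N t x ≤ C * t ^ (2 * ε) * (ζ / t ^ (3 * ε)) :=
        (hN t ht x).2.trans (by gcongr)
    _ ≤ C * t ^ (3 * ε) * (ζ / t ^ (3 * ε)) := by
      gcongr
      norm_num
    _ = C * ζ := by field_simp

theorem fderiv_apply_of_inverse {F G : E → E} (hF : ContDiff ℝ 1 F) (hG : ContDiff ℝ 1 G)
    (hFG : ∀ x, F (G x) = x) (x u : E) : fderiv ℝ F (G x) (fderiv ℝ G x u) = u := by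
  rw [← fderiv_comp_apply' hF hG]
  simp [hFG]

variable [FiniteDimensional ℝ E] [CompleteSpace E]

theorem exists_octave_comparison {p : ℝ → Seminorm ℝ E} {v : ℝ → E → E} (hv : SmoothField v)
    {q : ℕ → Seminorm ℝ E} {κ l M D : ℝ} (hM0 : 0 < M)
    (hM : OctaveComparable p M) (hD : 0 < D)
    (hq : ∀ n x, p (2 ^ n) x ≤ D * q n x ∧ q n x ≤ D * p (2 ^ n) x)
    (h : ∀ n : ℕ, FieldBounds (p (2 ^ n)) v (2 ^ n) (2 ^ (n + 1)) (κ / 2 ^ n) (l / 2 ^ n))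
    {t : ℝ} (ht : 1 ≤ t) : ∃ n : ℕ,
      (∀ z, p t z ≤ 2 * D * M * q n z ∧ q n z ≤ 2 * D * M * p t z) ∧
      (∀ x, q n (hv.lipschitzField.flow 1 x (2 ^ n))
        ≤ 2 * D * M * p t (hv.lipschitzField.flow 1 x t)) ∧
      ∀ x k, p t (hv.varFlow 1 x t k) ≤ 2 * D * M * q n (hv.varFlow 1 x (2 ^ n) k) ∧
        q n (hv.varFlow 1 x (2 ^ n) k) ≤ 2 * D * M * p t (hv.varFlow 1 x t k) := by
  obtain ⟨n, hn1, hn2⟩ := exists_nat_pow_near ht (one_lt_two : (1 : ℝ) < 2)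
  have hn : t ∈ Icc ((2 : ℝ) ^ n) (2 ^ (n + 1)) := ⟨hn1, hn2.le⟩
  have key : ∀ y z, p (2 ^ n) y ≤ 2 * p (2 ^ n) z ∧ p (2 ^ n) z ≤ 2 * p (2 ^ n) y →
      p t y ≤ 2 * D * M * q n z ∧ q n z ≤ 2 * D * M * p t y := by
    rintro y z ⟨h1, h2⟩
    constructor
    · calc p t y ≤ M * (2 * (D * q n z)) := by
            refine (hM n t hn y).1.trans (mul_le_mul_of_nonneg_left (h1.trans ?_) hM0.le)
            gcongr
            exact (hq n z).1
        _ = _ := by ring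
    · calc q n z ≤ D * (2 * (M * p t y)) := by
            refine (hq n z).2.trans (mul_le_mul_of_nonneg_left (h2.trans ?_) hD.le)
            gcongr
            exact (hM n t hn y).2
        _ = _ := by ring
  refine ⟨n, fun z => key z z ?_, fun x => (key _ _ ((h n).flow_comparable hv 1 x hn)).2,
    fun x k => key _ _ ((h n).varFlow_comparable hv 1 x k hn)⟩
  have := apply_nonneg (p (2 ^ n)) z
  constructor <;> linarith

theorem exists_derivative_bounds {A : ℝ → E →L[ℝ] E} {T : ℝ → ℝ → E ≃L[ℝ] E}
    {N : ℝ → E → ℝ} {p : ℝ → Seminorm ℝ E} {C ε : ℝ} (hN : NormComparable N C ε)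
    (hT : IsEvolutionFamily A T) (hε : 0 ≤ ε) (hC : 0 < C)
    (hp : ∀ t, 1 ≤ t → ∀ z, p t z = N t (T t 1 z))
    {v : ℝ → E → E} (hv : SmoothField v)
    {q : ℕ → Seminorm ℝ E} {κ l M D : ℝ} (hM0 : 0 < M)
    (hM : OctaveComparable p M) (hD : 0 < D)
    (hq : ∀ n x, p (2 ^ n) x ≤ D * q n x ∧ q n x ≤ D * p (2 ^ n) x)
    (h : ∀ n : ℕ, FieldBounds (p (2 ^ n)) v (2 ^ n) (2 ^ (n + 1)) (κ / 2 ^ n) (l / 2 ^ n))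
    {H G : E → E} {ρ : ℝ} (hH : ContDiff ℝ 1 H) (hG : ContDiff ℝ 1 G) (hHG : ∀ x, H (G x) = x)
    (hρ : 0 < ρ)
    (hnear : BandSys.NearCocycle q (fun n x => hv.lipschitzField.flow 1 x (2 ^ n)) ρ H)
    (hsmall : ∀ n w, q n (H w) ≤ ρ / 2 → q n (hv.lipschitzField.flow 1 w (2 ^ n)) ≤ ρ) :
    ∃ R ζ : ℝ, 0 < R ∧ 0 < ζ ∧ ∀ t : ℝ, 1 ≤ t → ∀ x, ‖x‖ ≤ ζ / t ^ (3 * ε) →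
      ‖fderiv ℝ (frameLinearization T (fun t x => hv.lipschitzField.flow t x 1) H t) x‖
        ≤ R * t ^ (4 * ε) ∧
      ‖fderiv ℝ (frameDelinearization T (fun t x => hv.lipschitzField.flow 1 x t) G t) x‖
        ≤ R * t ^ (4 * ε) := by
  have hΛ : 0 < 2 * D * M := by positivity
  refine ⟨2 * (2 * D * M) ^ 2 * C, ρ / (2 * (2 * D * M) * C), by positivity, by positivity,
    fun t ht x hx => ?_⟩
  obtain ⟨n, hn1, hn2, hn3⟩ := exists_octave_comparison hv hM0 hM hD hq h ht
  set Λ := 2 * D * M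
  have hpx : Λ * p t (T 1 t x) ≤ ρ / 2 := by
    rw [hp t ht, hT.symm_apply ht le_rfl]
    have := hN.le_of_norm_le hε hC ht (by positivity) hx
    calc Λ * N t x ≤ Λ * (C * (ρ / (2 * Λ * C))) := by gcongr
      _ = ρ / 2 := by field_simp
  have hder : ∀ t x k, fderiv ℝ (fun y => hv.lipschitzField.flow 1 y t) x k
      = hv.varFlow 1 x t k := fun t x k => by rw [(hv.hasFDerivAt_flow 1 x t).fderiv]
  have hφ : ContDiff ℝ 1 fun y => hv.lipschitzField.flow 1 y t :=
    (hv.contDiff_flow 1).comp (contDiff_prodMk_right t)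
  have hψ : ContDiff ℝ 1 fun y => hv.lipschitzField.flow t y 1 :=
    (hv.contDiff_flow_inverse 1).comp (contDiff_prodMk_right t)
  have hφψ : ∀ y, hv.lipschitzField.flow 1 (hv.lipschitzField.flow t y 1) t = y := fun y => by
    rw [hv.lipschitzField.flow_eq (hv.lipschitzField.flow_solves t y), LipschitzField.flow_init]
  have hnear' : ∀ w k, q n (hv.lipschitzField.flow 1 w (2 ^ n)) ≤ ρ →
      q n (fderiv ℝ H w k) ≤ 2 * q n (hv.varFlow 1 w (2 ^ n) k) ∧
      q n (hv.varFlow 1 w (2 ^ n) k) ≤ 2 * q n (fderiv ℝ H w k) := fun w k hw => by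
    have h1 := hnear n w k hw
    simp only [hder] at h1
    refine FieldBounds.comparable_of_sub_le (s := 1) (c := 1 / 8) (h1.trans_eq (by ring))
      (by norm_num)
  constructor
  · refine hN.norm_fderiv_le hT hε hC hp ht
      (B := fun z => H (hv.lipschitzField.flow t z 1))
      ((hH.comp hψ).differentiable one_ne_zero) (by positivity) x fun u => ?_
    rw [fderiv_comp_apply' hH hψ]
    set z := T 1 t x
    set w := hv.lipschitzField.flow t z 1
    set k := fderiv ℝ (fun y => hv.lipschitzField.flow t y 1) z u
    have hk : hv.varFlow 1 w t k = u := by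
      rw [← hder]; exact fderiv_apply_of_inverse hφ hψ hφψ z u
    have hw : q n (hv.lipschitzField.flow 1 w (2 ^ n)) ≤ ρ :=
      (hn2 w).trans (by rw [hφψ]; linarith)
    calc p t (fderiv ℝ H w k) ≤ Λ * (2 * (Λ * p t (hv.varFlow 1 w t k))) := by
          refine (hn1 _).1.trans (mul_le_mul_of_nonneg_left ((hnear' w k hw).1.trans ?_) hΛ.le)
          gcongr
          exact (hn3 w k).2
      _ = _ := by rw [hk]; ring
  · refine hN.norm_fderiv_le hT hε hC hp ht
      (B := fun z => hv.lipschitzField.flow 1 (G z) t)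
      ((hφ.comp hG).differentiable one_ne_zero) (by positivity) x fun u => ?_
    rw [fderiv_comp_apply' hφ hG, hder]
    set z := T 1 t x
    have hw := hsmall n (G z) (by rw [hHG]; exact (hn1 z).2.trans hpx)
    calc p t (hv.varFlow 1 (G z) t (fderiv ℝ G z u)) ≤ Λ * (2 * (Λ * p t u)) := by
          refine (hn3 _ _).1.trans (mul_le_mul_of_nonneg_left ((hnear' _ _ hw).2.trans ?_) hΛ.le)
          rw [fderiv_apply_of_inverse hH hG hHG]
          gcongr
          exact (hn1 u).2
      _ = _ := by ring

end Derivative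

/-- Theorem: `C¹` linearization under nonuniform polynomial dichotomy,
continuous time. -/
theorem c1_linearization_polyDichotomy_continuous {d : ℕ}
    (A : ℝ → (EuclideanSpace ℝ (Fin d) →L[ℝ] EuclideanSpace ℝ (Fin d)))
    (hA : ContinuousOn A (Set.Ici 1))
    (T : ℝ → ℝ → (EuclideanSpace ℝ (Fin d) ≃L[ℝ] EuclideanSpace ℝ (Fin d)))
    (hT : IsEvolutionFamily A T)
    (ε : ℝ) (hε : 0 ≤ ε)
    (hnupd : CNonuniformStrongPolyDichotomyWith T ε)
    (N : ℝ → EuclideanSpace ℝ (Fin d) → ℝ)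
    (hN : ∀ t : ℝ, 1 ≤ t → IsNormOn (N t))
    (hdich : CStrongPolyDichotomyWRT T N)
    (C : ℝ) (hC : 0 < C)
    (hcomp : ∀ t : ℝ, 1 ≤ t → ∀ x : EuclideanSpace ℝ (Fin d),
      ‖x‖ ≤ N t x ∧ N t x ≤ C * t ^ (2 * ε) * ‖x‖)
    (r k : ℕ) (aa bb : ℕ → ℝ)
    (hk : 1 ≤ k) (hkr : k < r)
    (hab : ∀ i : ℕ, 1 ≤ i → i ≤ r → 0 < aa i ∧ aa i ≤ bb i)
    (hord : ∀ i : ℕ, 1 ≤ i → i < r → bb i < aa (i + 1))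
    (hbk : bb k < 1) (hak : 1 < aa (k + 1))
    (hgap : max (bb r) (aa 1)⁻¹ < aa (k + 1) / bb k)
    (hband₁ : ∀ i : ℕ, 1 ≤ i → i ≤ k → bb i / aa i < (bb k)⁻¹)
    (hband₂ : ∀ j : ℕ, k + 1 ≤ j → j ≤ r → bb j / aa j < aa (k + 1))
    (hspec : SigmaPDc T N =
      ⋃ i ∈ Finset.Icc 1 r,
        Set.Icc (Real.log (aa i) / Real.log 2) (Real.log (bb i) / Real.log 2))
    (L : ℝ) (hL : 0 < L) :
    ∃ η₀ : ℝ, 0 < η₀ ∧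
      ∀ η : ℝ, 0 < η → η ≤ η₀ →
        ∀ f : ℝ → EuclideanSpace ℝ (Fin d) → EuclideanSpace ℝ (Fin d),
          ContDiffOn ℝ 1 (fun p : ℝ × EuclideanSpace ℝ (Fin d) => f p.1 p.2)
            (Set.Ici (1 : ℝ) ×ˢ (Set.univ : Set (EuclideanSpace ℝ (Fin d)))) →
          (∀ t : ℝ, 1 ≤ t → f t 0 = 0) →
          (∀ t : ℝ, 1 ≤ t → fderiv ℝ (f t) 0 = 0) →
          (∀ t : ℝ, 1 ≤ t → ∀ x : EuclideanSpace ℝ (Fin d),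
            ‖fderiv ℝ (f t) x‖ ≤ η / t ^ (1 + 4 * ε)) →
          (∀ t : ℝ, 1 ≤ t → ∀ x y : EuclideanSpace ℝ (Fin d),
            ‖fderiv ℝ (f t) x - fderiv ℝ (f t) y‖ ≤ L / t ^ (1 + 5 * ε) * ‖x - y‖) →
          ∃ H G : ℝ → EuclideanSpace ℝ (Fin d) → EuclideanSpace ℝ (Fin d),
            ContDiffOn ℝ 1 (fun p : ℝ × EuclideanSpace ℝ (Fin d) => H p.1 p.2)
              (Set.Ici (1 : ℝ) ×ˢ (Set.univ : Set (EuclideanSpace ℝ (Fin d)))) ∧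
            ContDiffOn ℝ 1 (fun p : ℝ × EuclideanSpace ℝ (Fin d) => G p.1 p.2)
              (Set.Ici (1 : ℝ) ×ˢ (Set.univ : Set (EuclideanSpace ℝ (Fin d)))) ∧
            (∀ u : ℝ → EuclideanSpace ℝ (Fin d),
              IsSemilinSolution A f u → IsLinSolution A (fun t => H t (u t))) ∧
            (∀ u : ℝ → EuclideanSpace ℝ (Fin d),
              IsLinSolution A u → IsSemilinSolution A f (fun t => G t (u t))) ∧
            (∀ t : ℝ, 1 ≤ t → ∀ x : EuclideanSpace ℝ (Fin d),
              H t (G t x) = x ∧ G t (H t x) = x) ∧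
            ∃ R ζ : ℝ, 0 < R ∧ 0 < ζ ∧
              ∀ t : ℝ, 1 ≤ t → ∀ x : EuclideanSpace ℝ (Fin d),
                ‖x‖ ≤ ζ / t ^ (3 * ε) →
                  ‖fderiv ℝ (H t) x‖ ≤ R * t ^ (4 * ε) ∧
                  ‖fderiv ℝ (G t) x‖ ≤ R * t ^ (4 * ε) := by
  have hTT := hT.2.1
  have hcomp' : NormComparable N C ε := hcomp
  obtain ⟨p, hp⟩ := exists_frameSeminorm T hN
  obtain ⟨K, a, hK, ha, hgrowth⟩ := frame_growth hp hTT hdich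
  have hM0 : 0 < K * 2 ^ a := by positivity
  have hM := octaveComparable_of_growth hK ha hgrowth
  set M := K * 2 ^ a
  have hab' : ∀ i, i < r → 0 < aa (i + 1) ∧ aa (i + 1) ≤ bb (i + 1) := fun i hi =>
    hab (i + 1) (by omega) (by omega)
  have hord' : ∀ i, i + 1 < r → bb (i + 1) < aa (i + 1 + 1) := fun i hi =>
    hord (i + 1) (by omega) (by omega)
  have hk1 : k - 1 + 1 = k := by omega
  have hr1 : r - 1 + 1 = r := by omega
  obtain ⟨α, β, μ, μ', ω, γ, σ, δ, hW, hαβ⟩ := exists_weights (a := fun i => aa (i + 1))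
    (b := fun i => bb (i + 1)) hk hkr hab' hord' (by rwa [hk1]) hak
    (by rw [hk1, hr1]; exact (le_max_left _ _).trans_lt hgap)
    (by rw [hk1]; exact (le_max_right _ _).trans_lt hgap)
    (fun i hi => by rw [hk1]; exact hband₁ (i + 1) (by omega) (by omega))
    (fun i hki hi => hband₂ (i + 1) (by omega) (by omega))
  obtain ⟨P, q, D, hbands, hD, hq⟩ := exists_bands hp hTT hN hdich (by omega : 0 < r) hab' hord'
    (fun τ hτ => by
      rw [hspec] at hτ
      obtain ⟨i, hi, h⟩ := Set.mem_iUnion₂.1 hτ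
      rw [Finset.mem_Icc] at hi
      exact ⟨i - 1, by omega, by rw [Nat.sub_add_cancel hi.1]; exact h⟩) hαβ
  have hδ := hW.δ_pos
  refine ⟨min (1 / (4 * (C * M ^ 2))) (δ / 1000 / (4 * M * D ^ 2 * (C * M ^ 2))),
    by positivity, fun η hη hη₀ f hf hf0 hf0' hfη hfL => ?_⟩
  have hη1 := hη₀.trans (min_le_left _ _)
  have hη2 := hη₀.trans (min_le_right _ _)
  rw [le_div_iff₀ (by positivity)] at hη1 hη2
  have hB : ∀ t, 1 ≤ t → ∀ x, ‖fderiv ℝ (f t) x‖ ≤ η.toNNReal := fun t ht x => by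
    rw [Real.coe_toNNReal _ hη.le]
    exact (hfη t ht x).trans (div_le_self hη.le (Real.one_le_rpow ht (by positivity)))
  have hlip : ∀ t, 1 ≤ t → LipschitzWith η.toNNReal (f t) := fun t ht =>
    lipschitzWith_of_nnnorm_fderiv_le
      (fun x => (differentiable_section hf ht x).differentiableAt) (hB t ht)
  have hv := smoothField_frameField hA hT hf hB
  have hfield := fieldBounds_frameField hT hf hf0 hf0' hfη hfL hε hC hη.le hL.le hp hcomp' hM0 hM
    (by linarith)
  have hsys := orbitSys_of_fieldBounds hv (by positivity) (by positivity) hM0 hM hD hq hfield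
  have hsystem : BandSys r k P q α β μ μ' ω γ σ δ _ _ _ :=
    ⟨hbands, hW, hsys, by positivity, by linarith, by positivity⟩
  have hψφ : ∀ t x, hv.lipschitzField.flow t (hv.lipschitzField.flow 1 x t) 1 = x :=
    fun t x => by
      rw [hv.lipschitzField.flow_eq (hv.lipschitzField.flow_solves 1 x), LipschitzField.flow_init]
  have hφψ : ∀ t x, hv.lipschitzField.flow 1 (hv.lipschitzField.flow t x 1) t = x :=
    fun t x => by
      rw [hv.lipschitzField.flow_eq (hv.lipschitzField.flow_solves t x), LipschitzField.flow_init]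
  obtain ⟨H, G, ρ, hH, hG, hGH, hHG, hρ, hnear, hsmall⟩ := hsystem.exists_linearization
    (Ψ := fun n x => hv.lipschitzField.flow (2 ^ n) x 1)
    (fun n => (hv.contDiff_flow_inverse 1).comp (contDiff_prodMk_right ((2 : ℝ) ^ n)))
    (fun n x => hφψ _ x) (fun n x => hψφ _ x)
  have hTd := hT.contDiffOn hA
  have hTs := hT.contDiffOn_symm hA
  exact ⟨frameLinearization T (fun t x => hv.lipschitzField.flow t x 1) H,
    frameDelinearization T (fun t x => hv.lipschitzField.flow 1 x t) G,
    contDiffOn_frameLinearization hTd hTs (hv.contDiff_flow_inverse 1) hH,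
    contDiffOn_frameDelinearization hTd hTs (hv.contDiff_flow 1) hG,
    fun u hu => frameLinearization_comp hA hT hlip hv.lipschitzField H hu,
    fun u hu => frameDelinearization_comp hA hT hv.lipschitzField G hu,
    fun t ht x => frameLinearization_inverse hT hψφ hφψ hGH hHG ht x,
    exists_derivative_bounds hcomp' hT hε hC hp hv hM0 hM hD hq hfield hH hG hHG hρ hnear hsmall⟩

end NonautLin
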